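/- Fix an integer k ≥ 2 and an integer r ≥ 0; let ω_k be the unique solution in (0,1) of -kω = ln(1-ω), and c_k = ω_k^k/2. For each n, let P_n(r) be the probability, for δ uniformly random among accessible transition structures on n states over a k-letter alphabet, that δ contains no three-state M-motif and contains exactly r M-motifs. Set ρ_n = c_k·n^{2-k}. Then P_n(r)/(e^{-ρ_n}·ρ_n^r/r!) → 1 as n → ∞. -/

import Mathlib

open scoped Classical BigOperators

namespace ArxivAutomata

/-- Extension of a transition structure to words: `run δ p u = δ(p, u)`. -/
def run {n k : ℕ} (δ : Fin n → Fin k → Fin n) (p : Fin n) (u : List (Fin k)) : Fin n :=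
  u.foldl δ p

/-- A transition structure is accessible if every state is reachable from the
initial state (the state with index 0, representing state 1). -/
def Accessible {n k : ℕ} (δ : Fin n → Fin k → Fin n) : Prop :=
  ∀ q : Fin n, ∃ u : List (Fin k), run δ ⟨0, Fin.pos q⟩ u = q

/-- The finite set of accessible transition structures on `n` states over a
`k`-letter alphabet. -/
noncomputable def accSet (n k : ℕ) : Finset (Fin n → Fin k → Fin n) :=
  Finset.univ.filter fun δ => Accessible δ

/-- Myhill–Nerode equivalence of two states. -/
def MNEquiv {n k : ℕ} (δ : Fin n → Fin k → Fin n) (T : Finset (Fin n)) (p q : Fin n) : Prop :=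
  ∀ u : List (Fin k), run δ p u ∈ T ↔ run δ q u ∈ T

/-- An automaton is minimal if Myhill–Nerode equivalent states are equal. -/
def Minimal {n k : ℕ} (δ : Fin n → Fin k → Fin n) (T : Finset (Fin n)) : Prop :=
  ∀ p q : Fin n, MNEquiv δ T p q → p = q

/-- `{i, j}` is an M-motif: `i ≠ j` and `δ_a(i) = δ_a(j)` for every letter `a`. -/
def IsMMotif {n k : ℕ} (δ : Fin n → Fin k → Fin n) (i j : Fin n) : Prop :=
  i ≠ j ∧ ∀ a : Fin k, δ i a = δ j a

/-- `{i, j, h}` is a three-state M-motif. -/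
def IsM3Motif {n k : ℕ} (δ : Fin n → Fin k → Fin n) (i j h : Fin n) : Prop :=
  i ≠ j ∧ i ≠ h ∧ j ≠ h ∧ ∀ a : Fin k, δ i a = δ j a ∧ δ j a = δ h a

/-- `δ` contains some three-state M-motif. -/
def HasM3 {n k : ℕ} (δ : Fin n → Fin k → Fin n) : Prop :=
  ∃ i j h, IsM3Motif δ i j h

/-- The number of M-motifs of `δ` (unordered pairs counted via `i < j`). -/
noncomputable def mCount {n k : ℕ} (δ : Fin n → Fin k → Fin n) : ℕ :=
  (Finset.univ.filter fun p : Fin n × Fin n =>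
    p.1 < p.2 ∧ ∀ a : Fin k, δ p.1 a = δ p.2 a).card

/-- The number of three-state M-motifs of `δ` (unordered triples via `i < j < h`). -/
noncomputable def m3Count {n k : ℕ} (δ : Fin n → Fin k → Fin n) : ℕ :=
  (Finset.univ.filter fun p : Fin n × Fin n × Fin n =>
    p.1 < p.2.1 ∧ p.2.1 < p.2.2 ∧
      ∀ a : Fin k, δ p.1 a = δ p.2.1 a ∧ δ p.2.1 a = δ p.2.2 a).card

/-- The Bernoulli measure of parameter `b` of a set of terminal states. -/
noncomputable def bern (b : ℝ) {n : ℕ} (T : Finset (Fin n)) : ℝ :=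
  b ^ T.card * (1 - b) ^ (n - T.card)

section

open Filter Topology

/-- Weighted one-letter step of the exploration: with `m` discovered states the letter leads to one
of them or to a new one. -/
def letterStep (f : ℕ → ℝ) (m : ℕ) : ℝ := m * f m + f (m + 1)

/-- `cplAux n k q m` counts, up to relabelling, the completions of an exploration with `m`
discovered states and `q` letters left. -/
noncomputable def cplAux (n k : ℕ) : ℕ → ℕ → ℝ
  | 0, m => if m = n then 1 else 0
  | q + 1, m => if k * n ≤ k * m + q then letterStep (cplAux n k q) m else 0

/-- `cpl n k p m` counts, up to relabelling, the completions of an exploration that has read `p`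
letters and discovered `m` states. -/
noncomputable def cpl (n k p m : ℕ) : ℝ := cplAux n k (k * n - p) m

lemma cpl_end (n k m : ℕ) : cpl n k (k * n) m = if m = n then 1 else 0 := by
  simp [cpl, cplAux]

lemma cpl_rec {n k p : ℕ} (hp : p < k * n) (m : ℕ) :
    cpl n k p m =
      if p < k * m then m * cpl n k (p + 1) m + cpl n k (p + 1) (m + 1) else 0 := by
  obtain ⟨q, hq⟩ : ∃ q, k * n = p + q + 1 := ⟨k * n - p - 1, by omega⟩
  have h1 : k * n - p = q + 1 := by omega
  have h2 : k * n - (p + 1) = q := by omega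
  simp only [cpl, h1, h2, cplAux, letterStep]
  congr 1
  simp only [eq_iff_iff]
  omega

lemma cplAux_nonneg (n k q m : ℕ) : 0 ≤ cplAux n k q m := by
  induction q generalizing m with
  | zero => simp only [cplAux]; split_ifs <;> norm_num
  | succ q ih =>
    simp only [cplAux, letterStep]
    have h1 := ih m
    have h2 := ih (m + 1)
    split_ifs <;> positivity

lemma cpl_nonneg (n k p m : ℕ) : 0 ≤ cpl n k p m := cplAux_nonneg _ _ _ _

lemma cplAux_eq_zero_of_lt {n k m : ℕ} (q : ℕ) (h : n < m) : cplAux n k q m = 0 := by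
  induction q generalizing m with
  | zero => simp [cplAux, h.ne']
  | succ q ih => simp [cplAux, letterStep, ih h, ih (h.trans (Nat.lt_succ_self m))]

lemma cpl_eq_zero_of_lt {n k p m : ℕ} (h : n < m) : cpl n k p m = 0 := cplAux_eq_zero_of_lt _ h

lemma cpl_eq_zero_of_le {n k p m : ℕ} (hp : p ≤ k * n) (h : k * m ≤ p) (hm : m ≠ n) :
    cpl n k p m = 0 := by
  rcases hp.lt_or_eq with h' | rfl
  · rw [cpl_rec h', if_neg (by omega)]
  · rw [cpl_end, if_neg hm]

lemma cpl_le_step {n k p : ℕ} (hp : p < k * n) (m : ℕ) :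
    cpl n k p m ≤ m * cpl n k (p + 1) m + cpl n k (p + 1) (m + 1) := by
  rw [cpl_rec hp]
  have h1 := cpl_nonneg n k (p + 1) m
  have h2 := cpl_nonneg n k (p + 1) (m + 1)
  split_ifs
  · exact le_rfl
  · positivity

lemma cpl_top {n k p : ℕ} (hp : p ≤ k * n) : cpl n k p n = (n : ℝ) ^ (k * n - p) := by
  obtain ⟨q, hq⟩ : ∃ q, p + q = k * n := ⟨k * n - p, by omega⟩
  induction q generalizing p with
  | zero => obtain rfl : p = k * n := by omega
            simp [cpl_end]
  | succ q ih =>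
    rw [cpl_rec (by omega), if_pos (by omega), ih (by omega) (by omega),
      cpl_eq_zero_of_lt (Nat.lt_succ_self n), add_zero, ← pow_succ']
    congr 1
    omega

lemma cpl_pos {n k p m : ℕ} (hp : p < k * m) (hm : m ≤ n) : 0 < cpl n k p m := by
  obtain ⟨d, hd⟩ := Nat.exists_eq_add_of_le hm
  induction d generalizing p m with
  | zero =>
    obtain rfl : n = m := by omega
    rw [cpl_top hp.le]
    have : 0 < n := Nat.pos_of_ne_zero fun h => by simp [h] at hp
    positivity
  | succ d ih =>
    have hk : 0 < k := Nat.pos_of_ne_zero fun h => by simp [h] at hp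
    have h1 : k * m < k * n := Nat.mul_lt_mul_of_pos_left (by omega) hk
    rw [cpl_rec (by omega), if_pos hp]
    have h3 := ih (p := p + 1) (m := m + 1) (by rw [Nat.mul_succ]; omega) (by omega) (by omega)
    have := cpl_nonneg n k (p + 1) m
    positivity

lemma cpl_pos_iff {n k p m : ℕ} (hp : p < k * n) : 0 < cpl n k p m ↔ p < k * m ∧ m ≤ n := by
  refine ⟨fun h => ⟨?_, ?_⟩, fun h => cpl_pos h.1 h.2⟩
  · by_contra h'
    rw [cpl_rec hp, if_neg h'] at h
    exact h.false
  · by_contra h'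
    rw [cpl_eq_zero_of_lt (by omega)] at h
    exact h.false

/-- The ratio of consecutive completion numbers is nondecreasing in the number of states. -/
lemma cpl_ratio_mono_states {n k p : ℕ} (hp : p < k * n) (m : ℕ) :
    cpl n k (p + 1) m * cpl n k p (m + 1) ≤ cpl n k (p + 1) (m + 1) * cpl n k p m := by
  obtain ⟨q, hq⟩ : ∃ q, k * n = p + q + 1 := ⟨k * n - p - 1, by omega⟩
  induction q generalizing p m with
  | zero =>
    have : p + 1 = k * n := by omega
    rw [this, cpl_end, cpl_end]
    by_cases h : m = n
    · subst h
      simp [cpl_eq_zero_of_lt (Nat.lt_succ_self m)]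
    · rw [if_neg h, zero_mul]
      exact mul_nonneg (by split_ifs <;> norm_num) (cpl_nonneg _ _ _ _)
  | succ q ih =>
    by_cases hv : p + 1 < k * m
    swap
    · rw [cpl_rec (p := p + 1) (by omega), if_neg hv, zero_mul]
      exact mul_nonneg (cpl_nonneg _ _ _ _) (cpl_nonneg _ _ _ _)
    rcases Nat.lt_or_ge n (m + 1) with hmn | hmn
    · simp [cpl_eq_zero_of_lt hmn]
    have hk : k * (m + 1) = k * m + k := Nat.mul_succ _ _
    have hk0 : 0 < k := Nat.pos_of_ne_zero fun h => by simp [h] at hv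
    have i1 := ih (p := p + 1) (by omega) m (by omega)
    have i2 := ih (p := p + 1) (by omega) (m + 1) (by omega)
    have e1 := cpl_rec (n := n) (k := k) (p := p) (by omega) m
    have e2 := cpl_rec (n := n) (k := k) (p := p) (by omega) (m + 1)
    have e3 := cpl_rec (n := n) (k := k) (p := p + 1) (by omega) m
    have e4 := cpl_rec (n := n) (k := k) (p := p + 1) (by omega) (m + 1)
    rw [if_pos (by omega)] at e1 e2 e3 e4
    have n1 := cpl_nonneg n k (p + 1) m
    have y0 : 0 < cpl n k (p + 1) (m + 1) := cpl_pos (by omega) hmn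
    have n3 := cpl_nonneg n k (p + 1) (m + 2)
    have n4 := cpl_nonneg n k (p + 2) m
    have n5 := cpl_nonneg n k (p + 2) (m + 1)
    have n6 := cpl_nonneg n k (p + 2) (m + 2)
    simp only [add_assoc, Nat.reduceAdd] at *
    set x := cpl n k (p + 1) m
    set y := cpl n k (p + 1) (m + 1)
    set w := cpl n k (p + 1) (m + 2)
    set x' := cpl n k (p + 2) m
    set y' := cpl n k (p + 2) (m + 1)
    set w' := cpl n k (p + 2) (m + 2)
    -- the diagonal ratio separates the two sides
    have d1 : x * y ≤ y' * cpl n k p m := by rw [e1]; nlinarith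
    have d2 : y' * cpl n k p (m + 1) ≤ y * y := by
      rw [e2]; nlinarith
    have hB1 := cpl_nonneg n k p m
    have hB2 := cpl_nonneg n k p (m + 1)
    refine le_of_mul_le_mul_right ?_ y0
    calc x * cpl n k p (m + 1) * y = (x * y) * cpl n k p (m + 1) := by ring
      _ ≤ (y' * cpl n k p m) * cpl n k p (m + 1) := by gcongr
      _ = (y' * cpl n k p (m + 1)) * cpl n k p m := by ring
      _ ≤ (y * y) * cpl n k p m := by gcongr
      _ = y * cpl n k p m * y := by ring

/-- The completion numbers are log-concave in the number of letters read. -/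
lemma cpl_log_concave {n k p : ℕ} (hp : p + 1 < k * n) (m : ℕ) :
    cpl n k p m * cpl n k (p + 2) m ≤ cpl n k (p + 1) m * cpl n k (p + 1) m := by
  have h := cpl_ratio_mono_states hp m
  have n1 := cpl_nonneg n k (p + 1) m
  have n4 := cpl_nonneg n k (p + 2) m
  by_cases hv : p + 1 < k * m
  · have e1 := cpl_rec (n := n) (k := k) (p := p) (by omega) m
    have e3 := cpl_rec (n := n) (k := k) (p := p + 1) (by omega) m
    rw [if_pos (by omega)] at e1 e3
    simp only [add_assoc, Nat.reduceAdd] at *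
    calc cpl n k p m * cpl n k (p + 2) m
        = m * cpl n k (p + 1) m * cpl n k (p + 2) m
          + cpl n k (p + 2) m * cpl n k (p + 1) (m + 1) := by rw [e1]; ring
      _ ≤ m * cpl n k (p + 1) m * cpl n k (p + 2) m
          + cpl n k (p + 2) (m + 1) * cpl n k (p + 1) m := by linarith
      _ = cpl n k (p + 1) m * (m * cpl n k (p + 2) m + cpl n k (p + 2) (m + 1)) := by ring
      _ = _ := by rw [← e3]
  · have hm : m ≠ n := by rintro rfl; omega
    rw [cpl_eq_zero_of_le (p := p + 2) (by omega) (by omega) hm]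
    simp [mul_self_nonneg]

lemma mul_cpl_succ_le {n k p : ℕ} (hp : p < k * n) (m : ℕ) :
    n * cpl n k (p + 1) m ≤ cpl n k p m := by
  by_cases hv : p < k * m
  swap
  · have hm : m ≠ n := by rintro rfl; omega
    rw [cpl_eq_zero_of_le (p := p + 1) (by omega) (by omega) hm, mul_zero]
    exact cpl_nonneg _ _ _ _
  rcases Nat.lt_or_ge n m with h | h
  · simp [cpl_eq_zero_of_lt h]
  obtain ⟨d, hd⟩ := Nat.exists_eq_add_of_le h
  induction d generalizing m with
  | zero =>
    obtain rfl : n = m := by omega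
    rw [cpl_top (by omega), cpl_top (by omega), ← pow_succ']
    exact le_of_eq (congrArg _ (by omega))
  | succ d ih =>
    have hk0 : 0 < k := Nat.pos_of_ne_zero fun h => by simp [h] at hv
    have hk : k * (m + 1) = k * m + k := Nat.mul_succ _ _
    have i := ih (m + 1) (by omega) (by omega) (by omega)
    have hM := cpl_ratio_mono_states hp m
    have y0 : 0 < cpl n k (p + 1) (m + 1) := cpl_pos (by omega) (by omega)
    have n1 := cpl_nonneg n k (p + 1) m
    refine le_of_mul_le_mul_right ?_ y0
    calc (n : ℝ) * cpl n k (p + 1) m * cpl n k (p + 1) (m + 1)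
        = cpl n k (p + 1) m * (n * cpl n k (p + 1) (m + 1)) := by ring
      _ ≤ cpl n k (p + 1) m * cpl n k p (m + 1) := by gcongr
      _ ≤ _ := by linarith

/-- Probability that the exploration conditioned to end with `n` states discovers no new state
at its letter number `p`, when `m` states are discovered. -/
noncomputable def stay (n k p m : ℕ) : ℝ := m * cpl n k (p + 1) m / cpl n k p m

/-- One-step averaging operator of the conditioned exploration. -/
noncomputable def avg (n k p : ℕ) (f : ℕ → ℝ) (m : ℕ) : ℝ :=
  stay n k p m * f m + (1 - stay n k p m) * f (m + 1)

/-- Expectation of `f` at time `p + t` for the conditioned exploration started with `m` states at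
time `p`. -/
noncomputable def chainE (n k : ℕ) : ℕ → ℕ → (ℕ → ℝ) → ℕ → ℝ
  | _, 0, f => f
  | p, t + 1, f => avg n k p (chainE n k (p + 1) t f)

section Chain

variable {n k : ℕ}

lemma stay_nonneg (p m : ℕ) : 0 ≤ stay n k p m :=
  div_nonneg (mul_nonneg (Nat.cast_nonneg _) (cpl_nonneg _ _ _ _)) (cpl_nonneg _ _ _ _)

lemma cpl_rec_of_pos {p m : ℕ} (hp : p < k * n) (h : 0 < cpl n k p m) :
    cpl n k p m = m * cpl n k (p + 1) m + cpl n k (p + 1) (m + 1) := by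
  have h' := (cpl_pos_iff hp).1 h
  rw [cpl_rec hp, if_pos h'.1]

lemma one_sub_stay {p m : ℕ} (hp : p < k * n) (h : 0 < cpl n k p m) :
    1 - stay n k p m = cpl n k (p + 1) (m + 1) / cpl n k p m := by
  rw [stay, eq_div_iff h.ne', sub_mul, div_mul_cancel₀ _ h.ne', one_mul]
  linarith [cpl_rec_of_pos hp h]

lemma stay_le_one {p m : ℕ} (hp : p < k * n) (h : 0 < cpl n k p m) : stay n k p m ≤ 1 := by
  have := one_sub_stay hp h
  have h2 : 0 ≤ cpl n k (p + 1) (m + 1) / cpl n k p m :=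
    div_nonneg (cpl_nonneg _ _ _ _) (cpl_nonneg _ _ _ _)
  linarith

lemma avg_eq_div {p m : ℕ} (hp : p < k * n) (h : 0 < cpl n k p m) (f : ℕ → ℝ) :
    avg n k p f m =
      (m * cpl n k (p + 1) m * f m + cpl n k (p + 1) (m + 1) * f (m + 1)) / cpl n k p m := by
  rw [avg, one_sub_stay hp h, stay]
  ring

lemma avg_mono {p m : ℕ} (hp : p < k * n) (h : 0 < cpl n k p m) {f g : ℕ → ℝ}
    (hfg : ∀ m', 0 < cpl n k (p + 1) m' → m ≤ m' → m' ≤ m + 1 → f m' ≤ g m') :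
    avg n k p f m ≤ avg n k p g m := by
  rw [avg_eq_div hp h, avg_eq_div hp h]
  refine div_le_div_of_nonneg_right (add_le_add ?_ ?_) h.le
  · rcases (cpl_nonneg n k (p + 1) m).eq_or_lt with h0 | h0
    · simp [← h0]
    · exact mul_le_mul_of_nonneg_left (hfg m h0 le_rfl (Nat.le_succ m)) (by positivity)
  · rcases (cpl_nonneg n k (p + 1) (m + 1)).eq_or_lt with h0 | h0
    · simp [← h0]
    · exact mul_le_mul_of_nonneg_left (hfg (m + 1) h0 (Nat.le_succ m) le_rfl) h0.le

lemma avg_const_mul (p : ℕ) (a : ℝ) (f : ℕ → ℝ) (m : ℕ) :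
    avg n k p (fun x => a * f x) m = a * avg n k p f m := by
  simp only [avg]; ring

lemma avg_const (p : ℕ) (a : ℝ) (m : ℕ) : avg n k p (fun _ => a) m = a := by
  simp only [avg]; ring

lemma chainE_add (p t : ℕ) (f g : ℕ → ℝ) (m : ℕ) :
    chainE n k p t (fun x => f x + g x) m = chainE n k p t f m + chainE n k p t g m := by
  induction t generalizing p m with
  | zero => rfl
  | succ t ih => simp only [chainE, avg, ih]; ring

lemma chainE_const_mul (p t : ℕ) (a : ℝ) (f : ℕ → ℝ) (m : ℕ) :
    chainE n k p t (fun x => a * f x) m = a * chainE n k p t f m := by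
  induction t generalizing p m with
  | zero => rfl
  | succ t ih => simp only [chainE, avg, ih]; ring

lemma chainE_const (p t : ℕ) (a : ℝ) (m : ℕ) : chainE n k p t (fun _ => a) m = a := by
  induction t generalizing p m with
  | zero => rfl
  | succ t ih => simp only [chainE, avg, ih]; ring

lemma chainE_sub (p t : ℕ) (f g : ℕ → ℝ) (m : ℕ) :
    chainE n k p t (fun x => f x - g x) m = chainE n k p t f m - chainE n k p t g m := by
  have := chainE_add (n := n) (k := k) p t f (fun x => (-1) * g x) m
  rw [chainE_const_mul] at this
  rw [sub_eq_add_neg, ← neg_one_mul, ← this]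
  congr 1
  funext x
  ring

/-- Markov property. -/
lemma chainE_chainE (p s t : ℕ) (f : ℕ → ℝ) :
    chainE n k p (s + t) f = chainE n k p s (chainE n k (p + s) t f) := by
  induction s generalizing p with
  | zero => simp [chainE]
  | succ s ih =>
    rw [Nat.succ_add, chainE, ih, chainE]
    congr 3
    omega

lemma chainE_succ (p t : ℕ) (f : ℕ → ℝ) :
    chainE n k p (t + 1) f = chainE n k p t (avg n k (p + t) f) := by
  rw [chainE_chainE]; rfl

lemma chainE_mono' {p t m : ℕ} (hp : p + t ≤ k * n) (h : 0 < cpl n k p m) {f g : ℕ → ℝ}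
    (hfg : ∀ m', 0 < cpl n k (p + t) m' → m ≤ m' → m' ≤ m + t → f m' ≤ g m') :
    chainE n k p t f m ≤ chainE n k p t g m := by
  induction t generalizing p m with
  | zero => exact hfg m h le_rfl le_rfl
  | succ t ih =>
    refine avg_mono (by omega) h fun m' hm' h1 h2 => ih (by omega) hm' fun m'' hm'' h3 h4 => ?_
    exact hfg m'' (by rwa [show p + (t + 1) = p + 1 + t by omega]) (by omega) (by omega)

lemma chainE_mono {p t m : ℕ} (hp : p + t ≤ k * n) (h : 0 < cpl n k p m) {f g : ℕ → ℝ}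
    (hfg : ∀ m', 0 < cpl n k (p + t) m' → f m' ≤ g m') :
    chainE n k p t f m ≤ chainE n k p t g m :=
  chainE_mono' hp h fun m' h' _ _ => hfg m' h'

/-- A function whose one-step average exceeds it by at most `e` grows at most linearly. -/
lemma chainE_le_add {p t m : ℕ} (hp : p + t ≤ k * n) (h : 0 < cpl n k p m) {F : ℕ → ℕ → ℝ} {e : ℝ}
    (hF : ∀ q m', p ≤ q → q < p + t → 0 < cpl n k q m' →
      avg n k q (F (q + 1)) m' ≤ F q m' + e) :
    chainE n k p t (F (p + t)) m ≤ F p m + t * e := by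
  induction t with
  | zero => simp [chainE]
  | succ t ih =>
    have ih := ih (by omega) fun q m' h1 h2 h3 => hF q m' h1 (by omega) h3
    rw [chainE_succ]
    have h1 := chainE_mono (p := p) (t := t) (n := n) (k := k) (m := m) (by omega) h
      (f := avg n k (p + t) (F (p + (t + 1)))) (g := fun x => F (p + t) x + e)
      fun m' hm' => hF (p + t) m' (by omega) (by omega) hm'
    rw [chainE_add, chainE_const] at h1
    push_cast
    linarith

end Chain

/-- The relative weight of the completions after `l` letters discovering nothing. -/
noncomputable def runRatio (n k l p m : ℕ) : ℝ := n ^ l * cpl n k (p + l) m / cpl n k p m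

section RunRatio

variable {n k : ℕ}

lemma runRatio_nonneg (l p m : ℕ) : 0 ≤ runRatio n k l p m :=
  div_nonneg (mul_nonneg (by positivity) (cpl_nonneg _ _ _ _)) (cpl_nonneg _ _ _ _)

lemma runRatio_zero {p m : ℕ} (h : 0 < cpl n k p m) : runRatio n k 0 p m = 1 := by
  simp [runRatio, h.ne']

lemma runRatio_succ {l p m : ℕ} (h : 0 < cpl n k (p + l) m) :
    runRatio n k (l + 1) p m = runRatio n k l p m * runRatio n k 1 (p + l) m := by
  simp only [runRatio, pow_one, ← add_assoc]
  rw [pow_succ]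
  field_simp

lemma runRatio_one_le {p m : ℕ} (hp : p < k * n) : runRatio n k 1 p m ≤ 1 := by
  simp only [runRatio, pow_one]
  exact div_le_one_of_le₀ (mul_cpl_succ_le hp m) (cpl_nonneg _ _ _ _)

lemma cpl_pos_of_succ {p m : ℕ} (hp : p < k * n) (h : 0 < cpl n k (p + 1) m) :
    0 < cpl n k p m := by
  have hn : 0 < n := Nat.pos_of_ne_zero fun h => by simp [h] at hp
  have := mul_cpl_succ_le hp m
  have : 0 < (n : ℝ) * cpl n k (p + 1) m := by positivity
  linarith

lemma cpl_pos_of_add {p m l : ℕ} (hp : p + l ≤ k * n) (h : 0 < cpl n k (p + l) m) :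
    0 < cpl n k p m := by
  induction l with
  | zero => exact h
  | succ l ih => exact ih (by omega) (cpl_pos_of_succ (by omega) h)

lemma runRatio_le_one {l p m : ℕ} (hp : p + l ≤ k * n) (h : 0 < cpl n k p m) :
    runRatio n k l p m ≤ 1 := by
  induction l with
  | zero => simp [runRatio_zero h]
  | succ l ih =>
    by_cases h0 : 0 < cpl n k (p + l) m
    · rw [runRatio_succ h0]
      exact mul_le_one₀ (ih (by omega)) (runRatio_nonneg _ _ _) (runRatio_one_le (by omega))
    · have h1 : ¬ 0 < cpl n k (p + (l + 1)) m := fun h1 => h0 (cpl_pos_of_succ (by omega) h1)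
      have h2 : cpl n k (p + (l + 1)) m = 0 := le_antisymm (not_lt.1 h1) (cpl_nonneg _ _ _ _)
      simp [runRatio, h2]

lemma runRatio_one_mono {p m : ℕ} (hp : p < k * n) (h : 0 < cpl n k p m)
    (h' : 0 < cpl n k p (m + 1)) : runRatio n k 1 p m ≤ runRatio n k 1 p (m + 1) := by
  simp only [runRatio, pow_one]
  rw [div_le_div_iff₀ h h', mul_assoc, mul_assoc]
  exact mul_le_mul_of_nonneg_left (cpl_ratio_mono_states hp m) (Nat.cast_nonneg _)

lemma runRatio_one_antitone {p m : ℕ} (hp : p + 1 < k * n) (h : 0 < cpl n k (p + 1) m) :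
    runRatio n k 1 (p + 1) m ≤ runRatio n k 1 p m := by
  have h0 := cpl_pos_of_succ (by omega) h
  simp only [runRatio, pow_one]
  rw [div_le_div_iff₀ h h0, mul_assoc, mul_assoc]
  have := cpl_log_concave hp m
  refine mul_le_mul_of_nonneg_left ?_ (Nat.cast_nonneg _)
  simp only [add_assoc, Nat.reduceAdd]
  linarith

lemma stay_eq {p m : ℕ} (hn : 0 < n) : stay n k p m = m / n * runRatio n k 1 p m := by
  have : (n : ℝ) ≠ 0 := by positivity
  simp only [stay, runRatio, pow_one]
  field_simp

/-- The averaged weight of a run differs from the weight only near the boundary. -/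
lemma avg_runRatio {l p m : ℕ} (hp : p + 1 + l ≤ k * n) (h : 0 < cpl n k p m) :
    avg n k p (runRatio n k l (p + 1)) m
      = n ^ l * (m * cpl n k (p + 1 + l) m + cpl n k (p + 1 + l) (m + 1)) / cpl n k p m := by
  rw [avg_eq_div (by omega) h]
  congr 1
  have key : ∀ x, cpl n k (p + 1) x * runRatio n k l (p + 1) x = n ^ l * cpl n k (p + 1 + l) x := by
    intro x
    by_cases h0 : 0 < cpl n k (p + 1) x
    · rw [runRatio]
      field_simp
    · have h1 : ¬ 0 < cpl n k (p + 1 + l) x := fun h1 => h0 (cpl_pos_of_add hp h1)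
      have e0 := le_antisymm (not_lt.1 h0) (cpl_nonneg _ _ _ _)
      have e1 := le_antisymm (not_lt.1 h1) (cpl_nonneg _ _ _ _)
      simp [e0, e1]
  rw [mul_assoc, key, key]
  ring

lemma runRatio_le_avg {l p m : ℕ} (hp : p + 1 + l ≤ k * n) (h : 0 < cpl n k p m) :
    runRatio n k l p m ≤ avg n k p (runRatio n k l (p + 1)) m := by
  rw [avg_runRatio hp h, runRatio]
  have := cpl_le_step (n := n) (k := k) (p := p + l) (by omega) m
  rw [show p + l + 1 = p + 1 + l by omega] at this
  gcongr

lemma avg_runRatio_le {l p m : ℕ} (hp : p + 1 + l ≤ k * n) (h : 0 < cpl n k p m) :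
    avg n k p (runRatio n k l (p + 1)) m
      ≤ runRatio n k l p m + if k * m ≤ p + l then 1 else 0 := by
  split_ifs with hb
  · have : avg n k p (runRatio n k l (p + 1)) m ≤ avg n k p (fun _ => 1) m :=
      avg_mono (by omega) h fun m' hm' _ _ => runRatio_le_one hp hm'
    rw [avg_const] at this
    linarith [runRatio_nonneg (n := n) (k := k) l p m]
  · rw [avg_runRatio hp h, runRatio, add_zero]
    have := cpl_rec (n := n) (k := k) (p := p + l) (by omega) m
    rw [if_pos (by omega), show p + l + 1 = p + 1 + l by omega] at this
    rw [this]

end RunRatio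

section Chain

variable {n k : ℕ}

lemma runRatio_le_chainE {l p t m : ℕ} (hp : p + t + l ≤ k * n) (h : 0 < cpl n k p m) :
    runRatio n k l p m ≤ chainE n k p t (runRatio n k l (p + t)) m := by
  induction t with
  | zero => exact le_rfl
  | succ t ih =>
    refine (ih (by omega)).trans ?_
    rw [chainE_succ]
    exact chainE_mono (by omega) h fun m' hm' => runRatio_le_avg (by omega) hm'

lemma chainE_runRatio_le {l p t m : ℕ} (hp : p + t + l ≤ k * n) (h : 0 < cpl n k p m) {e : ℝ}
    (he : ∀ s < t, chainE n k p s (fun x => if k * x ≤ p + s + l then 1 else 0) m ≤ e) :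
    chainE n k p t (runRatio n k l (p + t)) m ≤ runRatio n k l p m + t * e := by
  induction t with
  | zero => simp [chainE]
  | succ t ih =>
    have ih := ih (by omega) fun s hs => he s (by omega)
    rw [chainE_succ]
    have h1 := chainE_mono (p := p) (t := t) (n := n) (k := k) (m := m) (by omega) h
      (f := avg n k (p + t) (runRatio n k l (p + (t + 1))))
      (g := fun x => runRatio n k l (p + t) x + if k * x ≤ p + t + l then 1 else 0)
      fun m' hm' => avg_runRatio_le (by omega) hm'
    rw [chainE_add] at h1
    have := he t (Nat.lt_succ_self t)
    push_cast
    linarith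

/-- Chebyshev's association inequality. -/
lemma chainE_mul_le {p t m : ℕ} (hp : p + t ≤ k * n) (h : 0 < cpl n k p m) {f g : ℕ → ℝ}
    (hfg : ∀ x y, 0 < cpl n k (p + t) x → 0 < cpl n k (p + t) y →
      0 ≤ (f x - f y) * (g x - g y)) :
    chainE n k p t f m * chainE n k p t g m ≤ chainE n k p t (fun x => f x * g x) m := by
  set Ef := chainE n k p t f m
  set Eg := chainE n k p t g m
  set Efg := chainE n k p t (fun x => f x * g x) m with hEfg
  have h1 : ∀ y, 0 < cpl n k (p + t) y → 0 ≤ Efg + f y * g y - f y * Eg - g y * Ef := by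
    intro y hy
    have h2 := chainE_mono hp h (f := fun _ => 0)
      (g := fun x => (f x * g x + f y * g y) - ((f y) * g x + (g y) * f x))
      fun x hx => by have := hfg x y hx hy; linarith
    rw [chainE_sub, chainE_add, chainE_add, chainE_const, chainE_const, chainE_const_mul,
      chainE_const_mul] at h2
    linarith
  have h2 := chainE_mono hp h (f := fun _ => 0)
      (g := fun y => (Efg + f y * g y) - ((Eg) * f y + (Ef) * g y))
      fun x hx => by have := h1 x hx; linarith
  rw [chainE_sub, chainE_add, chainE_add, chainE_const, chainE_const, chainE_const_mul,
    chainE_const_mul, ← hEfg] at h2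
  nlinarith

lemma runRatio_one_mono_of_le {p x y : ℕ} (hp : p < k * n) (hx : 0 < cpl n k p x)
    (hy : 0 < cpl n k p y) (hxy : x ≤ y) : runRatio n k 1 p x ≤ runRatio n k 1 p y := by
  induction y, hxy using Nat.le_induction with
  | base => exact le_rfl
  | succ y hxy ih =>
    have h1 := (cpl_pos_iff hp).1 hx
    have h2 := (cpl_pos_iff hp).1 hy
    have h3 : 0 < cpl n k p y :=
      cpl_pos (h1.1.trans_le (Nat.mul_le_mul_left k hxy)) (by omega)
    exact (ih h3).trans (runRatio_one_mono hp h3 hy)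

lemma avg_id {p m : ℕ} (hn : 0 < n) :
    avg n k p (fun x => (x : ℝ)) m = m + 1 - m / n * runRatio n k 1 p m := by
  rw [← stay_eq hn]
  simp only [avg]
  push_cast
  ring

lemma chainE_id_succ {p t m : ℕ} (hn : 0 < n) :
    chainE n k p (t + 1) (fun x => (x : ℝ)) m = chainE n k p t (fun x => (x : ℝ)) m + 1
      - (n : ℝ)⁻¹ * chainE n k p t (fun x => x * runRatio n k 1 (p + t) x) m := by
  rw [chainE_succ]
  have : avg n k (p + t) (fun x => (x : ℝ)) = fun m : ℕ =>
      ((m : ℝ) + 1) - (n : ℝ)⁻¹ * (m * runRatio n k 1 (p + t) m) := by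
    funext m
    rw [avg_id hn]
    ring
  rw [this, chainE_sub, chainE_add, chainE_const, chainE_const_mul]

/-- If the run ratio is at least `w`, the exploration cannot have too few states. -/
lemma lower_bound_of_le_runRatio {p m : ℕ} {w : ℝ} (hw : 0 < w) (hw1 : w < 1) (hp : p ≤ k * n)
    (hn : 0 < n) (h : 0 < cpl n k p m) (hz : w ≤ runRatio n k 1 p m) :
    (1 - w * m / n) * (1 - w / n) ^ (k * n - p) ≤ 1 - w := by
  have hn' : (1 : ℝ) ≤ n := by exact_mod_cast hn
  have he : w / n ≤ 1 := (div_le_one (by positivity)).2 (by linarith)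
  have key : ∀ t, p + t ≤ k * n → (1 - w * m / n) * (1 - w / n) ^ t ≤
      1 - w / n * chainE n k p t (fun x => (x : ℝ)) m := by
    intro t
    induction t with
    | zero => intro _; simp only [chainE]; apply le_of_eq; ring
    | succ t ih =>
      intro ht
      have ih := ih (by omega)
      have h1 := runRatio_le_chainE (n := n) (k := k) (l := 1) (p := p) (t := t) (by omega) h
      have h2 := chainE_mul_le (n := n) (k := k) (p := p) (t := t) (by omega) h
        (f := fun x => (x : ℝ)) (g := runRatio n k 1 (p + t)) fun x y hx hy => by
          rcases le_total x y with hxy | hxy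
          · refine mul_nonneg_of_nonpos_of_nonpos (by simpa using hxy) ?_
            linarith [runRatio_one_mono_of_le (by omega) hx hy hxy]
          · refine mul_nonneg (by simpa using hxy) ?_
            linarith [runRatio_one_mono_of_le (by omega) hy hx hxy]
      have h3 : 0 ≤ chainE n k p t (fun x => (x : ℝ)) m := by
        have := chainE_mono (n := n) (k := k) (p := p) (t := t) (by omega) h
          (f := fun _ => 0) (g := fun x => (x : ℝ)) fun x _ => Nat.cast_nonneg x
        rwa [chainE_const] at this
      rw [chainE_id_succ hn, pow_succ, ← mul_assoc]
      set a := chainE n k p t (fun x => (x : ℝ)) m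
      set b := chainE n k p t (fun x => (x : ℝ) * runRatio n k 1 (p + t) x) m
      have h4 : a * w ≤ b := (mul_le_mul_of_nonneg_left (hz.trans h1) h3).trans h2
      have h5 : w / n * ((n : ℝ)⁻¹ * (a * w)) ≤ w / n * ((n : ℝ)⁻¹ * b) := by gcongr
      calc _ ≤ (1 - w / n * a) * (1 - w / n) :=
            mul_le_mul_of_nonneg_right ih (by linarith)
        _ = 1 - w / n * (a + 1) + w / n * ((n : ℝ)⁻¹ * (a * w)) := by
            rw [div_eq_mul_inv]; ring
        _ ≤ _ := by linarith
  have h1 := key (k * n - p) (by omega)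
  have h2 := chainE_mono (n := n) (k := k) (p := p) (t := k * n - p) (m := m) (by omega) h
    (f := fun _ => (n : ℝ)) (g := fun x => (x : ℝ)) fun x hx => by
      rw [show p + (k * n - p) = k * n by omega, cpl_end] at hx
      by_cases hxn : x = n
      · rw [hxn]
      · simp [hxn] at hx
  rw [chainE_const] at h2
  have h3 : w / n * n ≤ w / n * chainE n k p (k * n - p) (fun x => (x : ℝ)) m := by gcongr
  rw [div_mul_cancel₀ _ (by positivity)] at h3
  linarith

end Chain

/-- Potential measuring the distance of an exploration to the boundary. -/
noncomputable def pot (n k : ℕ) (w : ℝ) (p m : ℕ) : ℝ := (1 - w * m / n) * (1 - w / n) ^ (k * n - p)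

section Pot

variable {n k : ℕ} {w : ℝ}

lemma div_mem_unit (hw : 0 < w) (hw1 : w < 1) (hn : 0 < n) : 0 ≤ 1 - w / n ∧ 1 - w / n ≤ 1 := by
  have hn' : (1 : ℝ) ≤ n := by exact_mod_cast hn
  have he : w / n ≤ 1 := (div_le_one (by positivity)).2 (by linarith)
  have : 0 ≤ w / n := by positivity
  constructor <;> linarith

lemma pot_flat {p : ℕ} (hn : 0 < n) (hp : p < k * n) (m : ℕ) :
    n * (pot n k w (p + 1) m - pot n k w p m)
      = w * (1 - w * m / n) * (1 - w / n) ^ (k * n - (p + 1)) := by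
  have : (n : ℝ) ≠ 0 := by positivity
  rw [pot, pot, show k * n - p = k * n - (p + 1) + 1 by omega, pow_succ]
  field_simp
  ring

lemma pot_new {p : ℕ} (hn : 0 < n) (hp : p < k * n) (m : ℕ) :
    n * (pot n k w (p + 1) (m + 1) - pot n k w p m)
      = -(w * (w * m / n)) * (1 - w / n) ^ (k * n - (p + 1)) := by
  have : (n : ℝ) ≠ 0 := by positivity
  rw [pot, pot, show k * n - p = k * n - (p + 1) + 1 by omega, pow_succ]
  push_cast
  field_simp
  ring

lemma avg_exp_pot_le {p m : ℕ} {s g : ℝ} (hw : 0 < w) (hw1 : w < 1) (hs : 0 ≤ s) (hs1 : s ≤ 1)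
    (hp : p < k * n) (h : 0 < cpl n k p m) (hz : runRatio n k 1 p m ≤ w) :
    avg n k p (fun x => Real.exp (s * (n * (pot n k w (p + 1) x - g)))) m
      ≤ Real.exp (s * (n * (pot n k w p m - g))) * Real.exp (s ^ 2) := by
  have hn : 0 < n := Nat.pos_of_ne_zero fun h => by simp [h] at hp
  have hn' : (0 : ℝ) < n := by exact_mod_cast hn
  obtain ⟨u0, u1⟩ := div_mem_unit hw hw1 hn
  set G := (1 - w / n) ^ (k * n - (p + 1)) with hG
  have G0 : 0 ≤ G := pow_nonneg u0 _
  have G1 : G ≤ 1 := pow_le_one₀ u0 u1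
  have hmn := ((cpl_pos_iff hp).1 h).2
  set y : ℝ := w * m / n with hy
  have hmn' : (m : ℝ) / n ≤ 1 := (div_le_one hn').2 (by exact_mod_cast hmn)
  have hy' : y = w * (m / n) := by rw [hy, mul_div_assoc]
  have y0 : 0 ≤ y := by positivity
  have y1 : y ≤ 1 := by
    rw [hy']
    exact mul_le_one₀ hw1.le (by positivity) hmn'
  set θ := stay n k p m with hθ
  have t0 : 0 ≤ θ := stay_nonneg p m
  have t1 : θ ≤ 1 := stay_le_one hp h
  have ty : θ ≤ y := by
    rw [hθ, stay_eq hn, hy', mul_comm]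
    exact mul_le_mul_of_nonneg_right hz (by positivity)
  have hflat := pot_flat (w := w) hn hp m
  have hnew := pot_new (w := w) hn hp m
  rw [← hG, ← hy] at hflat hnew
  set a := w * (1 - y) * G
  set b := -(w * y) * G
  have wy0 : 0 ≤ w * (1 - y) := mul_nonneg hw.le (by linarith)
  have a0 : 0 ≤ a := mul_nonneg wy0 G0
  have a1 : a ≤ 1 := mul_le_one₀ (mul_le_one₀ hw1.le (by linarith) (by linarith)) G0 G1
  have b0' : 0 ≤ w * y * G := by positivity
  have b1' : w * y * G ≤ 1 := mul_le_one₀ (mul_le_one₀ hw1.le y0 y1) G0 G1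
  have b0 : b ≤ 0 := by simp only [b]; linarith
  have b1 : -1 ≤ b := by simp only [b]; linarith
  have ex : ∀ x : ℝ, |x| ≤ 1 → Real.exp (s * x) ≤ 1 + s * x + s ^ 2 := by
    intro x hx
    have h1 : |s * x| ≤ 1 := by
      rw [abs_mul, abs_of_nonneg hs]
      exact mul_le_one₀ hs1 (abs_nonneg _) hx
    have h2 := (abs_le.1 (Real.abs_exp_sub_one_sub_id_le h1)).2
    have h3 : (s * x) ^ 2 ≤ s ^ 2 := by
      rw [mul_pow]
      have : x ^ 2 ≤ 1 := by rw [← sq_abs]; exact pow_le_one₀ (abs_nonneg _) hx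
      nlinarith [sq_nonneg s]
    linarith
  have ea := ex a (abs_le.2 ⟨by linarith, a1⟩)
  have eb := ex b (abs_le.2 ⟨b1, by linarith⟩)
  have e1 : Real.exp (s * (n * (pot n k w (p + 1) m - g)))
      = Real.exp (s * (n * (pot n k w p m - g))) * Real.exp (s * a) := by
    rw [← Real.exp_add, ← hflat]; congr 1; ring
  have e2 : Real.exp (s * (n * (pot n k w (p + 1) (m + 1) - g)))
      = Real.exp (s * (n * (pot n k w p m - g))) * Real.exp (s * b) := by
    rw [← Real.exp_add, ← hnew]; congr 1; ring
  simp only [avg, e1, e2, ← hθ]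
  set R := Real.exp (s * (n * (pot n k w p m - g)))
  have hR : 0 < R := Real.exp_pos _
  have dr : θ * a + (1 - θ) * b ≤ 0 := by
    have : θ * a + (1 - θ) * b = w * G * (θ - y) := by simp only [a, b]; ring
    rw [this]
    exact mul_nonpos_of_nonneg_of_nonpos (by positivity) (by linarith)
  have fin : θ * Real.exp (s * a) + (1 - θ) * Real.exp (s * b) ≤ Real.exp (s ^ 2) := by
    have h1 : θ * Real.exp (s * a) ≤ θ * (1 + s * a + s ^ 2) := by gcongr
    have h2 : (1 - θ) * Real.exp (s * b) ≤ (1 - θ) * (1 + s * b + s ^ 2) :=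
      mul_le_mul_of_nonneg_left eb (by linarith)
    have h3 : s * (θ * a + (1 - θ) * b) ≤ 0 := mul_nonpos_of_nonneg_of_nonpos hs dr
    have h4 := Real.add_one_le_exp (s ^ 2)
    nlinarith
  calc _ = R * (θ * Real.exp (s * a) + (1 - θ) * Real.exp (s * b)) := by ring
    _ ≤ _ := by gcongr

lemma avg_exp_pot_le_of_lt {p m : ℕ} {s g : ℝ} (hw : 0 < w) (hw1 : w < 1) (hs : 0 ≤ s)
    (hp : p < k * n) (h : 0 < cpl n k p m) (hz : w ≤ runRatio n k 1 p m) :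
    avg n k p (fun x => Real.exp (s * (n * (pot n k w (p + 1) x - g)))) m
      ≤ Real.exp (s + s * (n * (1 - w - g))) := by
  have hn : 0 < n := Nat.pos_of_ne_zero fun h => by simp [h] at hp
  have hn' : (0 : ℝ) < n := by exact_mod_cast hn
  obtain ⟨u0, u1⟩ := div_mem_unit hw hw1 hn
  have hpot : pot n k w p m ≤ 1 - w := lower_bound_of_le_runRatio hw hw1 hp.le hn h hz
  have G0 : 0 ≤ (1 - w / n) ^ (k * n - (p + 1)) := pow_nonneg u0 _
  have G1 : (1 - w / n) ^ (k * n - (p + 1)) ≤ 1 := pow_le_one₀ u0 u1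
  have hmn := ((cpl_pos_iff hp).1 h).2
  have hmn' : (m : ℝ) / n ≤ 1 := (div_le_one hn').2 (by exact_mod_cast hmn)
  have y0 : 0 ≤ w * m / n := by positivity
  have y1 : w * m / n ≤ 1 := by
    rw [mul_div_assoc]
    exact mul_le_one₀ hw1.le (by positivity) hmn'
  have key : ∀ d, n * (d - pot n k w p m) ≤ 1 →
      Real.exp (s * (n * (d - g))) ≤ Real.exp (s + s * (n * (1 - w - g))) := by
    intro d hd
    apply Real.exp_le_exp.2
    have : n * (d - g) ≤ 1 + n * (1 - w - g) := by nlinarith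
    nlinarith
  refine (avg_mono hp h (g := fun _ => Real.exp (s + s * (n * (1 - w - g)))) ?_).trans
    (avg_const _ _ _).le
  intro x _ hx1 hx2
  obtain rfl | rfl : x = m ∨ x = m + 1 := by omega
  · refine key _ ?_
    rw [pot_flat hn hp]
    exact mul_le_one₀ (mul_le_one₀ hw1.le (by linarith) (by linarith)) G0 G1
  · refine key _ ?_
    rw [pot_new hn hp]
    have : 0 ≤ w * (w * m / n) := by positivity
    nlinarith

/-- Near the start of the exploration the potential is small. -/
lemma pot_start {p m l : ℕ} (hw : 0 < w) (hw1 : w < 1) (hn : 0 < n) (hp : p + l ≤ k * n)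
    (hpm : p ≤ m + l) :
    n * (pot n k w p m - (1 - w / n) ^ (k * n)) ≤ l := by
  have hn' : (0 : ℝ) < n := by exact_mod_cast hn
  obtain ⟨u0, u1⟩ := div_mem_unit hw hw1 hn
  have h1 : 1 - w * m / n ≤ (1 - w / n) ^ m := by
    have := one_add_mul_le_pow (a := -(w / n)) (by linarith) m
    calc 1 - w * m / n = 1 + m * (-(w / n)) := by ring
      _ ≤ (1 + -(w / n)) ^ m := this
      _ = _ := by rw [← sub_eq_add_neg]
  have h2 : 1 - l * (w / n) ≤ (1 - w / n) ^ l := by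
    have := one_add_mul_le_pow (a := -(w / n)) (by linarith) l
    calc 1 - l * (w / n) = 1 + l * (-(w / n)) := by ring
      _ ≤ (1 + -(w / n)) ^ l := this
      _ = _ := by rw [← sub_eq_add_neg]
  have h3 : pot n k w p m ≤ (1 - w / n) ^ (k * n - l) := by
    calc pot n k w p m ≤ (1 - w / n) ^ m * (1 - w / n) ^ (k * n - p) :=
          mul_le_mul_of_nonneg_right h1 (pow_nonneg u0 _)
      _ = (1 - w / n) ^ (m + (k * n - p)) := (pow_add _ _ _).symm
      _ ≤ _ := pow_le_pow_of_le_one u0 u1 (by omega)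
  set q := (1 - w / n) ^ (k * n - l) with hq
  have q0 : 0 ≤ q := pow_nonneg u0 _
  have q1 : q ≤ 1 := pow_le_one₀ u0 u1
  have h4 : (1 - w / n) ^ (k * n) = q * (1 - w / n) ^ l := by
    rw [hq, ← pow_add]; congr 1; omega
  have h5 : pot n k w p m - (1 - w / n) ^ (k * n) ≤ l * (w / n) := by
    have : q * (1 - l * (w / n)) ≤ q * (1 - w / n) ^ l := by gcongr
    have h6 : q * (l * (w / n)) ≤ 1 * (l * (w / n)) := by gcongr
    rw [h4]; linarith
  calc n * (pot n k w p m - (1 - w / n) ^ (k * n)) ≤ n * (l * (w / n)) := by gcongr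
    _ = l * w := by field_simp
    _ ≤ l * 1 := by gcongr
    _ = l := mul_one _

/-- Concavity estimate used at the boundary. -/
lemma exp_mul_one_sub_ge {κ u u₁ : ℝ} (hu : 0 ≤ u) (hu1 : u ≤ u₁) (h1 : u₁ < 1)
    (h0 : 0 < u₁) : 1 + (κ + Real.log (1 - u₁) / u₁) * u ≤ Real.exp (κ * u) * (1 - u) := by
  have hl : Real.log (1 - u₁) / u₁ * u ≤ Real.log (1 - u) := by
    have hc := strictConcaveOn_log_Ioi.concaveOn.2 (show (1 : ℝ) ∈ Set.Ioi 0 by simp)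
      (show 1 - u₁ ∈ Set.Ioi 0 by simp only [Set.mem_Ioi]; linarith)
      (show 0 ≤ 1 - u / u₁ by have := (div_le_one h0).2 hu1; linarith)
      (show 0 ≤ u / u₁ by positivity) (by ring)
    simp only [smul_eq_mul, Real.log_one, mul_zero, zero_add, mul_one] at hc
    have : 1 - u / u₁ + u / u₁ * (1 - u₁) = 1 - u := by field_simp; ring
    rw [this] at hc
    calc _ = u / u₁ * Real.log (1 - u₁) := by ring
      _ ≤ _ := hc
  have : Real.exp (κ * u) * (1 - u) = Real.exp (κ * u + Real.log (1 - u)) := by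
    rw [Real.exp_add, Real.exp_log (by linarith)]
  rw [this]
  have h2 := Real.add_one_le_exp (κ * u + Real.log (1 - u))
  linarith

/-- At the boundary the potential is large. -/
lemma pot_boundary {p x l : ℕ} {u₁ : ℝ} (hw : 0 < w) (hw1 : w < 1) (hn : 0 < n) (hk : 0 < k)
    (hp : p ≤ k * n) (hx : k * x ≤ p + l) (hu1 : u₁ < 1) (hu0 : 0 < u₁)
    (hpu : w * p ≤ u₁ * (k * n)) :
    (1 - w / n) ^ (k * n) * (k + Real.log (1 - u₁) / u₁) * (w * p / k) - l
      ≤ n * (pot n k w p x - (1 - w / n) ^ (k * n)) := by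
  have hn' : (1 : ℝ) ≤ n := by exact_mod_cast hn
  have hk' : (1 : ℝ) ≤ k := by exact_mod_cast hk
  obtain ⟨u0, u1⟩ := div_mem_unit hw hw1 hn
  set G := (1 - w / n) ^ (k * n - p) with hG
  set g := (1 - w / n) ^ (k * n) with hg
  have G0 : 0 ≤ G := pow_nonneg u0 _
  have G1 : G ≤ 1 := pow_le_one₀ u0 u1
  set u : ℝ := w * p / (k * n) with hu
  have hg0 : 0 ≤ g := pow_nonneg u0 _
  have hGg : g * Real.exp (k * u) ≤ G := by
    have h1 : (1 - w / n) ^ p ≤ Real.exp (-(k * u)) := by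
      have : 1 - w / n ≤ Real.exp (-(w / n)) := Real.one_sub_le_exp_neg _
      calc (1 - w / n) ^ p ≤ Real.exp (-(w / n)) ^ p := by gcongr
        _ = Real.exp (-(k * u)) := by
          rw [← Real.exp_nat_mul, hu]; congr 1; field_simp
    have h2 : g = G * (1 - w / n) ^ p := by rw [hg, hG, ← pow_add]; congr 1; omega
    calc g * Real.exp (k * u) ≤ (G * Real.exp (-(k * u))) * Real.exp (k * u) := by
          rw [h2]; gcongr
      _ = G := by rw [mul_assoc, ← Real.exp_add]; simp
  have hu2 : u ≤ u₁ := by rw [hu, div_le_iff₀ (by positivity)]; exact hpu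
  have hc := exp_mul_one_sub_ge (κ := k) (u := u) (by positivity) hu2 hu1 hu0
  have hx' : (k : ℝ) * x ≤ p + l := by exact_mod_cast hx
  have h3 : 1 - u - l / n ≤ 1 - w * x / n := by
    have e1 : w * x / n = w * (k * x) / (k * n) := by field_simp
    have e2 : w * (k * x) / (k * n) ≤ w * (p + l) / (k * n) := by gcongr
    have e3 : w * (p + l) / (k * n) = u + w * l / (k * n) := by rw [hu]; ring
    have e4 : w * l / (k * n) ≤ l / n := by
      rw [div_le_div_iff₀ (by positivity) (by positivity)]
      have : w * (l * n) ≤ k * (l * n) := by gcongr; linarith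
      linarith
    linarith
  have h4 : g * (1 + (k + Real.log (1 - u₁) / u₁) * u) - l / n ≤ pot n k w p x := by
    calc g * (1 + (k + Real.log (1 - u₁) / u₁) * u) - l / n
        ≤ g * (Real.exp (k * u) * (1 - u)) - l / n := by gcongr
      _ = (g * Real.exp (k * u)) * (1 - u) - l / n := by ring
      _ ≤ G * (1 - u) - l / n := by
          have := mul_le_mul_of_nonneg_right hGg (show 0 ≤ 1 - u by linarith)
          linarith
      _ ≤ G * (1 - u - l / n) := by
          have : G * (l / n) ≤ 1 * (l / n) := by gcongr
          linarith
      _ ≤ G * (1 - w * x / n) := by gcongr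
      _ = pot n k w p x := by rw [pot, mul_comm]
  have h5 : n * (g * (1 + (k + Real.log (1 - u₁) / u₁) * u) - l / n - g)
      ≤ n * (pot n k w p x - g) := by gcongr
  refine le_trans (le_of_eq ?_) h5
  rw [hu]
  field_simp
  ring

end Pot

lemma chainE_boundary_le {n k l p m t : ℕ} {w u₁ s c : ℝ} (hw : 0 < w) (hw1 : w < 1) (hk : 0 < k)
    (hs : 0 < s) (hs1 : s ≤ 1) (hu0 : 0 < u₁) (hu1 : u₁ < 1) (hsc : s ≤ c / 2)
    (hc : c ≤ (1 - w / n) ^ (k * n) * (k + Real.log (1 - u₁) / u₁) * (w / k))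
    (hξ : k * n * Real.exp (s + s * (n * (1 - w - (1 - w / n) ^ (k * n)))) ≤ 1)
    (hn : 0 < n) (h : 0 < cpl n k p m) (hpm : p ≤ m + l) (hpl : p + l ≤ k * n)
    (hpt : p + t ≤ k * n) (hwp : w * (p + t) ≤ u₁ * (k * n)) :
    chainE n k p t (fun x => if k * x ≤ p + t + l then 1 else 0) m
      ≤ Real.exp (s * l) * (Real.exp (s * l) + 1) * Real.exp (-(s * c / 2) * p) := by
  set g := (1 - w / n) ^ (k * n) with hg
  set ξ := Real.exp (s + s * (n * (1 - w - g))) with hξ'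
  set F : ℕ → ℕ → ℝ := fun q x =>
    Real.exp (-(s ^ 2 * q)) * Real.exp (s * (n * (pot n k w q x - g))) with hF
  have hξ0 : 0 < ξ := Real.exp_pos _
  have step : ∀ q m', p ≤ q → q < p + t → 0 < cpl n k q m' →
      avg n k q (F (q + 1)) m' ≤ F q m' + ξ := by
    intro q m' _ hq hV
    simp only [hF]
    rw [avg_const_mul]
    rcases le_total (runRatio n k 1 q m') w with hz | hz
    · have h1 := avg_exp_pot_le (g := g) hw hw1 hs.le hs1 (by omega) hV hz
      have h2 : Real.exp (-(s ^ 2 * (q + 1 : ℕ))) * Real.exp (s ^ 2) = Real.exp (-(s ^ 2 * q)) := by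
        rw [← Real.exp_add]; congr 1; push_cast; ring
      calc _ ≤ Real.exp (-(s ^ 2 * (q + 1 : ℕ))) *
            (Real.exp (s * (n * (pot n k w q m' - g))) * Real.exp (s ^ 2)) := by gcongr
        _ = (Real.exp (-(s ^ 2 * (q + 1 : ℕ))) * Real.exp (s ^ 2)) *
            Real.exp (s * (n * (pot n k w q m' - g))) := by ring
        _ ≤ _ := by rw [h2]; linarith
    · have h1 := avg_exp_pot_le_of_lt (g := g) hw hw1 hs.le (by omega) hV hz
      have h2 : Real.exp (-(s ^ 2 * (q + 1 : ℕ))) ≤ 1 := by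
        rw [Real.exp_le_one_iff]
        have : 0 ≤ s ^ 2 * ((q + 1 : ℕ) : ℝ) := by positivity
        linarith
      calc _ ≤ Real.exp (-(s ^ 2 * (q + 1 : ℕ))) * ξ := by gcongr
        _ ≤ 1 * ξ := by gcongr
        _ ≤ _ := by
          have : 0 < Real.exp (-(s ^ 2 * q)) * Real.exp (s * (n * (pot n k w q m' - g))) := by
            positivity
          linarith
  have h1 := chainE_le_add hpt h step
  have h2 : F p m ≤ Real.exp (s * l) := by
    have h3 := pot_start (n := n) (k := k) (p := p) (m := m) (l := l) hw hw1 hn hpl hpm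
    simp only [hF]
    rw [← Real.exp_add]
    apply Real.exp_le_exp.2
    have : 0 ≤ s ^ 2 * (p : ℝ) := by positivity
    have := mul_le_mul_of_nonneg_left h3 hs.le
    linarith
  have h3 : t * ξ ≤ 1 := by
    refine le_trans ?_ hξ
    have : (t : ℝ) ≤ k * n := by exact_mod_cast (by omega : t ≤ k * n)
    gcongr
  have h4 : chainE n k p t (fun x => if k * x ≤ p + t + l then 1 else 0) m ≤
      chainE n k p t (fun x => Real.exp (s * l) * Real.exp (-(s * c / 2) * p) * F (p + t) x) m := by
    refine chainE_mono hpt h fun x hx => ?_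
    split_ifs with hb
    · have h5 := pot_boundary (n := n) (k := k) (p := p + t) (x := x) (l := l) (u₁ := u₁) hw hw1 hn
        hk hpt hb hu1 hu0 (by push_cast; exact hwp)
      rw [← hg] at h5
      push_cast at h5
      have h6 : c * (p + t) ≤ g * (k + Real.log (1 - u₁) / u₁) * (w * (p + t) / k) := by
        calc c * (p + t) ≤ g * (k + Real.log (1 - u₁) / u₁) * (w / k) * (p + t) := by gcongr
          _ = _ := by ring
      have h7 : s * (c * (p + t) - l) ≤ s * (n * (pot n k w (p + t) x - g)) := by
        gcongr; linarith
      simp only [hF]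
      rw [← Real.exp_add, ← Real.exp_add, ← Real.exp_add, Real.one_le_exp_iff]
      push_cast
      have h8 : s ^ 2 * (p + t) ≤ s * (c / 2) * (p + t) := by
        rw [pow_two]; gcongr
      have h9 : 0 ≤ s * (c / 2) * t := by
        have : 0 < c := by linarith
        positivity
      linarith
    · simp only [hF]; positivity
  rw [chainE_const_mul] at h4
  calc _ ≤ _ := h4
    _ ≤ Real.exp (s * l) * Real.exp (-(s * c / 2) * p) * (Real.exp (s * l) + 1) := by
        gcongr; linarith
    _ = _ := by ring

lemma tendsto_one_sub_div_pow (k : ℕ) (w : ℝ) :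
    Tendsto (fun n : ℕ => (1 - w / n) ^ (k * n)) atTop (𝓝 (Real.exp (-(k * w)))) := by
  have h := (Real.tendsto_one_add_div_pow_exp (-w)).pow k
  rw [← Real.exp_nat_mul] at h
  refine (h.congr fun n => ?_).trans (le_of_eq (by congr 2; ring))
  rw [← pow_mul, mul_comm k n]
  congr 1
  ring

lemma tendsto_nat_mul_exp_neg {c : ℝ} (hc : 0 < c) :
    Tendsto (fun n : ℕ => (n : ℝ) * Real.exp (-(c * n))) atTop (𝓝 0) := by
  have h := (Real.tendsto_pow_mul_exp_neg_atTop_nhds_zero 1).comp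
    ((tendsto_natCast_atTop_atTop (R := ℝ)).const_mul_atTop hc)
  have h2 := h.const_mul c⁻¹
  rw [mul_zero] at h2
  refine h2.congr fun n => ?_
  simp only [Function.comp, pow_one]
  field_simp

/-- The conditioned exploration reaches the boundary with exponentially small probability. -/
lemma exists_boundary_tail {k : ℕ} (hk : 0 < k) {w u₁ : ℝ} (hw : 0 < w) (hw1 : w < 1)
    (hwk : 1 - w < Real.exp (-(k * w))) (hu0 : 0 < u₁) (hu1 : u₁ < 1)
    (huk : 0 < k * u₁ + Real.log (1 - u₁)) (l : ℕ) :
    ∃ K c : ℝ, 0 < K ∧ 0 < c ∧ ∀ᶠ n : ℕ in atTop, ∀ p m t : ℕ, 0 < cpl n k p m → p ≤ m + l →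
      p + l ≤ k * n → p + t ≤ k * n → w * (p + t) ≤ u₁ * (k * n) →
      chainE n k p t (fun x => if k * x ≤ p + t + l then 1 else 0) m ≤ K * Real.exp (-c * p) := by
  have hk' : (0 : ℝ) < k := by exact_mod_cast hk
  obtain ⟨g', hg1, hg2⟩ := exists_between hwk
  have hc0 : 0 < k + Real.log (1 - u₁) / u₁ := by
    have : k + Real.log (1 - u₁) / u₁ = (k * u₁ + Real.log (1 - u₁)) / u₁ := by field_simp
    rw [this]; positivity
  have hg0 : 0 < g' := by linarith
  set c := g' * (k + Real.log (1 - u₁) / u₁) * (w / k) with hc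
  have hcpos : 0 < c := by positivity
  set s := min 1 (c / 2) with hs
  have hs0 : 0 < s := by positivity
  refine ⟨Real.exp (s * l) * (Real.exp (s * l) + 1), s * c / 2, by positivity, by positivity, ?_⟩
  have e1 : ∀ᶠ n : ℕ in atTop, g' < (1 - w / n) ^ (k * n) :=
    (tendsto_one_sub_div_pow k w).eventually (lt_mem_nhds hg2)
  have e2 : ∀ᶠ n : ℕ in atTop,
      k * Real.exp s * (n * Real.exp (-(s * (g' - (1 - w)) * n))) < 1 := by
    have := (tendsto_nat_mul_exp_neg (c := s * (g' - (1 - w)))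
      (mul_pos hs0 (by linarith))).const_mul (k * Real.exp s)
    rw [mul_zero] at this
    exact this.eventually (gt_mem_nhds one_pos)
  filter_upwards [e1, e2, eventually_gt_atTop 0] with n h1 h2 hn p m t hV hpm hpl hpt hwp
  refine chainE_boundary_le hw hw1 hk hs0 (min_le_left _ _) hu0 hu1 (min_le_right _ _) ?_ ?_ hn hV
    hpm hpl hpt hwp
  · rw [hc]; gcongr
  · refine le_trans ?_ h2.le
    have h3 : Real.exp (s + s * (n * (1 - w - (1 - w / n) ^ (k * n))))
        ≤ Real.exp s * Real.exp (-(s * (g' - (1 - w)) * n)) := by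
      rw [← Real.exp_add]
      apply Real.exp_le_exp.2
      have : s * n * g' ≤ s * n * (1 - w / n) ^ (k * n) := by gcongr
      linarith
    calc _ ≤ k * n * (Real.exp s * Real.exp (-(s * (g' - (1 - w)) * n))) := by gcongr
      _ = _ := by ring

section SecondMoment

variable {n k p m : ℕ}

lemma sq_runRatio_le_avg {q x : ℕ} (hq : q + 2 ≤ k * n) (h : 0 < cpl n k q x) :
    runRatio n k 1 q x ^ 2 + stay n k q x * (runRatio n k 1 q x - runRatio n k 1 (q + 1) x) ^ 2
      ≤ avg n k q (fun y => runRatio n k 1 (q + 1) y ^ 2) x := by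
  have h1 := runRatio_le_avg (n := n) (k := k) (l := 1) (p := q) (m := x) (by omega) h
  have h2 := runRatio_nonneg (n := n) (k := k) 1 q x
  have h3 := one_sub_stay (n := n) (k := k) (by omega) h
  have h4 : 0 ≤ 1 - stay n k q x := by
    rw [h3]; exact div_nonneg (cpl_nonneg _ _ _ _) (cpl_nonneg _ _ _ _)
  simp only [avg] at h1 ⊢
  set z := runRatio n k 1 q x
  set a := runRatio n k 1 (q + 1) x
  set b := runRatio n k 1 (q + 1) (x + 1)
  set θ := stay n k q x
  have h5 : 0 ≤ (1 - θ) * (b - z) ^ 2 := by positivity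
  have h6 : 0 ≤ z * (θ * a + (1 - θ) * b - z) := mul_nonneg h2 (by linarith)
  nlinarith

lemma sq_add_le_succ {t : ℕ} (hq : p + t + 2 ≤ k * n) (h : 0 < cpl n k p m) :
    chainE n k p t (fun x => runRatio n k 1 (p + t) x ^ 2) m
      + chainE n k p t (fun x => stay n k (p + t) x *
          (runRatio n k 1 (p + t) x - runRatio n k 1 (p + t + 1) x) ^ 2) m
      ≤ chainE n k p (t + 1) (fun x => runRatio n k 1 (p + (t + 1)) x ^ 2) m := by
  rw [chainE_succ, ← chainE_add]
  exact chainE_mono (by omega) h fun x hx => sq_runRatio_le_avg hq hx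

lemma runRatio_two_le_sq (hq : p + 2 ≤ k * n) :
    runRatio n k 2 p m ≤ runRatio n k 1 p m ^ 2 := by
  by_cases h0 : 0 < cpl n k (p + 1) m
  · rw [runRatio_succ h0, pow_two]
    exact mul_le_mul_of_nonneg_left (runRatio_one_antitone (by omega) h0) (runRatio_nonneg _ _ _)
  · have h1 : ¬ 0 < cpl n k (p + 2) m := fun h1 => h0 (cpl_pos_of_succ (by omega) h1)
    have h2 : cpl n k (p + 2) m = 0 := le_antisymm (not_lt.1 h1) (cpl_nonneg _ _ _ _)
    rw [runRatio, h2, mul_zero, zero_div]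
    positivity

lemma sq_sub_runRatio_two (hq : p + 2 ≤ k * n) :
    runRatio n k 1 p m ^ 2 - runRatio n k 2 p m
      = runRatio n k 1 p m * (runRatio n k 1 p m - runRatio n k 1 (p + 1) m) := by
  by_cases h0 : 0 < cpl n k (p + 1) m
  · rw [runRatio_succ h0]
    ring
  · have h1 : ¬ 0 < cpl n k (p + 2) m := fun h1 => h0 (cpl_pos_of_succ (by omega) h1)
    have h2 : cpl n k (p + 2) m = 0 := le_antisymm (not_lt.1 h1) (cpl_nonneg _ _ _ _)
    have h3 : cpl n k (p + 1) m = 0 := le_antisymm (not_lt.1 h0) (cpl_nonneg _ _ _ _)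
    simp [runRatio, h2, h3]

/-- The second moment of the run ratio stays close to its initial value. -/
lemma sq_runRatio_sub_le {t₁ t₂ : ℕ} {e lam : ℝ} (ht : t₁ < t₂) (hlam : 0 < lam) (h0 : 0 ≤ e)
    (hp : p + t₂ + 2 ≤ k * n) (h : 0 < cpl n k p m) (hmid : k * n ≤ 2 * (p + t₁))
    (he : ∀ s < t₂, chainE n k p s (fun x => if k * x ≤ p + s + 2 then 1 else 0) m ≤ e) :
    ∀ t ≤ t₁, chainE n k p t (fun x => runRatio n k 1 (p + t) x ^ 2) m - runRatio n k 1 p m ^ 2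
      ≤ t₂ * e + lam / (t₂ - t₁) + 1 / (2 * lam) := by
  set S : ℕ → ℝ := fun t => chainE n k p t (fun x => runRatio n k 1 (p + t) x ^ 2) m with hS
  set D : ℕ → ℝ := fun t => chainE n k p t (fun x => stay n k (p + t) x *
          (runRatio n k 1 (p + t) x - runRatio n k 1 (p + t + 1) x) ^ 2) m with hD
  set z₀ := runRatio n k 1 p m
  have hn : 0 < n := Nat.pos_of_ne_zero fun h => by simp [h] at hp
  have hn' : (0 : ℝ) < n := by exact_mod_cast hn
  have step : ∀ t, t ≤ t₂ → S t + D t ≤ S (t + 1) := fun t h1 => sq_add_le_succ (by omega) h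
  have D0 : ∀ t, t ≤ t₂ → 0 ≤ D t := fun t h1 => by
    have := chainE_mono (n := n) (k := k) (p := p) (t := t) (m := m) (by omega) h (f := fun _ => 0)
      (g := fun x => stay n k (p + t) x *
          (runRatio n k 1 (p + t) x - runRatio n k 1 (p + t + 1) x) ^ 2)
      fun x _ => mul_nonneg (stay_nonneg _ _) (sq_nonneg _)
    rwa [chainE_const] at this
  have hmono : ∀ s t, s ≤ t → t ≤ t₂ → S s ≤ S t := by
    intro s t hst
    induction t, hst using Nat.le_induction with
    | base => intro _; exact le_rfl
    | succ t _ ih => intro ht; linarith [ih (by omega), step t (by omega), D0 t (by omega)]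
  have point : ∀ t, t₁ ≤ t → t < t₂ → S t - z₀ ^ 2 ≤ t₂ * e + lam * D t + 1 / (2 * lam) := by
    intro t h1 h2
    have hY := chainE_runRatio_le (n := n) (k := k) (l := 2) (p := p) (t := t) (by omega) h
      fun s hs => he s (by omega)
    have hY0 := runRatio_two_le_sq (n := n) (k := k) (p := p) (m := m) (by omega)
    have hm : chainE n k p t (fun x => runRatio n k 1 (p + t) x ^ 2 - runRatio n k 2 (p + t) x) m
        ≤ chainE n k p t (fun x => lam * (stay n k (p + t) x *
          (runRatio n k 1 (p + t) x - runRatio n k 1 (p + t + 1) x) ^ 2) + 1 / (2 * lam)) m := by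
      refine chainE_mono (by omega) h fun x hx => ?_
      rw [sq_sub_runRatio_two (by omega), stay_eq hn]
      have hv := (cpl_pos_iff (by omega)).1 hx
      have z0 := runRatio_nonneg (n := n) (k := k) 1 (p + t) x
      have z1 := runRatio_one_le (n := n) (k := k) (p := p + t) (m := x) (by omega)
      set z := runRatio n k 1 (p + t) x
      set d := z - runRatio n k 1 (p + t + 1) x
      have hx2 : (1 : ℝ) / 2 ≤ x / n := by
        rw [div_le_div_iff₀ (by norm_num) hn', one_mul]
        have h5 : k * n ≤ k * (x * 2) := by
          have : k * (x * 2) = 2 * (k * x) := by ring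
          omega
        have hk : 0 < k := Nat.pos_of_ne_zero fun h => by simp [h] at hp
        exact_mod_cast Nat.le_of_mul_le_mul_left h5 hk
      have h6 : lam * (1 / 2 * z * d ^ 2) ≤ lam * (x / n * z * d ^ 2) := by gcongr
      have h7 : 0 ≤ z * (lam * d - 1) ^ 2 / (2 * lam) := by positivity
      have h8 : z * (lam * d - 1) ^ 2 / (2 * lam)
          = lam * (1 / 2 * z * d ^ 2) - z * d + z * (1 / (2 * lam)) := by field_simp; ring
      have h9 : z * (1 / (2 * lam)) ≤ 1 * (1 / (2 * lam)) := by gcongr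
      linarith
    rw [chainE_sub, chainE_add, chainE_const_mul, chainE_const] at hm
    have h3 : (t : ℝ) * e ≤ t₂ * e := by gcongr
    simp only [hS, hD]
    linarith
  have hw : (0 : ℝ) < t₂ - t₁ := by
    have : (t₁ : ℝ) < t₂ := by exact_mod_cast ht
    linarith
  have sum : ∀ t, t₁ ≤ t → t ≤ t₂ →
      ((t : ℝ) - t₁) * (S t₁ - z₀ ^ 2 - t₂ * e - 1 / (2 * lam)) ≤ lam * (S t - S t₁) := by
    intro t h1
    induction t, h1 using Nat.le_induction with
    | base => intro _; simp
    | succ t h1 ih =>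
      intro h2
      have i := ih (by omega)
      have i2 := point t h1 (by omega)
      have i3 := hmono t₁ t h1 (by omega)
      have i4 := mul_le_mul_of_nonneg_left (step t (by omega)) hlam.le
      push_cast
      linarith
  intro t h1
  have h2 := sum t₂ ht.le le_rfl
  have h3 : S t₂ ≤ 1 := by
    have := chainE_mono (n := n) (k := k) (p := p) (t := t₂) (m := m) (by omega) h
      (f := fun x => runRatio n k 1 (p + t₂) x ^ 2) (g := fun _ => 1)
      fun x _ => pow_le_one₀ (runRatio_nonneg _ _ _) (runRatio_one_le (by omega))
    rwa [chainE_const] at this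
  have h4 : 0 ≤ S t₁ := by
    have := chainE_mono (n := n) (k := k) (p := p) (t := t₁) (m := m) (by omega) h
      (f := fun _ => 0) (g := fun x => runRatio n k 1 (p + t₁) x ^ 2)
      fun x _ => sq_nonneg _
    rwa [chainE_const] at this
  have h5 : lam * (S t₂ - S t₁) ≤ lam * 1 := by gcongr; linarith
  have h6 : S t₁ - z₀ ^ 2 - t₂ * e - 1 / (2 * lam) ≤ lam / (t₂ - t₁) := by
    rw [le_div_iff₀ hw]; linarith
  have h7 := hmono t t₁ h1 ht.le
  linarith

/-- If the run ratio is at most `w`, the exploration must have many states. -/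
lemma upper_bound_of_runRatio_le {t₁ t₂ : ℕ} {e lam w κ : ℝ} (ht : t₁ < t₂) (hlam : 0 < lam)
    (h0 : 0 ≤ e) (hp : p + t₂ + 2 ≤ k * n) (h : 0 < cpl n k p m) (hmid : k * n ≤ 2 * (p + t₁))
    (he : ∀ s < t₂, chainE n k p s (fun x => if k * x ≤ p + s + 2 then 1 else 0) m ≤ e)
    (hκ : 0 < κ) (hV : t₂ * e + lam / (t₂ - t₁) + 1 / (2 * lam) ≤ κ ^ 2)
    (hw : 0 < w) (hw1 : w < 1) (hz : runRatio n k 1 p m ≤ w) :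
    (1 - κ) * (1 - (1 - w / n) ^ t₁) ≤ w := by
  have hn : 0 < n := Nat.pos_of_ne_zero fun h => by simp [h] at hp
  have hn' : (0 : ℝ) < n := by exact_mod_cast hn
  obtain ⟨u0, u1⟩ := div_mem_unit hw hw1 hn
  have hVt := sq_runRatio_sub_le ht hlam h0 hp h hmid he
  set z₀ := runRatio n k 1 p m
  have z00 : 0 ≤ z₀ := runRatio_nonneg _ _ _
  have key : ∀ t, t ≤ t₁ → (1 - κ) * (1 - (1 - w / n) ^ t) ≤
      w / n * chainE n k p t (fun x => (x : ℝ)) m := by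
    intro t
    induction t with
    | zero => intro _; simp only [chainE, pow_zero, sub_self, mul_zero]; positivity
    | succ t ih =>
      intro ht'
      have ih := ih (by omega)
      have a0 : 0 ≤ chainE n k p t (fun x => (x : ℝ)) m := by
        have := chainE_mono (n := n) (k := k) (p := p) (t := t) (m := m) (by omega) h
          (f := fun _ => 0) (g := fun x => (x : ℝ)) fun x _ => Nat.cast_nonneg x
        rwa [chainE_const] at this
      have hS := (hVt t (by omega)).trans hV
      have hz1 := runRatio_le_chainE (n := n) (k := k) (l := 1) (p := p) (t := t) (m := m)
        (by omega) h
      have hb : chainE n k p t (fun x => x * runRatio n k 1 (p + t) x) m ≤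
          chainE n k p t (fun x => z₀ * x + (n * ((2 * κ)⁻¹ * (runRatio n k 1 (p + t) x ^ 2
            + (z₀ ^ 2 - 2 * z₀ * runRatio n k 1 (p + t) x)) + κ / 2))) m := by
        refine chainE_mono (by omega) h fun x hx => ?_
        have hv := (cpl_pos_iff (by omega)).1 hx
        have hxn : (x : ℝ) ≤ n := by exact_mod_cast hv.2
        set z := runRatio n k 1 (p + t) x
        have h1 : 0 ≤ (|z - z₀| - κ) ^ 2 / (2 * κ) := by positivity
        have h2 : (|z - z₀| - κ) ^ 2 / (2 * κ)
            = (2 * κ)⁻¹ * (z ^ 2 + (z₀ ^ 2 - 2 * z₀ * z)) + κ / 2 - |z - z₀| := by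
          rw [sub_sq, sq_abs]; field_simp; ring
        have h3 : (x : ℝ) * (z - z₀) ≤ n * |z - z₀| :=
          (mul_le_mul_of_nonneg_left (le_abs_self _) (Nat.cast_nonneg x)).trans
            (mul_le_mul_of_nonneg_right hxn (abs_nonneg _))
        have h4 : n * |z - z₀| ≤ n * ((2 * κ)⁻¹ * (z ^ 2 + (z₀ ^ 2 - 2 * z₀ * z)) + κ / 2) := by
          gcongr; linarith
        linarith
      rw [chainE_add, chainE_const_mul, chainE_const_mul, chainE_add, chainE_const_mul,
        chainE_const, chainE_add, chainE_sub, chainE_const, chainE_const_mul] at hb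
      rw [chainE_id_succ hn]
      set a := chainE n k p t (fun x => (x : ℝ)) m
      set b := chainE n k p t (fun x => (x : ℝ) * runRatio n k 1 (p + t) x) m
      set Ez := chainE n k p t (runRatio n k 1 (p + t)) m
      set S := chainE n k p t (fun x => runRatio n k 1 (p + t) x ^ 2) m
      have hb2 : b ≤ w * a + n * κ := by
        have h5 : S + (z₀ ^ 2 - 2 * z₀ * Ez) ≤ κ ^ 2 := by
          have := mul_le_mul_of_nonneg_left hz1 z00
          nlinarith
        have h6 : (2 * κ)⁻¹ * (S + (z₀ ^ 2 - 2 * z₀ * Ez)) ≤ (2 * κ)⁻¹ * κ ^ 2 := by gcongr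
        have h7 : (2 * κ)⁻¹ * κ ^ 2 = κ / 2 := by field_simp
        have h8 : n * ((2 * κ)⁻¹ * (S + (z₀ ^ 2 - 2 * z₀ * Ez)) + κ / 2) ≤ n * κ := by
          gcongr; linarith
        have h9 : z₀ * a ≤ w * a := by gcongr
        linarith
      have h10 : w / n * ((n : ℝ)⁻¹ * b) ≤ w / n * ((n : ℝ)⁻¹ * (w * a + n * κ)) := by gcongr
      have h11 : w / n * ((n : ℝ)⁻¹ * (w * a + n * κ)) = w / n * (w / n * a) + w / n * κ := by
        field_simp
      have h12 := mul_le_mul_of_nonneg_right ih u0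
      rw [pow_succ]
      nlinarith
  have h1 := key t₁ le_rfl
  have h2 := chainE_mono (n := n) (k := k) (p := p) (t := t₁) (m := m) (by omega) h
    (f := fun x => (x : ℝ)) (g := fun _ => (n : ℝ)) fun x hx => by
      exact_mod_cast ((cpl_pos_iff (by omega)).1 hx).2
  rw [chainE_const] at h2
  calc _ ≤ _ := h1
    _ ≤ w / n * n := by gcongr
    _ = w := by field_simp

end SecondMoment

/-- A slowly growing number of rows. -/
def slow (n : ℕ) : ℕ := Nat.sqrt (Nat.sqrt n)

lemma slow_pow_le (n : ℕ) : slow n ^ 4 ≤ n := by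
  have h1 := Nat.sqrt_le' n
  have h2 := Nat.sqrt_le' (Nat.sqrt n)
  calc slow n ^ 4 = (slow n ^ 2) ^ 2 := by ring
    _ ≤ (Nat.sqrt n) ^ 2 := Nat.pow_le_pow_left h2 2
    _ ≤ n := h1

lemma lt_slow_pow (n : ℕ) : n < (slow n + 1) ^ 4 := by
  have h1 := Nat.lt_succ_sqrt' n
  have h2 := Nat.lt_succ_sqrt' (Nat.sqrt n)
  calc n < (Nat.sqrt n + 1) ^ 2 := h1
    _ ≤ ((slow n + 1) ^ 2) ^ 2 := Nat.pow_le_pow_left h2 2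
    _ = _ := by ring

lemma tendsto_slow : Tendsto slow atTop atTop := by
  refine tendsto_atTop.2 fun b => ?_
  filter_upwards [eventually_ge_atTop ((b + 1) ^ 4)] with n hn
  by_contra h
  have h1 := lt_slow_pow n
  have h2 : (slow n + 1) ^ 4 ≤ (b + 1) ^ 4 := Nat.pow_le_pow_left (by omega) 4
  omega

lemma tendsto_slow_sq_div : Tendsto (fun n : ℕ => (slow n : ℝ) ^ 2 / n) atTop (𝓝 0) := by
  have h1 : Tendsto (fun n : ℕ => ((slow n : ℝ) ^ 2)⁻¹) atTop (𝓝 0) :=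
    (tendsto_inv_atTop_zero.comp
      ((tendsto_pow_atTop two_ne_zero).comp (tendsto_natCast_atTop_atTop (R := ℝ)))).comp
      tendsto_slow
  refine squeeze_zero' (Eventually.of_forall fun n => by positivity) ?_ h1
  filter_upwards [tendsto_slow.eventually_gt_atTop 0, eventually_gt_atTop 0] with n h2 h3
  have h4 : (slow n : ℝ) ^ 4 ≤ n := by exact_mod_cast slow_pow_le n
  rw [div_le_iff₀ (by positivity), inv_mul_eq_div, le_div_iff₀ (by positivity)]
  calc _ = (slow n : ℝ) ^ 4 := by ring
    _ ≤ n := h4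

lemma tendsto_slow_div : Tendsto (fun n : ℕ => (slow n : ℝ) / n) atTop (𝓝 0) := by
  refine squeeze_zero' (Eventually.of_forall fun n => by positivity) ?_ tendsto_slow_sq_div
  filter_upwards [tendsto_slow.eventually_gt_atTop 0] with n h2
  have : (1 : ℝ) ≤ slow n := by exact_mod_cast h2
  gcongr
  nlinarith

lemma tendsto_mul_exp_slow {c : ℝ} (hc : 0 < c) :
    Tendsto (fun n : ℕ => (n : ℝ) * Real.exp (-c * slow n)) atTop (𝓝 0) := by
  have h := (Real.tendsto_pow_mul_exp_neg_atTop_nhds_zero 4).comp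
    (((tendsto_natCast_atTop_atTop (R := ℝ)).atTop_add
      (tendsto_const_nhds (x := (1 : ℝ)))).const_mul_atTop hc)
  have h2 := ((h.comp tendsto_slow).const_mul (c⁻¹ ^ 4 * Real.exp c))
  rw [mul_zero] at h2
  refine squeeze_zero (fun n => by positivity) (fun n => ?_) h2
  have h3 : (n : ℝ) ≤ (slow n + 1) ^ 4 := by exact_mod_cast (lt_slow_pow n).le
  simp only [Function.comp]
  calc (n : ℝ) * Real.exp (-c * slow n) ≤ (slow n + 1) ^ 4 * Real.exp (-c * slow n) := by gcongr
    _ = _ := by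
      have : Real.exp (-c * slow n) = Real.exp c * Real.exp (-(c * (slow n + 1))) := by
        rw [← Real.exp_add]; congr 1; ring
      rw [this]
      field_simp

section Omega

variable {k : ℕ} {ω : ℝ}

lemma exp_neg_lt_of_lt {w : ℝ} (hk : 0 < k) (hωe : Real.exp (-(k * ω)) = 1 - ω)
    (hw : 0 < w) (hwω : w < ω) : Real.exp (-(k * w)) < 1 - w := by
  have hω : 0 < ω := hw.trans hwω
  have hk' : (0 : ℝ) < k := by exact_mod_cast hk
  have h := strictConvexOn_exp.2 (Set.mem_univ (0 : ℝ)) (Set.mem_univ (-(k * ω)))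
    (by have : 0 < k * ω := by positivity
        linarith : (0 : ℝ) ≠ -(k * ω))
    (show 0 < 1 - w / ω by have := (div_lt_one hω).2 hwω; linarith)
    (show 0 < w / ω by positivity) (by ring)
  simp only [smul_eq_mul, mul_zero, Real.exp_zero, hωe, zero_add] at h
  have e1 : w / ω * -(k * ω) = -(k * w) := by field_simp
  have e2 : (1 - w / ω) * 1 + w / ω * (1 - ω) = 1 - w := by field_simp; ring
  rwa [e1, e2] at h

lemma lt_exp_neg_of_lt {w : ℝ} (hk : 0 < k) (hωe : Real.exp (-(k * ω)) = 1 - ω)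
    (hω : 0 < ω) (hwω : ω < w) : 1 - w < Real.exp (-(k * w)) := by
  have hw : 0 < w := hω.trans hwω
  have hk' : (0 : ℝ) < k := by exact_mod_cast hk
  have h := strictConvexOn_exp.2 (Set.mem_univ (0 : ℝ)) (Set.mem_univ (-(k * w)))
    (by have : 0 < k * w := by positivity
        linarith : (0 : ℝ) ≠ -(k * w))
    (show 0 < 1 - ω / w by have := (div_lt_one hw).2 hwω; linarith)
    (show 0 < ω / w by positivity) (by ring)
  simp only [smul_eq_mul, mul_zero, Real.exp_zero, zero_add] at h
  have e1 : ω / w * -(k * w) = -(k * ω) := by field_simp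
  rw [e1, hωe] at h
  have h2 : ω / w * (1 - w) < ω / w * Real.exp (-(k * w)) := by
    have : ω / w * (1 - w) = ω / w - ω := by field_simp
    linarith
  exact lt_of_mul_lt_mul_left h2 (by positivity)

/-- The boundary is not approached before the very end of the exploration. -/
lemma exists_boundary_tail_of_lt_one (hk : 0 < k) (hωe : Real.exp (-(k * ω)) = 1 - ω)
    (hω : 0 < ω) (hω1 : ω < 1) {γ : ℝ} (hγ : 0 < γ) (hγ1 : γ < 1) (l : ℕ) :
    ∃ K c : ℝ, 0 < K ∧ 0 < c ∧ ∀ᶠ n : ℕ in atTop, ∀ p m t : ℕ, 0 < cpl n k p m → p ≤ m + l →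
      p + l ≤ k * n → p + t ≤ k * n → ((p + t : ℕ) : ℝ) ≤ γ * (k * n) →
      chainE n k p t (fun x => if k * x ≤ p + t + l then 1 else 0) m ≤ K * Real.exp (-c * p) := by
  obtain ⟨γ', h1, h2⟩ := exists_between hγ1
  have hu : γ' * ω < ω := by nlinarith
  have hw : ω < γ' * ω / γ := by rw [lt_div_iff₀ hγ]; nlinarith
  obtain ⟨w, h3, h4⟩ := exists_between (lt_min hω1 hw)
  have h5 := h4.trans_le (min_le_left _ _)
  have h6 := h4.trans_le (min_le_right _ _)
  have hu0 : 0 < γ' * ω := mul_pos (hγ.trans h1) hω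
  obtain ⟨K, c, hK, hc, h⟩ := exists_boundary_tail hk (w := w) (u₁ := γ' * ω) (hω.trans h3) h5
    (lt_exp_neg_of_lt hk hωe hω h3) hu0 (hu.trans hω1) (by
      have := exp_neg_lt_of_lt hk hωe hu0 hu
      have := (Real.lt_log_iff_exp_lt (by linarith)).2 this
      linarith) l
  refine ⟨K, c, hK, hc, ?_⟩
  filter_upwards [h] with n hn p m t a1 a2 a3 a4 a5
  refine hn p m t a1 a2 a3 a4 ?_
  rw [lt_div_iff₀ hγ] at h6
  push_cast at a5
  calc w * ((p : ℝ) + t) ≤ w * (γ * (k * n)) := by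
        have := hω.trans h3
        gcongr
    _ = (w * γ) * (k * n) := by ring
    _ ≤ _ := by gcongr

lemma eventually_runRatio_lt (hωe : Real.exp (-(k * ω)) = 1 - ω)
    (hω : 0 < ω) (hk : 2 ≤ k) {w : ℝ} (hw : ω < w) (hw1 : w < 1) (i : ℕ) :
    ∀ᶠ n : ℕ in atTop, runRatio n k 1 (k * slow n + i) (k * slow n + 1) < w := by
  have h1 : Tendsto (fun n : ℕ => (1 - w * (k * (slow n / n) + 1 / n)) * (1 - w / n) ^ (k * n))
      atTop (𝓝 (Real.exp (-(k * w)))) := by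
    have h2 := ((((tendsto_slow_div.const_mul (k : ℝ)).add
      (tendsto_one_div_atTop_nhds_zero_nat (𝕜 := ℝ))).const_mul w).const_sub 1).mul
      (tendsto_one_sub_div_pow k w)
    simpa using h2
  have h3 := lt_exp_neg_of_lt (by omega) hωe hω hw
  have hs : Tendsto (fun n => (slow n : ℝ) / n) atTop (𝓝 0) := tendsto_slow_div
  have h4 : ∀ᶠ n : ℕ in atTop, (slow n : ℝ) / n < 1 / (2 * k) :=
    hs.eventually (gt_mem_nhds (by positivity))
  filter_upwards [h1.eventually (lt_mem_nhds h3), h4, tendsto_slow.eventually_ge_atTop (i + 1),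
    eventually_ge_atTop (2 * i + 2)] with n h5 h6 h7 h8
  by_contra! hc
  have hn : 0 < n := by omega
  have hn' : (0 : ℝ) < n := by exact_mod_cast hn
  have h9 : 2 * (k * slow n) < n := by
    rw [div_lt_div_iff₀ hn' (by positivity)] at h6
    have : ((2 * (k * slow n) : ℕ) : ℝ) < n := by push_cast; linarith
    exact_mod_cast this
  have hkn : 2 * n ≤ k * n := Nat.mul_le_mul_right n hk
  have hV : 0 < cpl n k (k * slow n + i) (k * slow n + 1) := by
    refine cpl_pos ?_ (by omega)
    have h10 : 2 * (k * slow n) ≤ k * (k * slow n) := Nat.mul_le_mul_right _ hk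
    have h11 : 2 * slow n ≤ k * slow n := Nat.mul_le_mul_right _ hk
    rw [Nat.mul_add]
    omega
  have h12 := lower_bound_of_le_runRatio (hω.trans hw) hw1 (by omega) hn hV hc
  obtain ⟨u0, u1⟩ := div_mem_unit (hω.trans hw) hw1 hn
  have hw0 := hω.trans hw
  have e1 : w * ((k * slow n + 1 : ℕ) : ℝ) / n = w * (k * (slow n / n) + 1 / n) := by
    push_cast; field_simp
  rw [e1] at h12
  have h13 : (1 - w / n) ^ (k * n) ≤ (1 - w / n) ^ (k * n - (k * slow n + i)) :=
    pow_le_pow_of_le_one u0 u1 (by omega)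
  have h14 : 0 ≤ 1 - w * (k * (slow n / n) + 1 / n) := by
    rw [← e1, mul_div_assoc]
    have : ((k * slow n + 1 : ℕ) : ℝ) / n ≤ 1 := by
      rw [div_le_one hn']; exact_mod_cast (by omega : k * slow n + 1 ≤ n)
    have : w * (((k * slow n + 1 : ℕ) : ℝ) / n) ≤ 1 * 1 := by gcongr
    linarith
  have := mul_le_mul_of_nonneg_left h13 h14
  linarith

end Omega

section Omega

variable {k : ℕ} {ω : ℝ}

lemma eventually_slow_le (hk : 0 < k) (i : ℕ) {η : ℝ} (hη : 0 < η) :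
    ∀ᶠ n : ℕ in atTop, ((k * slow n + i : ℕ) : ℝ) ≤ η * (k * n) := by
  have h : Tendsto (fun n : ℕ => (k : ℝ) * (slow n / n) + i / n) atTop (𝓝 (k * 0 + 0)) :=
    (tendsto_slow_div.const_mul (k : ℝ)).add (tendsto_const_div_atTop_nhds_zero_nat (i : ℝ))
  have hk' : (0 : ℝ) < k := by exact_mod_cast hk
  have h1 : (k : ℝ) * 0 + 0 < η * k := by
    rw [mul_zero, add_zero]
    positivity
  have h2 := h.eventually (gt_mem_nhds h1)
  filter_upwards [h2, eventually_gt_atTop 0] with n h3 hn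
  have hn' : (0 : ℝ) < n := by exact_mod_cast hn
  have h4 : (k : ℝ) * (slow n / n) + i / n = (k * slow n + i) / n := by ring
  rw [h4, div_lt_iff₀ hn'] at h3
  push_cast
  linarith

lemma eventually_cpl_slow_pos (hk : 2 ≤ k) (i : ℕ) :
    ∀ᶠ n : ℕ in atTop, 0 < cpl n k (k * slow n + i) (k * slow n + 1) := by
  have hk0 : (0 : ℝ) < k := by exact_mod_cast (by omega : 0 < k)
  filter_upwards [eventually_slow_le (k := k) (by omega) 1 (η := 1 / k) (by positivity),
    tendsto_slow.eventually_ge_atTop i] with n h6 h7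
  have h9 : k * slow n + 1 ≤ n := by
    have : ((k * slow n + 1 : ℕ) : ℝ) ≤ n := by
      refine h6.trans (le_of_eq ?_); field_simp
    exact_mod_cast this
  refine cpl_pos ?_ h9
  have h10 : 2 * (k * slow n) ≤ k * (k * slow n) := Nat.mul_le_mul_right _ hk
  have h11 : 2 * slow n ≤ k * slow n := Nat.mul_le_mul_right _ hk
  rw [Nat.mul_add]
  omega

lemma tendsto_natFloor_mul_div {a : ℝ} (ha : 0 ≤ a) :
    Tendsto (fun n : ℕ => (⌊a * n⌋₊ : ℝ) / n) atTop (𝓝 a) :=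
  (tendsto_nat_floor_mul_div_atTop ha).comp tendsto_natCast_atTop_atTop

lemma eventually_lt_runRatio (hωe : Real.exp (-(k * ω)) = 1 - ω)
    (hω : 0 < ω) (hω1 : ω < 1) (hk : 2 ≤ k) {w : ℝ} (hw : 0 < w) (hwω : w < ω) (i : ℕ) :
    ∀ᶠ n : ℕ in atTop, w < runRatio n k 1 (k * slow n + i) (k * slow n + 1) := by
  have hk' : (0 : ℝ) < k := by exact_mod_cast (by omega : 0 < k)
  have hw1 : w < 1 := hwω.trans hω1
  -- choice of the parameters
  have h1 := exp_neg_lt_of_lt (by omega) hωe hw hwω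
  have h2 : -Real.log (1 - w) / (w * k) < 1 := by
    rw [div_lt_one (by positivity)]
    have := (Real.lt_log_iff_exp_lt (by linarith)).2 h1
    linarith
  obtain ⟨γ₁, h3, h4⟩ := exists_between (max_lt (show (1 : ℝ) / 2 < 1 by norm_num) h2)
  have hγ : 1 / 2 < γ₁ := (le_max_left _ _).trans_lt h3
  have h5 : Real.exp (-(w * (γ₁ * k))) < 1 - w := by
    rw [← Real.lt_log_iff_exp_lt (by linarith)]
    have := (le_max_right _ _).trans_lt h3
    rw [div_lt_iff₀ (by positivity)] at this
    linarith
  obtain ⟨γ₂, h6, h7⟩ := exists_between h4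
  obtain ⟨γ, h8, h9⟩ := exists_between h7
  set E := 1 - Real.exp (-(w * (γ₁ * k))) with hE
  have hE0 : w < E := by linarith
  obtain ⟨κ, hκ, hκ1⟩ := exists_between (show 0 < 1 - w / E by
    have := (div_lt_one (hw.trans hE0)).2 hE0; linarith)
  have hκE : w < (1 - κ) * E := by
    have : w / E < 1 - κ := by linarith
    rwa [div_lt_iff₀ (hw.trans hE0)] at this
  set lam : ℝ := 2 / κ ^ 2 with hlam
  have hlam0 : 0 < lam := by positivity
  obtain ⟨K, c, hK, hc, htail⟩ := exists_boundary_tail_of_lt_one (k := k) (by omega) hωe hω hω1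
    (by linarith : 0 < γ) h9 (i + 2)
  set t₁ : ℕ → ℕ := fun n => ⌊γ₁ * k * n⌋₊
  set t₂ : ℕ → ℕ := fun n => ⌊γ₂ * k * n⌋₊
  have l1 : Tendsto (fun n : ℕ => (t₁ n : ℝ) / n) atTop (𝓝 (γ₁ * k)) :=
    tendsto_natFloor_mul_div (by positivity)
  have l2 : Tendsto (fun n : ℕ => (t₂ n : ℝ) / n) atTop (𝓝 (γ₂ * k)) :=
    tendsto_natFloor_mul_div (by nlinarith)
  -- the bound on the second moment
  have v1 : Tendsto (fun n : ℕ => (t₂ n : ℝ) * (K * Real.exp (-(c * k) * slow n))) atTop (𝓝 0) := by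
    have := (l2.mul (tendsto_mul_exp_slow (c := c * k) (by positivity))).const_mul K
    rw [mul_zero, mul_zero] at this
    refine this.congr' ?_
    filter_upwards [eventually_gt_atTop 0] with n hn
    have hn' : (n : ℝ) ≠ 0 := by positivity
    field_simp
  have v2 : Tendsto (fun n : ℕ => lam / ((t₂ n : ℝ) - t₁ n)) atTop (𝓝 0) := by
    have h := (tendsto_const_div_atTop_nhds_zero_nat lam).div (l2.sub l1)
      (by have : γ₁ * k < γ₂ * k := by gcongr
          linarith)
    rw [zero_div] at h
    refine h.congr' ?_
    filter_upwards [eventually_gt_atTop 0] with n hn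
    have hn' : (n : ℝ) ≠ 0 := by positivity
    simp only [Pi.div_apply]
    rw [← sub_div, div_div_div_cancel_right₀ hn']
  have v := (v1.add v2).add_const (1 / (2 * lam))
  have hlk : 1 / (2 * lam) = κ ^ 2 / 4 := by rw [hlam]; field_simp; norm_num
  have hlk' : 0 + 0 + 1 / (2 * lam) < κ ^ 2 := by
    have : 0 < κ ^ 2 := by positivity
    rw [hlk]
    linarith
  have ev1 := v.eventually (gt_mem_nhds hlk')
  -- the limit of the main inequality
  have ev2 : ∀ᶠ n : ℕ in atTop, w < (1 - κ) * (1 - Real.exp (-(w * (t₁ n / n)))) := by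
    have : Tendsto (fun n : ℕ => (1 - κ) * (1 - Real.exp (-(w * (t₁ n / n))))) atTop
        (𝓝 ((1 - κ) * E)) :=
      (((Real.continuous_exp.tendsto _).comp (l1.const_mul w).neg).const_sub 1).const_mul _
    exact this.eventually (lt_mem_nhds hκE)
  have ev3 := (l2.sub l1).eventually (lt_mem_nhds (a := 0) (by
    have : γ₁ * k < γ₂ * k := by gcongr
    linarith))
  have ev4 := l1.eventually (lt_mem_nhds (a := (k : ℝ) / 2) (by nlinarith))
  have ev5 := eventually_slow_le (k := k) (by omega) (i + (i + 2) + 2) (η := γ - γ₂) (by linarith)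
  filter_upwards [htail, ev1, ev2, ev3, ev4, ev5, eventually_cpl_slow_pos hk i,
    eventually_gt_atTop 0] with n a1 a2 a3 a4 a5 a6 a7 hn
  have hn' : (0 : ℝ) < n := by exact_mod_cast hn
  by_contra! hcon
  have ht : t₁ n < t₂ n := by
    have : (t₁ n : ℝ) / n < t₂ n / n := by linarith
    rw [div_lt_div_iff_of_pos_right hn'] at this
    exact_mod_cast this
  have hγ₂ : 0 < γ₂ := by linarith
  have ht2 : (t₂ n : ℝ) ≤ γ₂ * k * n := Nat.floor_le (by positivity)
  have hroom : ((k * slow n + (i + (i + 2) + 2) + t₂ n : ℕ) : ℝ) ≤ γ * (k * n) := by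
    rw [Nat.cast_add]
    linarith
  have hroom' : k * slow n + (i + (i + 2) + 2) + t₂ n ≤ k * n := by
    have h10 : γ * (k * n) ≤ 1 * (k * n) := by gcongr
    have : ((k * slow n + (i + (i + 2) + 2) + t₂ n : ℕ) : ℝ) ≤ (k * n : ℕ) := by
      push_cast at hroom h10 ⊢; linarith
    exact_mod_cast this
  have hmid : k * n ≤ 2 * (k * slow n + i + t₁ n) := by
    rw [lt_div_iff₀ hn'] at a5
    have : ((k * n : ℕ) : ℝ) ≤ ((2 * t₁ n : ℕ) : ℝ) := by push_cast; linarith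
    have : k * n ≤ 2 * t₁ n := by exact_mod_cast this
    omega
  have he : ∀ s < t₂ n, chainE n k (k * slow n + i) s
      (fun x => if k * x ≤ k * slow n + i + s + 2 then 1 else 0) (k * slow n + 1)
      ≤ K * Real.exp (-(c * k) * slow n) := by
    intro s hs
    have hb := a1 (k * slow n + i) (k * slow n + 1) s a7 (by omega) (by omega) (by omega) (by
      refine le_trans ?_ hroom
      exact_mod_cast (by omega))
    refine le_trans (chainE_mono (by omega) a7 fun x _ => ?_) (hb.trans ?_)
    · split_ifs <;> first | omega | norm_num
    · refine mul_le_mul_of_nonneg_left (Real.exp_le_exp.2 ?_) hK.le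
      have : 0 ≤ c * i := by positivity
      push_cast
      linarith
  have hfin := upper_bound_of_runRatio_le ht hlam0 (by positivity) (by omega) a7 hmid he hκ a2.le hw
    hw1 hcon
  have hpow : (1 - w / n) ^ t₁ n ≤ Real.exp (-(w * (t₁ n / n))) := by
    obtain ⟨u0, u1⟩ := div_mem_unit hw hw1 hn
    calc (1 - w / n) ^ t₁ n ≤ Real.exp (-(w / n)) ^ t₁ n := by
          gcongr; exact Real.one_sub_le_exp_neg _
      _ = _ := by rw [← Real.exp_nat_mul]; congr 1; ring
  have hκ1' : 0 ≤ 1 - κ := by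
    have : 0 < w / E := by have := hw.trans hE0; positivity
    linarith
  have := mul_le_mul_of_nonneg_left hpow hκ1'
  linarith

lemma tendsto_runRatio_one (hωe : Real.exp (-(k * ω)) = 1 - ω)
    (hω : 0 < ω) (hω1 : ω < 1) (hk : 2 ≤ k) (i : ℕ) :
    Tendsto (fun n => runRatio n k 1 (k * slow n + i) (k * slow n + 1)) atTop (𝓝 ω) := by
  rw [tendsto_order]
  constructor
  · intro a ha
    obtain ⟨w, h1, h2⟩ := exists_between (max_lt hω ha)
    filter_upwards [eventually_lt_runRatio hωe hω hω1 hk ((le_max_left _ _).trans_lt h1) h2 i]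
      with n hn
    exact (le_max_right _ _).trans_lt (h1.trans hn)
  · intro a ha
    obtain ⟨w, h1, h2⟩ := exists_between (lt_min hω1 ha)
    filter_upwards [eventually_runRatio_lt hωe hω hk h1 (h2.trans_le (min_le_left _ _)) i]
      with n hn
    exact hn.trans (h2.trans_le (min_le_right _ _))

/-- The run ratio at the end of the initial phase converges. -/
lemma tendsto_runRatio (hωe : Real.exp (-(k * ω)) = 1 - ω)
    (hω : 0 < ω) (hω1 : ω < 1) (hk : 2 ≤ k) (l : ℕ) :
    Tendsto (fun n => runRatio n k l (k * slow n) (k * slow n + 1)) atTop (𝓝 (ω ^ l)) := by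
  induction l with
  | zero =>
    refine tendsto_const_nhds.congr' ?_
    filter_upwards [eventually_cpl_slow_pos hk 0] with n hn
    rw [add_zero] at hn
    rw [runRatio_zero hn, pow_zero]
  | succ l ih =>
    rw [pow_succ]
    refine (ih.mul (tendsto_runRatio_one hωe hω hω1 hk l)).congr' ?_
    filter_upwards [eventually_cpl_slow_pos hk l] with n hn
    rw [runRatio_succ hn]

end Omega

lemma letterStep_nonneg {f : ℕ → ℝ} (hf : ∀ x, 0 ≤ f x) (q m : ℕ) : 0 ≤ letterStep^[q] f m := by
  induction q generalizing m with
  | zero => exact hf m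
  | succ q ih =>
    rw [Function.iterate_succ_apply']
    have h1 := ih m
    have h2 := ih (m + 1)
    simp only [letterStep]
    positivity

lemma letterStep_eq_zero {f : ℕ → ℝ} {n : ℕ} (hf : ∀ x, n < x → f x = 0) (q : ℕ) {m : ℕ}
    (hm : n < m) : letterStep^[q] f m = 0 := by
  induction q generalizing m with
  | zero => exact hf m hm
  | succ q ih =>
    rw [Function.iterate_succ_apply']
    simp [letterStep, ih hm, ih (hm.trans (Nat.lt_succ_self m))]

lemma letterStep_sum {ι : Type*} (s : Finset ι) (c : ι → ℝ) (f : ι → ℕ → ℝ) (q m : ℕ) :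
    letterStep^[q] (fun x => ∑ i ∈ s, c i * f i x) m = ∑ i ∈ s, c i * letterStep^[q] (f i) m := by
  induction q generalizing m with
  | zero => rfl
  | succ q ih =>
    simp only [Function.iterate_succ_apply', letterStep, ih, Finset.mul_sum]
    rw [← Finset.sum_add_distrib]
    exact Finset.sum_congr rfl fun i _ => by ring

lemma letterStep_mono {f g : ℕ → ℝ} {m : ℕ} (hfg : ∀ x, m ≤ x → f x ≤ g x) (q : ℕ) :
    letterStep^[q] f m ≤ letterStep^[q] g m := by
  induction q generalizing m with
  | zero => exact hfg m le_rfl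
  | succ q ih =>
    simp only [Function.iterate_succ_apply', letterStep]
    have h1 := ih hfg
    have h2 := ih (m := m + 1) fun x hx => hfg x (by omega)
    gcongr

/-- Row-level completion numbers, where the rows with index in `D` are not allowed to discover
new states and carry no multiplicity. Here `i` rows are left and `j` rows have been read. -/
noncomputable def skipW (n k : ℕ) (D : Finset ℕ) : ℕ → ℕ → ℕ → ℝ
  | 0, _, m => if m = n then 1 else 0
  | i + 1, j, m => if j < m then
      (if j ∈ D then skipW n k D i (j + 1) m else letterStep^[k] (skipW n k D i (j + 1)) m) else 0

/-- Completion numbers of explorations ending with exactly `r` pairs of equal rows and no triple,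
starting with `l` pairs, `j` rows read and `i` rows left. -/
noncomputable def pairW (n k r : ℕ) : ℕ → ℕ → ℕ → ℕ → ℝ
  | 0, _, m, l => if m = n ∧ l = r then 1 else 0
  | i + 1, j, m, l => if j < m then
      letterStep^[k] (fun x => pairW n k r i (j + 1) x l) m
        - ((j : ℝ) - l) * pairW n k r i (j + 1) m l
        + ((j : ℝ) - 2 * l) * pairW n k r i (j + 1) m (l + 1) else 0

/-- Coefficients of the expansion of `pairW` in terms of `skipW`. -/
noncomputable def coef (r : ℕ) (D : Finset ℕ) : ℕ → ℕ → ℕ → ℝ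
  | 0, _, l => if l = r then 1 else 0
  | i + 1, j, l => if j ∈ D then
      -((j : ℝ) - l) * coef r D i (j + 1) l + ((j : ℝ) - 2 * l) * coef r D i (j + 1) (l + 1)
    else coef r D i (j + 1) l

lemma skipW_congr {n k : ℕ} {D D' : Finset ℕ} {i j : ℕ} (h : ∀ x, j ≤ x → (x ∈ D ↔ x ∈ D')) :
    skipW n k D i j = skipW n k D' i j := by
  induction i generalizing j with
  | zero => rfl
  | succ i ih =>
    funext m
    simp only [skipW, h j le_rfl, ih (j := j + 1) fun x hx => h x (by omega)]

lemma coef_congr {r : ℕ} {D D' : Finset ℕ} {i j : ℕ} (h : ∀ x, j ≤ x → (x ∈ D ↔ x ∈ D')) :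
    coef r D i j = coef r D' i j := by
  induction i generalizing j with
  | zero => rfl
  | succ i ih =>
    funext m
    simp only [coef, h j le_rfl, ih (j := j + 1) fun x hx => h x (by omega)]

lemma skipW_nonneg (n k : ℕ) (D : Finset ℕ) (i j m : ℕ) : 0 ≤ skipW n k D i j m := by
  induction i generalizing j m with
  | zero => simp only [skipW]; split_ifs <;> norm_num
  | succ i ih =>
    simp only [skipW]
    split_ifs
    · exact ih _ _
    · exact letterStep_nonneg (fun x => ih _ x) _ _
    · exact le_rfl

lemma skipW_eq_zero {n k : ℕ} {D : Finset ℕ} {i j m : ℕ} (h : n < m) : skipW n k D i j m = 0 := by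
  induction i generalizing j m with
  | zero => simp [skipW, h.ne']
  | succ i ih =>
    simp only [skipW]
    split_ifs
    · exact ih h
    · exact letterStep_eq_zero (fun x hx => ih hx) _ h
    · rfl

lemma pairW_eq_zero {n k r i j m l : ℕ} (h : n < m) : pairW n k r i j m l = 0 := by
  induction i generalizing j m l with
  | zero => simp [pairW, h.ne']
  | succ i ih =>
    simp only [pairW]
    split_ifs
    · rw [letterStep_eq_zero (fun x hx => ih hx) _ h, ih h, ih h]
      ring
    · rfl

lemma pairW_eq_sum (n k r i j m l : ℕ) :
    pairW n k r i j m l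
      = ∑ D ∈ (Finset.Ico j (j + i)).powerset, coef r D i j l * skipW n k D i j m := by
  induction i generalizing j m l with
  | zero => simp only [pairW, add_zero, Finset.Ico_self, Finset.powerset_empty,
      Finset.sum_singleton, coef, skipW]; split_ifs <;> simp_all
  | succ i ih =>
    have hI : Finset.Ico j (j + (i + 1)) = insert j (Finset.Ico (j + 1) (j + 1 + i)) := by
      ext x; simp only [Finset.mem_Ico, Finset.mem_insert]; omega
    rw [hI, Finset.sum_powerset_insert (by simp), ← Finset.sum_add_distrib]
    simp only [pairW]
    by_cases hjm : j < m
    · rw [if_pos hjm]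
      simp only [ih]
      rw [letterStep_sum, Finset.mul_sum, Finset.mul_sum, ← Finset.sum_sub_distrib,
        ← Finset.sum_add_distrib]
      refine Finset.sum_congr rfl fun D hD => ?_
      have hj : j ∉ D := fun h => by
        have := Finset.mem_powerset.1 hD h
        simp at this
      have hc : ∀ x, j + 1 ≤ x → (x ∈ insert j D ↔ x ∈ D) := fun x hx => by
        rw [Finset.mem_insert]
        exact ⟨fun h => h.resolve_left (by omega), Or.inr⟩
      simp only [coef, skipW, if_neg hj, if_pos hjm, Finset.mem_insert_self, if_true,
        coef_congr hc, skipW_congr hc]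
      ring
    · rw [if_neg hjm]
      refine (Finset.sum_eq_zero fun D _ => ?_).symm
      simp [skipW, hjm]

lemma cpl_sub_eq_letterStep {n k j q m : ℕ} (hj : j < n) (hq : q ≤ k) (hm : j < m) :
    cpl n k (k * (j + 1) - q) m = letterStep^[q] (cpl n k (k * (j + 1))) m := by
  induction q generalizing m with
  | zero => rfl
  | succ q ih =>
    have h1 : k * (j + 1) ≤ k * n := Nat.mul_le_mul_left k hj
    have h2 : k * (j + 1) ≤ k * m := Nat.mul_le_mul_left k hm
    have h3 : k ≤ k * (j + 1) := Nat.le_mul_of_pos_right k (Nat.succ_pos j)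
    rw [cpl_rec (by omega), if_pos (by omega), Function.iterate_succ_apply', letterStep,
      show k * (j + 1) - (q + 1) + 1 = k * (j + 1) - q by omega, ih (by omega) hm,
      ih (by omega) (by omega)]

lemma cpl_row {n k j m : ℕ} (hj : j < n) :
    cpl n k (k * j) m = if j < m then letterStep^[k] (cpl n k (k * (j + 1))) m else 0 := by
  split_ifs with h
  · rw [← cpl_sub_eq_letterStep hj le_rfl h]
    congr 1
    rw [Nat.mul_succ]; omega
  · refine cpl_eq_zero_of_le (Nat.mul_le_mul_left k hj.le) (Nat.mul_le_mul_left k (not_lt.1 h)) ?_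
    omega

lemma skipW_empty {n k i j m : ℕ} (hij : i + j = n) :
    skipW n k ∅ i j m = cpl n k (k * j) m := by
  induction i generalizing j m with
  | zero =>
    obtain rfl : j = n := by omega
    rw [cpl_end, skipW]
  | succ i ih =>
    have : skipW n k ∅ i (j + 1) = cpl n k (k * (j + 1)) := by
      funext x; exact ih (by omega)
    rw [cpl_row (by omega), skipW, this]
    simp

/-- The states discovered after reading the rows of the states in `U`. -/
noncomputable def disc {n k : ℕ} (root : Fin n) (U : Finset (Fin n)) (δ : Fin n → Fin k → Fin n) :
    Finset (Fin n) :=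
  insert root (U.biUnion fun v => Finset.univ.image (δ v))

/-- The transition structures with prescribed rows on `U`. -/
noncomputable def agree {n k : ℕ} (U : Finset (Fin n)) (δ : Fin n → Fin k → Fin n) :
    Finset (Fin n → Fin k → Fin n) :=
  Finset.univ.filter fun δ' => ∀ x ∈ U, δ' x = δ x

/-- The rows in `U` form a partial exploration from `root`. -/
def Explored {n k : ℕ} (root : Fin n) (U : Finset (Fin n)) (δ : Fin n → Fin k → Fin n) : Prop :=
  U ⊆ disc root U δ ∧ ∀ δ' ∈ agree U δ, ∀ q ∈ disc root U δ, ∃ u, run δ' root u = q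

/-- The number of states in `U` whose row is `u`. -/
noncomputable def rowCount {n k : ℕ} (U : Finset (Fin n)) (δ : Fin n → Fin k → Fin n)
    (u : Fin k → Fin n) : ℕ :=
  (U.filter fun v => δ v = u).card

lemma mem_agree {n k : ℕ} {U : Finset (Fin n)} {δ δ' : Fin n → Fin k → Fin n} :
    δ' ∈ agree U δ ↔ ∀ x ∈ U, δ' x = δ x := by
  simp [agree]

lemma card_filter_agree_eq_sum {n k : ℕ} {U : Finset (Fin n)} {v : Fin n} (hv : v ∉ U)
    (δ : Fin n → Fin k → Fin n) (P : (Fin n → Fin k → Fin n) → Prop) [DecidablePred P] :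
    ((agree U δ).filter P).card
      = ∑ u, ((agree (insert v U) (Function.update δ v u)).filter P).card := by
  rw [Finset.card_eq_sum_card_fiberwise (f := fun δ' => δ' v) (t := Finset.univ)
    (fun _ _ => Finset.mem_coe.2 (Finset.mem_univ _))]
  refine Finset.sum_congr rfl fun u _ => ?_
  congr 1
  ext δ'
  have hU : ∀ x ∈ U, Function.update δ v u x = δ x := fun x hx =>
    Function.update_of_ne (ne_of_mem_of_not_mem hx hv) _ _
  simp only [Finset.mem_filter, mem_agree, Finset.forall_mem_insert, Function.update_self]
  constructor
  · rintro ⟨⟨h1, h2⟩, h3⟩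
    exact ⟨⟨h3, fun x hx => (h1 x hx).trans (hU x hx).symm⟩, h2⟩
  · rintro ⟨⟨h3, h1⟩, h2⟩
    exact ⟨⟨fun x hx => (h1 x hx).trans (hU x hx), h2⟩, h3⟩

lemma agree_univ {n k : ℕ} (δ : Fin n → Fin k → Fin n) : agree Finset.univ δ = {δ} := by
  ext δ'
  simp [mem_agree, funext_iff]

lemma disc_insert_update {n k : ℕ} {root : Fin n} {U : Finset (Fin n)} {v : Fin n} (hv : v ∉ U)
    (δ : Fin n → Fin k → Fin n) (u : Fin k → Fin n) :
    disc root (insert v U) (Function.update δ v u) = disc root U δ ∪ Finset.univ.image u := by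
  have hU : U.biUnion (fun x => Finset.univ.image (Function.update δ v u x))
      = U.biUnion fun x => Finset.univ.image (δ x) :=
    Finset.biUnion_congr rfl fun x hx => by
      rw [Function.update_of_ne (ne_of_mem_of_not_mem hx hv)]
  rw [disc, disc, Finset.biUnion_insert, hU, Function.update_self]
  ext x
  simp only [Finset.mem_insert, Finset.mem_union]
  tauto

lemma explored_empty {n k : ℕ} (root : Fin n) (δ : Fin n → Fin k → Fin n) :
    Explored root ∅ δ := by
  refine ⟨Finset.empty_subset _, fun δ' _ q hq => ⟨[], ?_⟩⟩
  simpa [disc, run, eq_comm] using hq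

lemma Explored.insert_update {n k : ℕ} {root : Fin n} {U : Finset (Fin n)} {v : Fin n}
    {δ : Fin n → Fin k → Fin n} (h : Explored root U δ) (hv : v ∉ U) (hv' : v ∈ disc root U δ)
    (u : Fin k → Fin n) : Explored root (insert v U) (Function.update δ v u) := by
  rw [Explored, disc_insert_update hv]
  refine ⟨Finset.insert_subset (Finset.mem_union_left _ hv')
    (h.1.trans Finset.subset_union_left), fun δ' hδ' q hq => ?_⟩
  rw [mem_agree, Finset.forall_mem_insert, Function.update_self] at hδ'
  have hδ : δ' ∈ agree U δ := mem_agree.2 fun x hx => by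
    rw [hδ'.2 x hx, Function.update_of_ne (ne_of_mem_of_not_mem hx hv)]
  rcases Finset.mem_union.1 hq with hq | hq
  · exact h.2 δ' hδ q hq
  · obtain ⟨a, -, rfl⟩ := Finset.mem_image.1 hq
    obtain ⟨w, hw⟩ := h.2 δ' hδ v hv'
    refine ⟨w ++ [a], ?_⟩
    rw [run] at hw ⊢
    rw [List.foldl_append, hw, List.foldl_cons, List.foldl_nil, hδ'.1]

lemma sum_row_factorial {n : ℕ} (q : ℕ) {f : ℕ → ℝ} (hf : ∀ x, n < x → f x = 0)
    (D : Finset (Fin n)) :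
    ∑ u : Fin q → Fin n, ((n - (D ∪ Finset.univ.image u).card).factorial : ℝ)
        * f (D ∪ Finset.univ.image u).card
      = ((n - D.card).factorial : ℝ) * letterStep^[q] f D.card := by
  induction q generalizing D with
  | zero => simp
  | succ q ih =>
    rw [← Fintype.sum_equiv (Fin.consEquiv fun _ => Fin n) _ _ fun _ => rfl,
      Fintype.sum_prod_type]
    have h1 : ∀ a : Fin n, ∀ u : Fin q → Fin n,
        D ∪ Finset.univ.image ((Fin.consEquiv fun _ => Fin n) (a, u))
          = insert a D ∪ Finset.univ.image u := by
      intro a u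
      ext x
      simp only [Finset.mem_union, Finset.mem_image, Finset.mem_univ, true_and, Finset.mem_insert,
        Fin.consEquiv, Equiv.coe_fn_mk, Fin.exists_fin_succ, Fin.cons_zero, Fin.cons_succ]
      tauto
    simp only [h1, ih]
    have h2 : ∀ a : Fin n, ((n - (insert a D).card).factorial : ℝ)
        * letterStep^[q] f (insert a D).card = if a ∈ D then
          ((n - D.card).factorial : ℝ) * letterStep^[q] f D.card else
          ((n - (D.card + 1)).factorial : ℝ) * letterStep^[q] f (D.card + 1) := by
      intro a
      split_ifs with ha
      · rw [Finset.insert_eq_of_mem ha]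
      · rw [Finset.card_insert_of_notMem ha]
    simp only [h2]
    rw [Finset.sum_ite, Finset.sum_const, Finset.sum_const, nsmul_eq_mul, nsmul_eq_mul,
      Function.iterate_succ_apply', letterStep, Finset.filter_notMem_eq_sdiff,
      ← Finset.compl_eq_univ_sdiff, Finset.card_compl, Fintype.card_fin]
    simp only [Finset.filter_mem_eq_inter, Finset.univ_inter]
    have hD : D.card ≤ n := by simpa using D.card_le_univ
    rcases hD.lt_or_eq with hD | hD
    · obtain ⟨d, hd⟩ : ∃ d, n - D.card = d + 1 := ⟨n - D.card - 1, by omega⟩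
      rw [show n - (D.card + 1) = d by omega, hd, Nat.factorial_succ]
      push_cast
      ring
    · rw [hD, letterStep_eq_zero hf q (Nat.lt_succ_self n)]
      simp

lemma not_accessible_of_disc_eq {n k : ℕ} {root : Fin n} (h0 : (root : ℕ) = 0)
    {U : Finset (Fin n)} {δ δ' : Fin n → Fin k → Fin n} (hδ : δ' ∈ agree U δ)
    (h : disc root U δ = U) (hU : U.card < n) : ¬ Accessible δ' := by
  intro hacc
  have hcl : ∀ (w : List (Fin k)) (q : Fin n), q ∈ U → run δ' q w ∈ U := by
    intro w
    induction w with
    | nil => exact fun q hq => hq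
    | cons a w ih =>
      intro q hq
      refine ih _ ?_
      rw [mem_agree.1 hδ q hq, ← h]
      exact Finset.mem_insert_of_mem (Finset.mem_biUnion.2 ⟨q, hq, by simp⟩)
  have huniv : U = Finset.univ := Finset.eq_univ_iff_forall.2 fun q => by
    obtain ⟨w, hw⟩ := hacc q
    rw [← hw]
    refine hcl w _ ?_
    rw [← h]
    refine Finset.mem_insert.2 (Or.inl (Fin.ext h0.symm))
  rw [huniv] at hU
  simp at hU

lemma Explored.accessible {n k : ℕ} {root : Fin n} (h0 : (root : ℕ) = 0)
    {δ : Fin n → Fin k → Fin n} (h : Explored root Finset.univ δ) : Accessible δ := by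
  intro q
  obtain ⟨u, hu⟩ := h.2 δ (mem_agree.2 fun _ _ => rfl) q (h.1 (Finset.mem_univ q))
  exact ⟨u, by rw [← hu]; congr 1; exact Fin.ext h0.symm⟩

lemma Explored.card_accessible {n k : ℕ} {root : Fin n} (h0 : (root : ℕ) = 0) (i : ℕ)
    {U : Finset (Fin n)} {δ : Fin n → Fin k → Fin n} (h : Explored root U δ)
    (hi : U.card + i = n) :
    (((agree U δ).filter Accessible).card : ℝ)
      = ((n - (disc root U δ).card).factorial : ℝ)
        * skipW n k ∅ i U.card (disc root U δ).card := by
  induction i generalizing U δ with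
  | zero =>
    obtain rfl : U = Finset.univ := Finset.card_eq_iff_eq_univ U |>.1 (by simpa using hi)
    have hd : disc root Finset.univ δ = Finset.univ := Finset.univ_subset_iff.1 h.1
    rw [agree_univ, Finset.filter_singleton, if_pos (h.accessible h0), hd]
    simp [skipW]
  | succ i ih =>
    by_cases hd : U.card < (disc root U δ).card
    · obtain ⟨v, hv', hv⟩ := Finset.exists_mem_notMem_of_card_lt_card hd
      have hc : (insert v U).card = U.card + 1 := Finset.card_insert_of_notMem hv
      rw [card_filter_agree_eq_sum hv, skipW, if_pos hd, if_neg (Finset.notMem_empty _),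
        ← sum_row_factorial k (fun x hx => skipW_eq_zero hx)]
      push_cast
      refine Finset.sum_congr rfl fun u _ => ?_
      rw [ih (h.insert_update hv hv' u) (by omega), disc_insert_update hv, hc]
    · rw [skipW, if_neg hd, mul_zero, Nat.cast_eq_zero, Finset.card_eq_zero,
        Finset.filter_eq_empty_iff]
      exact fun δ' hδ' => not_accessible_of_disc_eq h0 hδ'
        (Finset.eq_of_subset_of_card_le h.1 (by omega)).symm (by omega)

lemma disc_empty {n k : ℕ} (root : Fin n) (δ : Fin n → Fin k → Fin n) :
    disc root ∅ δ = {root} := by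
  simp [disc]

lemma agree_empty {n k : ℕ} (δ : Fin n → Fin k → Fin n) : agree ∅ δ = Finset.univ := by
  ext; simp [mem_agree]

lemma card_accSet {n : ℕ} (k : ℕ) (hn : 0 < n) :
    ((accSet n k).card : ℝ) = ((n - 1).factorial : ℝ) * cpl n k 0 1 := by
  have h := (explored_empty (k := k) ⟨0, hn⟩ fun _ _ => ⟨0, hn⟩).card_accessible rfl n (by simp)
  rw [agree_empty, disc_empty, Finset.card_singleton, Finset.card_empty,
    skipW_empty (by omega)] at h
  exact h

lemma rowCount_insert_update {n k : ℕ} {U : Finset (Fin n)} {v : Fin n} (hv : v ∉ U)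
    (δ : Fin n → Fin k → Fin n) (u w : Fin k → Fin n) :
    rowCount (insert v U) (Function.update δ v u) w
      = rowCount U δ w + if w = u then 1 else 0 := by
  have hU : (U.filter fun x => Function.update δ v u x = w) = U.filter fun x => δ x = w :=
    Finset.filter_congr fun x hx => by
      rw [Function.update_of_ne (ne_of_mem_of_not_mem hx hv)]
  rw [rowCount, rowCount, Finset.filter_insert, hU, Function.update_self]
  by_cases h : u = w
  · rw [if_pos h, if_pos h.symm, Finset.card_insert_of_notMem (by simp [hv])]
  · rw [if_neg h, if_neg (Ne.symm h), add_zero]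

lemma rowCount_le_of_mem_agree {n k : ℕ} {U : Finset (Fin n)} {δ δ' : Fin n → Fin k → Fin n}
    (h : δ' ∈ agree U δ) (u : Fin k → Fin n) : rowCount U δ u ≤ rowCount Finset.univ δ' u := by
  refine Finset.card_le_card fun v hv => ?_
  rw [Finset.mem_filter] at hv ⊢
  exact ⟨Finset.mem_univ _, (mem_agree.1 h v hv.1).trans hv.2⟩

lemma card_rowCount_eq {n k : ℕ} {U : Finset (Fin n)} {δ : Fin n → Fin k → Fin n}
    (h : ∀ u, rowCount U δ u ≤ 2) :
    (Finset.univ.filter fun u => rowCount U δ u = 1).card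
      + 2 * (Finset.univ.filter fun u => rowCount U δ u = 2).card = U.card := by
  rw [Finset.card_eq_sum_card_fiberwise (f := δ) (s := U) (t := Finset.univ)
    (fun _ _ => Finset.mem_coe.2 (Finset.mem_univ _)), Finset.card_filter, Finset.card_filter,
    Finset.mul_sum, ← Finset.sum_add_distrib]
  refine Finset.sum_congr rfl fun u _ => ?_
  have := h u
  change _ = rowCount U δ u
  interval_cases rowCount U δ u <;> simp

lemma not_hasM3_iff {n k : ℕ} (δ : Fin n → Fin k → Fin n) :
    ¬ HasM3 δ ↔ ∀ u, rowCount Finset.univ δ u ≤ 2 := by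
  rw [← not_iff_not, not_not]
  push Not
  simp only [rowCount, Finset.two_lt_card, Finset.mem_filter, Finset.mem_univ, true_and, HasM3,
    IsM3Motif]
  constructor
  · rintro ⟨i, j, h, hij, hih, hjh, hδ⟩
    exact ⟨δ j, i, funext fun a => (hδ a).1, j, rfl, h, funext fun a => (hδ a).2.symm, hij, hih,
      hjh⟩
  · rintro ⟨u, i, hi, j, hj, h, hh, hij, hih, hjh⟩
    exact ⟨i, j, h, hij, hih, hjh, fun a => by simp [hi, hj, hh]⟩

lemma mCount_eq_card {n k : ℕ} {δ : Fin n → Fin k → Fin n}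
    (h : ∀ u, rowCount Finset.univ δ u ≤ 2) :
    mCount δ = (Finset.univ.filter fun u => rowCount Finset.univ δ u = 2).card := by
  refine Finset.card_nbij (fun p => δ p.1) ?_ ?_ ?_
  · intro p hp
    obtain ⟨hlt, hp⟩ := (Finset.mem_filter.1 hp).2
    refine Finset.mem_coe.2 (Finset.mem_filter.2 ⟨Finset.mem_univ _, le_antisymm (h _) ?_⟩)
    refine Finset.one_lt_card.2 ⟨p.1, by simp, p.2, ?_, hlt.ne⟩
    simpa using (funext hp).symm
  · intro p hp p' hp' hpp
    obtain ⟨hlt, hp⟩ := (Finset.mem_filter.1 (Finset.mem_coe.1 hp)).2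
    obtain ⟨hlt', hp'⟩ := (Finset.mem_filter.1 (Finset.mem_coe.1 hp')).2
    have e2 := funext hp
    have e2' := funext hp'
    have hpp : δ p.1 = δ p'.1 := hpp
    by_contra hne
    obtain ⟨x, hx, hx1, hx2⟩ : ∃ x, δ x = δ p.1 ∧ x ≠ p.1 ∧ x ≠ p.2 := by
      by_contra! hno
      have a1 := hno p'.1 hpp.symm
      have a2 := hno p'.2 (by rw [← e2', hpp])
      apply hne
      by_cases c1 : p'.1 = p.1
      · have : p'.2 ≠ p.1 := by rw [← c1]; exact hlt'.ne'
        exact Prod.ext c1.symm (a2 this).symm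
      · have h3 := a1 c1
        have : p'.2 ≠ p.1 := by
          intro h4
          rw [h3, h4] at hlt'
          exact lt_asymm hlt hlt'
        have := a2 this
        rw [h3, this] at hlt'
        exact absurd hlt' (lt_irrefl _)
    have := h (δ p.1)
    refine absurd this (not_le.2 (Finset.two_lt_card.2 ⟨p.1, by simp, p.2, ?_, x, ?_, hlt.ne,
      hx1.symm, hx2.symm⟩))
    · simpa using e2.symm
    · simpa using hx
  · intro u hu
    obtain ⟨a, b, hab, hs⟩ := Finset.card_eq_two.1 (Finset.mem_filter.1 (Finset.mem_coe.1 hu)).2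
    have ha : δ a = u := by
      have : a ∈ Finset.univ.filter fun v => δ v = u := by rw [hs]; simp
      simpa using this
    have hb : δ b = u := by
      have : b ∈ Finset.univ.filter fun v => δ v = u := by rw [hs]; simp
      simpa using this
    rcases lt_or_gt_of_ne hab with hlt | hlt
    · exact ⟨(a, b), by simp [hlt, ha, hb], ha⟩
    · exact ⟨(b, a), by simp [hlt, ha, hb], hb⟩

lemma Explored.card_pairs {n k : ℕ} (r : ℕ) {root : Fin n} (h0 : (root : ℕ) = 0) (i : ℕ)
    {U : Finset (Fin n)} {δ : Fin n → Fin k → Fin n} (h : Explored root U δ)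
    (hi : U.card + i = n) (h2 : ∀ u, rowCount U δ u ≤ 2) :
    (((agree U δ).filter fun δ' => Accessible δ' ∧ ¬ HasM3 δ' ∧ mCount δ' = r).card : ℝ)
      = ((n - (disc root U δ).card).factorial : ℝ)
        * pairW n k r i U.card (disc root U δ).card
          (Finset.univ.filter fun u => rowCount U δ u = 2).card := by
  induction i generalizing U δ with
  | zero =>
    obtain rfl : U = Finset.univ := Finset.card_eq_iff_eq_univ U |>.1 (by simpa using hi)
    have hd : disc root Finset.univ δ = Finset.univ := Finset.univ_subset_iff.1 h.1
    rw [agree_univ, Finset.filter_singleton, hd, mCount_eq_card h2, pairW]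
    simp only [h.accessible h0, not_hasM3_iff, h2, true_and, implies_true, Finset.card_univ,
      Fintype.card_fin, Nat.sub_self, Nat.factorial_zero]
    split_ifs <;> simp
  | succ i ih =>
    by_cases hd : U.card < (disc root U δ).card
    · obtain ⟨v, hv', hv⟩ := Finset.exists_mem_notMem_of_card_lt_card hd
      have hc : (insert v U).card = U.card + 1 := Finset.card_insert_of_notMem hv
      set l := (Finset.univ.filter fun u => rowCount U δ u = 2).card with hl
      set m := (disc root U δ).card with hm
      have hrow : ∀ u : Fin k → Fin n,
          (((agree (insert v U) (Function.update δ v u)).filter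
            fun δ' => Accessible δ' ∧ ¬ HasM3 δ' ∧ mCount δ' = r).card : ℝ)
          = ((n - (disc root U δ ∪ Finset.univ.image u).card).factorial : ℝ)
              * pairW n k r i (U.card + 1) (disc root U δ ∪ Finset.univ.image u).card l
            + (if rowCount U δ u = 1 then ((n - m).factorial : ℝ) *
              (pairW n k r i (U.card + 1) m (l + 1) - pairW n k r i (U.card + 1) m l) else 0)
            - (if rowCount U δ u = 2 then ((n - m).factorial : ℝ) *
              pairW n k r i (U.card + 1) m l else 0) := by
        intro u
        have hmem : rowCount U δ u ≠ 0 → disc root U δ ∪ Finset.univ.image u = disc root U δ := by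
          intro h
          obtain ⟨x, hx⟩ := Finset.card_ne_zero.1 h
          rw [Finset.mem_filter] at hx
          refine Finset.union_eq_left.2 fun y hy => Finset.mem_insert_of_mem ?_
          exact Finset.mem_biUnion.2 ⟨x, hx.1, by rwa [hx.2]⟩
        have hle : rowCount U δ u < 2 →
            ∀ w, rowCount (insert v U) (Function.update δ v u) w ≤ 2 := by
          intro h w
          rw [rowCount_insert_update hv]
          split_ifs with hw
          · rw [hw]; omega
          · exact h2 w
        have hu := h2 u
        rcases (show rowCount U δ u = 0 ∨ rowCount U δ u = 1 ∨ rowCount U δ u = 2 by omega)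
          with h' | h' | h'
        · rw [ih (h.insert_update hv hv' u) (by omega) (hle (by omega)), disc_insert_update hv, hc]
          have : (Finset.univ.filter fun w =>
              rowCount (insert v U) (Function.update δ v u) w = 2).card = l := by
            rw [hl]
            congr 1
            refine Finset.filter_congr fun w _ => ?_
            rw [rowCount_insert_update hv]
            split_ifs with hw
            · rw [hw, h']; simp
            · rw [add_zero]
          rw [this, h']
          simp
        · rw [ih (h.insert_update hv hv' u) (by omega) (hle (by omega)), disc_insert_update hv, hc]
          have : (Finset.univ.filter fun w =>
              rowCount (insert v U) (Function.update δ v u) w = 2).card = l + 1 := by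
            have : (Finset.univ.filter fun w =>
                rowCount (insert v U) (Function.update δ v u) w = 2)
                = insert u (Finset.univ.filter fun w => rowCount U δ w = 2) := by
              ext w
              simp only [Finset.mem_filter, Finset.mem_univ, true_and, Finset.mem_insert,
                rowCount_insert_update hv]
              split_ifs with hw
              · simp [hw, h']
              · simp [hw]
            rw [this, Finset.card_insert_of_notMem (by simp [h'])]
          rw [this, h', hmem (by omega)]
          simp only [if_true, OfNat.one_ne_ofNat, if_false]
          ring
        · rw [h', hmem (by omega), Finset.filter_eq_empty_iff.2]
          · simp [← hm]
          · rintro δ' hδ' ⟨-, h3, -⟩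
            have h4 := (rowCount_le_of_mem_agree hδ' u).trans ((not_hasM3_iff δ').1 h3 u)
            rw [rowCount_insert_update hv, if_pos rfl] at h4
            omega
      have hcard := card_rowCount_eq h2
      rw [card_filter_agree_eq_sum hv, pairW, if_pos hd]
      push_cast
      simp only [hrow]
      rw [Finset.sum_sub_distrib, Finset.sum_add_distrib,
        sum_row_factorial k (f := fun x => pairW n k r i (U.card + 1) x l)
          (fun x hx => pairW_eq_zero hx), ← Finset.sum_filter, ← Finset.sum_filter,
        Finset.sum_const, Finset.sum_const, nsmul_eq_mul, nsmul_eq_mul, ← hl, ← hm]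
      have : ((Finset.univ.filter fun u => rowCount U δ u = 1).card : ℝ) = U.card - 2 * l := by
        rw [← hcard]; push_cast; ring
      rw [this]
      ring
    · rw [pairW, if_neg hd, mul_zero, Nat.cast_eq_zero, Finset.card_eq_zero,
        Finset.filter_eq_empty_iff]
      exact fun δ' hδ' h' => not_accessible_of_disc_eq h0 hδ'
        (Finset.eq_of_subset_of_card_le h.1 (by omega)).symm (by omega) h'.1

lemma card_filter_accSet {n : ℕ} (k r : ℕ) (hn : 0 < n) :
    (((accSet n k).filter fun δ => ¬ HasM3 δ ∧ mCount δ = r).card : ℝ)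
      = ((n - 1).factorial : ℝ) * pairW n k r n 0 1 0 := by
  have h := (explored_empty (k := k) ⟨0, hn⟩ fun _ _ => ⟨0, hn⟩).card_pairs r rfl n (by simp)
    (by simp [rowCount])
  rw [agree_empty, disc_empty, Finset.card_singleton, Finset.card_empty] at h
  simp only [rowCount, Finset.filter_empty, Finset.card_empty, OfNat.zero_ne_ofNat,
    Finset.filter_false] at h
  rw [accSet, Finset.filter_filter]
  exact h

/-- `unroll k g i j m` iterates `i` rows of the exploration, starting with `j` rows read and `m`
states, before applying the terminal weight `g`. -/
noncomputable def unroll (k : ℕ) (g : ℕ → ℝ) : ℕ → ℕ → ℕ → ℝ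
  | 0, _, m => g m
  | i + 1, j, m => if j < m then letterStep^[k] (unroll k g i (j + 1)) m else 0

section Skip

variable {n k : ℕ}

lemma cpl_eq_zero_of_add {p m l : ℕ} (hp : p + l ≤ k * n) (h : cpl n k p m = 0) :
    cpl n k (p + l) m = 0 := by
  by_contra h'
  exact (cpl_pos_of_add hp (lt_of_le_of_ne (cpl_nonneg _ _ _ _) (Ne.symm h'))).ne' h

lemma letterStep_cpl_mul {j q m : ℕ} {h : ℕ → ℝ} (hj : j < n) (hq : q ≤ k) (hm : j < m) :
    letterStep^[q] (fun x => cpl n k (k * (j + 1)) x * h x) m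
      = cpl n k (k * (j + 1) - q) m * chainE n k (k * (j + 1) - q) q h m := by
  induction q generalizing m with
  | zero => rfl
  | succ q ih =>
    have h1 : k * (j + 1) ≤ k * n := Nat.mul_le_mul_left k hj
    have h2 : k * (j + 1) ≤ k * m := Nat.mul_le_mul_left k hm
    have h3 : k ≤ k * (j + 1) := Nat.le_mul_of_pos_right k (Nat.succ_pos j)
    obtain ⟨p, hp⟩ : ∃ p, k * (j + 1) - (q + 1) = p := ⟨_, rfl⟩
    have hp1 : k * (j + 1) - q = p + 1 := by omega
    rw [Function.iterate_succ_apply', letterStep, ih (by omega) hm, ih (by omega) (by omega), hp,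
      hp1, chainE]
    have hrec := cpl_rec (n := n) (k := k) (p := p) (by omega) m
    rw [if_pos (by omega)] at hrec
    have n1 := cpl_nonneg n k (p + 1) m
    have n2 := cpl_nonneg n k (p + 1) (m + 1)
    rcases (cpl_nonneg n k p m).eq_or_lt with h0 | h0
    · have h4 : (m : ℝ) * cpl n k (p + 1) m = 0 := by
        have : 0 ≤ (m : ℝ) * cpl n k (p + 1) m := by positivity
        linarith
      have h5 : cpl n k (p + 1) (m + 1) = 0 := by linarith
      rw [← mul_assoc, h4, h5, ← h0]
      ring
    · rw [avg_eq_div (by omega) h0, mul_div_cancel₀ _ h0.ne']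
      ring

lemma unroll_eq {g : ℕ → ℝ} {i j : ℕ} (m : ℕ) (hij : j + i ≤ n)
    (hg : ∀ x, cpl n k (k * (j + i)) x = 0 → g x = 0) :
    unroll k g i j m = cpl n k (k * j) m
      * chainE n k (k * j) (k * i) (fun x => g x / cpl n k (k * (j + i)) x) m := by
  induction i generalizing j m with
  | zero =>
    by_cases h : cpl n k (k * j) m = 0
    · simp [unroll, h, hg m h]
    · simp [unroll, chainE, mul_div_cancel₀ _ h]
  | succ i ih =>
    have e : j + (i + 1) = j + 1 + i := by ring
    rw [unroll]
    split_ifs with hm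
    · rw [e] at hg ⊢
      have : unroll k g i (j + 1) = fun x => cpl n k (k * (j + 1)) x * chainE n k (k * (j + 1))
          (k * i) (fun x => g x / cpl n k (k * (j + 1 + i)) x) x := by
        funext x
        exact ih x (by omega) hg
      rw [this, letterStep_cpl_mul (by omega) le_rfl hm, Nat.mul_succ, Nat.add_sub_cancel,
        show k * (i + 1) = k + k * i by ring, chainE_chainE]
    · rw [cpl_eq_zero_of_le (Nat.mul_le_mul_left k (by omega)) (Nat.mul_le_mul_left k (not_lt.1 hm))
        (by omega), zero_mul]

lemma unroll_mono {g g' : ℕ → ℝ} (h : ∀ x, g x ≤ g' x) (i j m : ℕ) :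
    unroll k g i j m ≤ unroll k g' i j m := by
  induction i generalizing j m with
  | zero => exact h m
  | succ i ih =>
    simp only [unroll]
    split_ifs
    · exact letterStep_mono (fun x _ => ih _ _) _
    · exact le_rfl

lemma unroll_nonneg {g : ℕ → ℝ} (h : ∀ x, 0 ≤ g x) (i j m : ℕ) : 0 ≤ unroll k g i j m := by
  induction i generalizing j m with
  | zero => exact h m
  | succ i ih =>
    simp only [unroll]
    split_ifs
    · exact letterStep_nonneg (fun x => ih _ _) _ _
    · exact le_rfl

lemma skipW_eq_unroll {D : Finset ℕ} {i j a : ℕ} (h : ∀ x, j ≤ x → x < j + a → x ∉ D) :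
    skipW n k D (a + i) j = unroll k (skipW n k D i (j + a)) a j := by
  induction a generalizing j with
  | zero => funext m; simp [unroll]
  | succ a ih =>
    funext m
    rw [show a + 1 + i = (a + i) + 1 by ring, skipW, unroll, if_neg (h j le_rfl (by omega)),
      ih fun x h1 h2 => h x (by omega) (by omega), show j + 1 + a = j + (a + 1) by ring]

lemma card_filter_Ico {D : Finset ℕ} {j b : ℕ} (hj : j < b) :
    ((Finset.Ico j b).filter (· ∈ D)).card
      = ((Finset.Ico (j + 1) b).filter (· ∈ D)).card + if j ∈ D then 1 else 0 := by
  have hI : Finset.Ico j b = insert j (Finset.Ico (j + 1) b) := by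
    ext x; simp only [Finset.mem_Ico, Finset.mem_insert]; omega
  rw [hI, Finset.filter_insert]
  split_ifs
  · rw [Finset.card_insert_of_notMem (by simp)]
  · rfl

lemma card_filter_Ico_le {D : Finset ℕ} (j b : ℕ) :
    ((Finset.Ico j b).filter (· ∈ D)).card ≤ b - j := by
  simpa using Finset.card_filter_le (Finset.Ico j b) (· ∈ D)

lemma filter_Ico_eq {D : Finset ℕ} {j b : ℕ} (h : D ⊆ Finset.Ico j b) :
    (Finset.Ico j b).filter (· ∈ D) = D := by
  rw [Finset.filter_mem_eq_inter, Finset.inter_eq_right.2 h]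

lemma pow_mul_cpl_le {p q m : ℕ} (hp : p + q ≤ k * n) :
    (n : ℝ) ^ q * cpl n k (p + q) m ≤ cpl n k p m := by
  induction q with
  | zero => simp
  | succ q ih =>
    refine le_trans ?_ (ih (by omega))
    rw [pow_succ, mul_assoc]
    gcongr
    exact mul_cpl_succ_le (p := p + q) (by omega) m

lemma pow_mul_skipW_le {D : Finset ℕ} {i j m : ℕ} (hij : i + j = n) :
    (n : ℝ) ^ (k * ((Finset.Ico j n).filter (· ∈ D)).card) * skipW n k D i j m
      ≤ cpl n k (k * j) m := by
  induction i generalizing j m with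
  | zero =>
    obtain rfl : j = n := by omega
    simp [cpl_end, skipW]
  | succ i ih =>
    have hjn : k * j + k ≤ k * n := by
      rw [← Nat.mul_succ]; exact Nat.mul_le_mul_left k (by omega)
    rw [card_filter_Ico (show j < n by omega), skipW]
    by_cases hm : j < m
    · rw [if_pos hm]
      set c := ((Finset.Ico (j + 1) n).filter (· ∈ D)).card
      split_ifs
      · calc (n : ℝ) ^ (k * (c + 1)) * skipW n k D i (j + 1) m
            = n ^ k * (n ^ (k * c) * skipW n k D i (j + 1) m) := by ring
          _ ≤ n ^ k * cpl n k (k * (j + 1)) m := by gcongr; exact ih (by omega)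
          _ ≤ _ := by rw [Nat.mul_succ]; exact pow_mul_cpl_le hjn
      · rw [cpl_row (by omega), if_pos hm, add_zero]
        have := letterStep_sum {()} (fun _ => (n : ℝ) ^ (k * c)) (fun _ => skipW n k D i (j + 1))
          k m
        simp only [Finset.sum_singleton] at this
        rw [← this]
        exact letterStep_mono (fun x _ => ih (by omega)) _
    · rw [if_neg hm, mul_zero]
      exact cpl_nonneg _ _ _ _

lemma cpl_le_skipW {D : Finset ℕ} {i j m : ℕ} (hij : i + j = n) :
    cpl n k (k * (j + ((Finset.Ico j n).filter (· ∈ D)).card)) m ≤ skipW n k D i j m := by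
  induction i generalizing j m with
  | zero =>
    obtain rfl : j = n := by omega
    simp [cpl_end, skipW]
  | succ i ih =>
    have hle := card_filter_Ico_le (D := D) (j + 1) n
    have hc := card_filter_Ico (D := D) (show j < n by omega)
    set c := ((Finset.Ico (j + 1) n).filter (· ∈ D)).card
    rw [skipW]
    by_cases hm : j < m
    · rw [if_pos hm]
      split_ifs with hD
      · rw [hc, if_pos hD, show j + (c + 1) = j + 1 + c by ring]
        exact ih (by omega)
      · rw [hc, if_neg hD, add_zero, cpl_row (by omega)]
        split_ifs
        · refine letterStep_mono (fun x _ => ?_) _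
          rw [show j + c + 1 = j + 1 + c by ring]
          exact ih (by omega)
        · exact letterStep_nonneg (fun x => skipW_nonneg _ _ _ _ _ _) _ _
    · rw [if_neg hm, cpl_eq_zero_of_le (Nat.mul_le_mul_left k _) (Nat.mul_le_mul_left k (by omega))
        (by omega)]
      rw [hc]
      split_ifs <;> omega

lemma unroll_cpl_le {a e j m : ℕ} (hj : j + a ≤ e) (he : e < n) :
    unroll k (cpl n k (k * e)) a (j + 1) m ≤ unroll k (cpl n k (k * (e + 1))) (a + 1) j m := by
  induction a generalizing j m with
  | zero =>
    rw [unroll, unroll, cpl_row he]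
    have h0 : 0 ≤ letterStep^[k] (cpl n k (k * (e + 1))) m :=
      letterStep_nonneg (fun x => cpl_nonneg _ _ _ _) _ _
    split_ifs with h1 h2
    · exact le_rfl
    · omega
    · exact h0
    · exact le_rfl
  | succ a ih =>
    rw [unroll, unroll]
    split_ifs with h1 h2
    · exact letterStep_mono (fun x _ => ih (by omega)) _
    · omega
    · exact letterStep_nonneg (fun x => unroll_nonneg (fun x => cpl_nonneg _ _ _ _) _ _ _) _ _
    · exact le_rfl

lemma skipW_le_unroll {D : Finset ℕ} {a b i j m : ℕ} (hD : ∀ x, b ≤ x → x ∉ D) (hj : j + a = b)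
    (hi : b + i = n) (hb : b + ((Finset.Ico j b).filter (· ∈ D)).card ≤ n) :
    skipW n k D (a + i) j m
      ≤ unroll k (cpl n k (k * (b + ((Finset.Ico j b).filter (· ∈ D)).card))) a j m := by
  induction a generalizing j m with
  | zero =>
    obtain rfl : j = b := by omega
    have h := skipW_congr (n := n) (k := k) (i := i) (j := j) (D := D) (D' := ∅)
      fun x hx => by simp [hD x hx]
    simp [unroll, h, skipW_empty (show i + j = n by omega)]
  | succ a ih =>
    have hc := card_filter_Ico (D := D) (show j < b by omega)
    rw [hc] at hb ⊢
    set c := ((Finset.Ico (j + 1) b).filter (· ∈ D)).card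
    rw [show a + 1 + i = (a + i) + 1 by ring, skipW]
    by_cases hjD : j ∈ D
    · rw [if_pos hjD] at hb ⊢
      rw [if_pos hjD]
      split_ifs
      · refine (ih (by omega) (by omega)).trans ?_
        rw [← add_assoc]
        exact unroll_cpl_le (by omega) (by omega)
      · exact unroll_nonneg (fun x => cpl_nonneg _ _ _ _) _ _ _
    · rw [if_neg hjD] at hb ⊢
      rw [if_neg hjD, unroll]
      split_ifs
      · exact letterStep_mono (fun x _ => ih (by omega) (by omega)) _
      · exact le_rfl

lemma pow_mul_unroll_cpl {j s : ℕ} (m : ℕ) (hj : j + s ≤ n) :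
    (n : ℝ) ^ (k * s) * unroll k (cpl n k (k * (j + s))) j 0 m
      = cpl n k 0 m * chainE n k 0 (k * j) (runRatio n k (k * s) (k * j)) m := by
  have hjs : k * j + k * s ≤ k * n := by rw [← Nat.mul_add]; exact Nat.mul_le_mul_left k hj
  rw [unroll_eq (n := n) m (by omega), mul_left_comm, ← chainE_const_mul, mul_zero]
  · have : runRatio n k (k * s) (k * j)
        = fun x => (n : ℝ) ^ (k * s) * (cpl n k (k * j + k * s) x / cpl n k (k * j) x) :=
      funext fun x => mul_div_assoc _ _ _
    rw [this]
    simp only [zero_add, Nat.mul_add]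
  · intro x hx
    rw [zero_add] at hx
    rw [Nat.mul_add]
    exact cpl_eq_zero_of_add hjs hx

lemma chainE_le_pow_mul_skipW {D : Finset ℕ} {j : ℕ} (hD : D ⊆ Finset.Ico j n)
    (hj : j ≤ n) (h : 0 < cpl n k 0 1) :
    chainE n k 0 (k * j) (runRatio n k (k * D.card) (k * j)) 1
      ≤ (n : ℝ) ^ (k * D.card) * (skipW n k D n 0 1 / cpl n k 0 1) := by
  have hc : j + D.card ≤ n := by
    have := Finset.card_le_card hD
    rw [Nat.card_Ico] at this
    omega
  have h1 := skipW_eq_unroll (n := n) (k := k) (D := D) (i := n - j) (j := 0) (a := j)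
    fun x _ hx hxD => by
      have := Finset.mem_Ico.1 (hD hxD)
      omega
  rw [Nat.add_sub_cancel' hj, zero_add] at h1
  rw [← mul_div_assoc, le_div_iff₀ h, mul_comm, ← pow_mul_unroll_cpl 1 hc, h1]
  gcongr
  refine unroll_mono (fun x => ?_) _ _ _
  have := cpl_le_skipW (n := n) (k := k) (D := D) (i := n - j) (j := j) (m := x) (by omega)
  rwa [filter_Ico_eq hD] at this

lemma pow_mul_skipW_le_chainE {D : Finset ℕ} {b : ℕ} (hD : D ⊆ Finset.range b)
    (hb : b + D.card ≤ n) (h : 0 < cpl n k 0 1) :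
    (n : ℝ) ^ (k * D.card) * (skipW n k D n 0 1 / cpl n k 0 1)
      ≤ chainE n k 0 (k * b) (runRatio n k (k * D.card) (k * b)) 1 := by
  rw [Finset.range_eq_Ico] at hD
  have h1 := skipW_le_unroll (n := n) (k := k) (D := D) (a := b) (b := b) (i := n - b) (j := 0)
    (m := 1) (fun x hx hxD => by have := Finset.mem_Ico.1 (hD hxD); omega) (by omega) (by omega)
    (by rwa [filter_Ico_eq hD])
  rw [filter_Ico_eq hD, Nat.add_sub_cancel' (by omega)] at h1
  rw [← mul_div_assoc, div_le_iff₀ h, mul_comm (chainE _ _ _ _ _ _), ← pow_mul_unroll_cpl 1 hb]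
  gcongr

lemma pow_mul_skipW_div_le_one {D : Finset ℕ} (hD : D ⊆ Finset.range n) :
    (n : ℝ) ^ (k * D.card) * (skipW n k D n 0 1 / cpl n k 0 1) ≤ 1 := by
  have h := pow_mul_skipW_le (n := n) (k := k) (D := D) (i := n) (j := 0) (m := 1) (by omega)
  rw [filter_Ico_eq (by rwa [← Finset.range_eq_Ico])] at h
  rw [← mul_div_assoc]
  exact div_le_one_of_le₀ h (cpl_nonneg _ _ _ _)

lemma chainE_ne_succ_le {p : ℕ} (hn : 0 < n) (hp : p ≤ k * n) (h : 0 < cpl n k 0 1) :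
    chainE n k 0 p (fun x => if x ≠ p + 1 then 1 else 0) 1 ≤ (p : ℝ) ^ 2 / n := by
  have := chainE_le_add (n := n) (k := k) (p := 0) (t := p) (m := 1) (e := p / n)
    (F := fun q x => if x ≠ q + 1 then 1 else 0) (by omega) h fun q m _ hq hm => by
      rw [zero_add] at hq
      by_cases hmq : m = q + 1
      · subst hmq
        simp only [avg, ne_eq, not_true_eq_false, if_false, mul_zero, add_zero, zero_add]
        rw [if_pos (by omega), mul_one, stay_eq hn]
        calc _ ≤ ((q + 1 : ℕ) : ℝ) / n * 1 := by
              gcongr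
              exact runRatio_one_le (by omega)
          _ ≤ (p : ℝ) / n := by
              rw [mul_one]
              gcongr
              exact_mod_cast hq
      · have h1 : avg n k q (fun x => if x ≠ q + 1 + 1 then 1 else 0) m
            ≤ avg n k q (fun _ => 1) m :=
          avg_mono (by omega) hm fun x _ _ _ => by split_ifs <;> norm_num
        rw [avg_const] at h1
        rw [if_pos hmq]
        have : (0 : ℝ) ≤ p / n := by positivity
        linarith
  simp only [zero_add, ne_eq, not_true_eq_false, if_false] at this
  refine this.trans (le_of_eq ?_)
  ring

end Skip

lemma eventually_abs_skip_sub_le {k : ℕ} {ω : ℝ} (hωe : Real.exp (-(k * ω)) = 1 - ω)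
    (hω : 0 < ω) (hω1 : ω < 1) (hk : 2 ≤ k) {γ : ℝ} (hγ : 0 < γ) (hγ1 : γ < 1) (s : ℕ) {ε : ℝ}
    (hε : 0 < ε) :
    ∀ᶠ n : ℕ in atTop, ∀ b : ℕ, (b : ℝ) ≤ γ * n → slow n ≤ b → ∀ D : Finset ℕ, D.card = s →
      D ⊆ Finset.Ico (slow n) b →
      |(n : ℝ) ^ (k * s) * (skipW n k D n 0 1 / cpl n k 0 1) - ω ^ (k * s)| ≤ ε := by
  have hk0 : 0 < k := by omega
  obtain ⟨K, c, hK, hc, htail⟩ :=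
    exists_boundary_tail_of_lt_one hk0 hωe hω hω1 hγ hγ1 (k * s)
  have hv := tendsto_runRatio hωe hω hω1 hk (k * s)
  have herr : Tendsto (fun n : ℕ => |runRatio n k (k * s) (k * slow n) (k * slow n + 1)
      - ω ^ (k * s)| + ((k : ℝ) ^ 2 * ((slow n : ℝ) ^ 2 / n)
        + k * K * (n * Real.exp (-c * slow n)))) atTop (𝓝 0) := by
    have h1 := (hv.sub_const (ω ^ (k * s))).abs
    have h2 := (tendsto_slow_sq_div.const_mul ((k : ℝ) ^ 2)).add
      ((tendsto_mul_exp_slow hc).const_mul (k * K))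
    simpa using h1.add h2
  filter_upwards [htail, herr.eventually (ge_mem_nhds hε), eventually_gt_atTop 0,
    eventually_slow_le hk0 (k * s) one_pos, eventually_cpl_slow_pos hk 0,
    tendsto_natCast_atTop_atTop.eventually_ge_atTop (s / (1 - γ) : ℝ)]
    with n htail herr hn hslow hpos hns b hb hsb D hDs hD
  rw [div_le_iff₀ (by linarith)] at hns
  rw [add_zero] at hpos
  have hslow : k * slow n + k * s ≤ k * n := by
    rw [one_mul] at hslow
    exact_mod_cast hslow
  have hbs : b + s ≤ n := by
    have : (b : ℝ) + s ≤ n := by linarith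
    exact_mod_cast this
  have hks : k * slow n ≤ k * b := Nat.mul_le_mul_left k hsb
  have hkb : k * b + k * s ≤ k * n := by rw [← Nat.mul_add]; exact Nat.mul_le_mul_left k hbs
  have h01 : 0 < cpl n k 0 1 := cpl_pos (by omega) hn
  have hp := chainE_ne_succ_le (n := n) (k := k) (p := k * slow n) hn (by omega) h01
  have hpe : ((k * slow n : ℕ) : ℝ) ^ 2 / n = (k : ℝ) ^ 2 * ((slow n : ℝ) ^ 2 / n) := by
    push_cast; ring
  rw [hpe] at hp
  have hlow := chainE_le_pow_mul_skipW (n := n) (k := k)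
    (hD.trans (Finset.Ico_subset_Ico_right (by omega))) (by omega) h01
  have hup := pow_mul_skipW_le_chainE (n := n) (k := k) (D := D) (b := b)
    (fun x hx => Finset.mem_range.2 (Finset.mem_Ico.1 (hD hx)).2) (by omega) h01
  rw [hDs] at hlow hup
  set P := k * slow n with hP
  set v := runRatio n k (k * s) P (P + 1) with hvdef
  set π := chainE n k 0 P (fun x => if x ≠ P + 1 then 1 else 0) 1 with hπ
  have hv1 : v ≤ 1 := runRatio_le_one (by omega) hpos
  have hv0 : 0 ≤ v := runRatio_nonneg _ _ _
  have hlow' : v - π ≤ chainE n k 0 P (runRatio n k (k * s) P) 1 := by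
    have h1 := chainE_mono (n := n) (k := k) (p := 0) (t := P) (m := 1) (by omega) h01
      (f := fun x => v - if x ≠ P + 1 then 1 else 0) (g := runRatio n k (k * s) P)
      fun x _ => by
        have := runRatio_nonneg (n := n) (k := k) (k * s) P x
        by_cases hx : x = P + 1
        · simp [hx, hvdef]
        · rw [if_pos hx]; linarith
    rwa [chainE_sub, chainE_const] at h1
  set t := k * b - P with ht
  have htb : k * b = P + t := by omega
  set e := K * Real.exp (-c * slow n) with he
  have hte : (t : ℝ) * e ≤ k * K * (n * Real.exp (-c * slow n)) := by
    have : (t : ℝ) ≤ k * n := by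
      have : t ≤ k * n := by omega
      exact_mod_cast this
    calc (t : ℝ) * e ≤ (k * n) * e := by gcongr
      _ = _ := by rw [he]; ring
  have hup' : chainE n k 0 (k * b) (runRatio n k (k * s) (k * b)) 1 ≤ π + (v + t * e) := by
    rw [htb, chainE_chainE, zero_add]
    have h1 := chainE_mono (n := n) (k := k) (p := 0) (t := P) (m := 1) (by omega) h01
      (f := chainE n k P t (runRatio n k (k * s) (P + t)))
      (g := fun x => (if x ≠ P + 1 then 1 else 0) + (v + t * e)) fun x hx => by
        rw [zero_add] at hx
        by_cases hxP : x = P + 1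
        · subst hxP
          rw [if_neg (by simp), zero_add]
          refine chainE_runRatio_le (by omega) hx fun q hq => ?_
          refine (htail P (P + 1) q hx (by omega) (by omega) (by omega) ?_).trans ?_
          · have h2 : ((P + q : ℕ) : ℝ) ≤ ((k * b : ℕ) : ℝ) := by
              exact_mod_cast (show P + q ≤ k * b by omega)
            push_cast at h2 ⊢
            have h3 : (k : ℝ) * b ≤ k * (γ * n) := by gcongr
            linarith
          · rw [he]
            have h2 : (slow n : ℝ) ≤ P := by
              exact_mod_cast (Nat.le_mul_of_pos_left (slow n) hk0)
            have h3 : c * (slow n : ℝ) ≤ c * P := by gcongr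
            gcongr ?_ * Real.exp ?_
            linarith
        · rw [if_pos hxP]
          have h2 := chainE_mono (n := n) (k := k) (p := P) (t := t) (m := x) (by omega) hx
            (f := runRatio n k (k * s) (P + t)) (g := fun _ => 1) fun y hy =>
              runRatio_le_one (by omega) hy
          rw [chainE_const] at h2
          have : 0 ≤ v + t * e := by positivity
          linarith
    rwa [chainE_add, chainE_const] at h1
  have habs := abs_le.1 (le_refl |v - ω ^ (k * s)|)
  rw [abs_le]
  have hte0 : 0 ≤ (k : ℝ) * K * (n * Real.exp (-c * slow n)) := by positivity
  constructor <;> linarith [habs.1, habs.2]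

/-- Leading coefficient of `coef` when `c` rows are skipped. -/
noncomputable def mainCoef (r c l : ℕ) : ℝ :=
  if l ≤ r then (-1) ^ (c + (r - l)) * (c.choose (r - l) : ℝ) else 0

lemma mainCoef_succ (r c l : ℕ) :
    mainCoef r (c + 1) l = -mainCoef r c l + mainCoef r c (l + 1) := by
  rcases lt_trichotomy l r with h | rfl | h
  · obtain ⟨d, hd⟩ : ∃ d, r - l = d + 1 := ⟨r - l - 1, by omega⟩
    have hd' : r - (l + 1) = d := by omega
    rw [mainCoef, mainCoef, mainCoef, if_pos h.le, if_pos h.le, if_pos (by omega), hd, hd',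
      Nat.choose_succ_succ]
    push_cast
    ring
  · simp [mainCoef, pow_succ]
  · simp [mainCoef, h.not_ge, show ¬ l + 1 ≤ r by omega]

lemma abs_mainCoef_le (r c l : ℕ) : |mainCoef r c l| ≤ 2 ^ c := by
  rw [mainCoef]
  split_ifs
  · rw [abs_mul, abs_pow, abs_neg, abs_one, one_pow, one_mul, Nat.abs_cast]
    exact_mod_cast Nat.choose_le_two_pow _ _
  · simp

lemma coef_eq_zero_of_lt {r i j l : ℕ} (D : Finset ℕ) (h : r < l) : coef r D i j l = 0 := by
  induction i generalizing j l with
  | zero => simp [coef, h.ne']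
  | succ i ih => simp [coef, ih h, ih (h.trans (Nat.lt_succ_self l))]

lemma coef_eq_zero_of_card_lt {r n i j l : ℕ} {D : Finset ℕ} (hij : j + i = n)
    (h : ((Finset.Ico j n).filter (· ∈ D)).card + l < r) : coef r D i j l = 0 := by
  induction i generalizing j l with
  | zero =>
    have : l < r := by omega
    simp [coef, this.ne]
  | succ i ih =>
    rw [card_filter_Ico (by omega)] at h
    rw [coef]
    split_ifs at h ⊢
    · rw [ih (by omega) (by omega), ih (by omega) (by omega)]
      ring
    · exact ih (by omega) (by omega)

lemma abs_coef_le {r n i j : ℕ} {D : Finset ℕ} (l : ℕ) (hij : j + i = n) :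
    |coef r D i j l| ≤ ((2 + 4 * r) * n : ℝ) ^ ((Finset.Ico j n).filter (· ∈ D)).card := by
  induction i generalizing j l with
  | zero =>
    obtain rfl : j = n := by omega
    rw [coef]
    split_ifs <;> simp
  | succ i ih =>
    by_cases hl : r < l
    · rw [coef_eq_zero_of_lt D hl, abs_zero]
      positivity
    rw [card_filter_Ico (show j < n by omega), coef]
    split_ifs
    · have h1 := ih (j := j + 1) l (by omega)
      have h2 := ih (j := j + 1) (l + 1) (by omega)
      set B := ((2 + 4 * r) * n : ℝ) ^ ((Finset.Ico (j + 1) n).filter (· ∈ D)).card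
      set x := coef r D i (j + 1) l
      set y := coef r D i (j + 1) (l + 1)
      have hjn : (j : ℝ) ≤ n := by exact_mod_cast (show j ≤ n by omega)
      have hn1 : (1 : ℝ) ≤ n := by exact_mod_cast (show 1 ≤ n by omega)
      have hlr : (l : ℝ) ≤ r := by exact_mod_cast (not_lt.1 hl)
      have hj0 : (0 : ℝ) ≤ j := Nat.cast_nonneg j
      have hl0 : (0 : ℝ) ≤ l := Nat.cast_nonneg l
      have h3 : |(j : ℝ) - l| ≤ n + r := abs_le.2 ⟨by linarith, by linarith⟩
      have h4 : |(j : ℝ) - 2 * l| ≤ n + 2 * r := abs_le.2 ⟨by linarith, by linarith⟩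
      have hB : 0 ≤ B := by positivity
      calc |-((j : ℝ) - l) * x + (j - 2 * l) * y|
          ≤ |(j : ℝ) - l| * |x| + |(j : ℝ) - 2 * l| * |y| := by
            refine (abs_add_le _ _).trans (le_of_eq ?_)
            rw [abs_mul, abs_mul, abs_neg]
        _ ≤ (n + r) * B + (n + 2 * r) * B := by gcongr
        _ = (2 * n + 3 * r) * B := by ring
        _ ≤ ((2 + 4 * r) * n) * B := by
            gcongr
            nlinarith [Nat.cast_nonneg (α := ℝ) r]
        _ = _ := by rw [pow_succ]; ring
    · exact ih l (by omega)

lemma mul_abs_coef_sub_le {r n i j : ℕ} {D : Finset ℕ} (l : ℕ) (hij : j + i = n) :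
    n * |coef r D i j l - mainCoef r ((Finset.Ico j n).filter (· ∈ D)).card l
        * ∏ x ∈ (Finset.Ico j n).filter (· ∈ D), (x : ℝ)|
      ≤ ((Finset.Ico j n).filter (· ∈ D)).card
        * ((2 + 4 * r) * n : ℝ) ^ ((Finset.Ico j n).filter (· ∈ D)).card := by
  induction i generalizing j l with
  | zero =>
    obtain rfl : j = n := by omega
    have : coef r D 0 j l - mainCoef r 0 l = 0 := by
      rw [coef, mainCoef]
      rcases lt_trichotomy l r with h | rfl | h
      · obtain ⟨d, hd⟩ : ∃ d, r - l = d + 1 := ⟨r - l - 1, by omega⟩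
        simp [h.ne, hd]
      · simp
      · simp [h.ne', h.not_ge]
    simp [this]
  | succ i ih =>
    by_cases hl : r < l
    · rw [coef_eq_zero_of_lt D hl, mainCoef, if_neg (by omega)]
      simp only [zero_mul, sub_zero, abs_zero, mul_zero]
      positivity
    have hI : Finset.Ico j n = insert j (Finset.Ico (j + 1) n) := by
      ext x; simp only [Finset.mem_Ico, Finset.mem_insert]; omega
    rw [coef, hI, Finset.filter_insert]
    have h1 := ih (j := j + 1) l (by omega)
    have h2 := ih (j := j + 1) (l + 1) (by omega)
    have h3 := abs_coef_le (r := r) (D := D) (i := i) (j := j + 1) l (by omega : _ = n)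
    have h4 := abs_coef_le (r := r) (D := D) (i := i) (j := j + 1) (l + 1) (by omega : _ = n)
    split_ifs
    · rw [Finset.card_insert_of_notMem (by simp), Finset.prod_insert (by simp), mainCoef_succ]
      set c := ((Finset.Ico (j + 1) n).filter (· ∈ D)).card
      set B := ((2 + 4 * r) * n : ℝ) ^ c
      set x := coef r D i (j + 1) l
      set y := coef r D i (j + 1) (l + 1)
      set Q := ∏ x ∈ (Finset.Ico (j + 1) n).filter (· ∈ D), (x : ℝ)
      have hjn : (j : ℝ) ≤ n := by exact_mod_cast (show j ≤ n by omega)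
      have hlr : (l : ℝ) ≤ r := by exact_mod_cast (not_lt.1 hl)
      have hB : 0 ≤ B := by positivity
      have hc0 : (0 : ℝ) ≤ c := Nat.cast_nonneg c
      have hr0 : (0 : ℝ) ≤ r := Nat.cast_nonneg r
      have hn0 : (0 : ℝ) ≤ n := Nat.cast_nonneg n
      have e : -((j : ℝ) - l) * x + (j - 2 * l) * y
          - (-mainCoef r c l + mainCoef r c (l + 1)) * (j * Q)
          = l * x + -(2 * l * y) + (-(j * (x - mainCoef r c l * Q))
            + j * (y - mainCoef r c (l + 1) * Q)) := by ring
      rw [e]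
      calc n * |l * x + -(2 * l * y) + (-(j * (x - mainCoef r c l * Q))
            + j * (y - mainCoef r c (l + 1) * Q))|
          ≤ n * (l * |x| + 2 * l * |y| + (j * |x - mainCoef r c l * Q|
            + j * |y - mainCoef r c (l + 1) * Q|)) := by
            gcongr
            refine (abs_add_le _ _).trans (add_le_add ((abs_add_le _ _).trans (le_of_eq ?_))
              ((abs_add_le _ _).trans (le_of_eq ?_)))
            · rw [abs_neg, abs_mul, abs_mul, abs_mul, Nat.abs_cast, abs_two]
            · rw [abs_neg, abs_mul, abs_mul, Nat.abs_cast]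
        _ = n * (l * |x| + 2 * l * |y|) + (j * (n * |x - mainCoef r c l * Q|)
            + j * (n * |y - mainCoef r c (l + 1) * Q|)) := by ring
        _ ≤ n * (r * B + 2 * r * B) + (n * (c * B) + n * (c * B)) := by gcongr
        _ = (3 * r + 2 * c) * (n * B) := by ring
        _ ≤ ((c + 1) * (2 + 4 * r)) * (n * B) := by
            gcongr
            nlinarith [mul_nonneg hc0 hr0]
        _ = _ := by push_cast; rw [pow_succ]; ring
    · exact ih l (by omega)

/-- Elementary symmetric sums of `0, …, n - 1`. -/
noncomputable def symSum (n s : ℕ) : ℝ :=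
  ∑ D ∈ Finset.powersetCard s (Finset.range n), ∏ x ∈ D, (x : ℝ)

lemma symSum_zero (n : ℕ) : symSum n 0 = 1 := by
  simp [symSum]

lemma symSum_zero_left (s : ℕ) : symSum 0 (s + 1) = 0 := by
  rw [symSum, Finset.powersetCard_eq_empty.2 (by simp), Finset.sum_empty]

lemma symSum_succ (n s : ℕ) : symSum (n + 1) (s + 1) = symSum n (s + 1) + n * symSum n s := by
  rw [symSum, symSum, symSum, Finset.range_add_one, Finset.powersetCard_succ_insert (by simp),
    Finset.sum_union, Finset.sum_image, Finset.mul_sum]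
  · congr 1
    refine Finset.sum_congr rfl fun D hD => Finset.prod_insert fun h => ?_
    have := (Finset.mem_powersetCard.1 hD).1 h
    simp at this
  · intro D hD D' hD' h
    have hn : ∀ E ∈ Finset.powersetCard s (Finset.range n), n ∉ E := fun E hE h => by
      have := (Finset.mem_powersetCard.1 hE).1 h
      simp at this
    have := congrArg (Finset.erase · n) h
    simpa [Finset.erase_insert (hn D hD), Finset.erase_insert (hn D' hD')] using this
  · refine Finset.disjoint_left.2 fun D hD hD' => ?_
    obtain ⟨E, -, rfl⟩ := Finset.mem_image.1 hD'
    have := (Finset.mem_powersetCard.1 hD).1 (Finset.mem_insert_self n E)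
    simp at this

lemma pow_succ_add_le {a : ℝ} (ha : 0 ≤ a) (m : ℕ) :
    a ^ (m + 1) + (m + 1) * a ^ m ≤ (a + 1) ^ (m + 1) := by
  induction m with
  | zero => simp
  | succ m ih =>
    have h : 0 ≤ ((m : ℝ) + 1) * a ^ m := by positivity
    calc a ^ (m + 1 + 1) + ((m + 1 : ℕ) + 1) * a ^ (m + 1)
        ≤ (a ^ (m + 1) + (m + 1) * a ^ m) * (a + 1) := by push_cast; ring_nf; ring_nf at h; linarith
      _ ≤ (a + 1) ^ (m + 1) * (a + 1) := by gcongr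
      _ = _ := by ring

lemma pow_succ_le_add {a : ℝ} (ha : 0 ≤ a) (m : ℕ) :
    (a + 1) ^ (m + 1) ≤ a ^ (m + 1) + (m + 1) * (a + 1) ^ m := by
  induction m with
  | zero => simp
  | succ m ih =>
    have h : a ^ (m + 1) ≤ (a + 1) ^ (m + 1) := by gcongr; linarith
    calc (a + 1) ^ (m + 1 + 1) = (a + 1) ^ (m + 1) * (a + 1) := by ring
      _ ≤ (a ^ (m + 1) + (m + 1) * (a + 1) ^ m) * (a + 1) := by gcongr
      _ = a ^ (m + 1 + 1) + a ^ (m + 1) + (m + 1) * (a + 1) ^ (m + 1) := by ring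
      _ ≤ a ^ (m + 1 + 1) + ((m + 1 : ℕ) + 1) * (a + 1) ^ (m + 1) := by push_cast; linarith

lemma symSum_le (n s : ℕ) : symSum n s ≤ (n : ℝ) ^ (2 * s) / (2 ^ s * s.factorial) := by
  induction s generalizing n with
  | zero => simp [symSum_zero]
  | succ s ihs =>
    induction n with
    | zero => rw [symSum_zero_left]; positivity
    | succ n ih =>
      have hp := pow_succ_add_le (Nat.cast_nonneg (α := ℝ) n) (2 * s + 1)
      rw [symSum_succ]
      calc _ ≤ (n : ℝ) ^ (2 * (s + 1)) / (2 ^ (s + 1) * (s + 1).factorial)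
            + n * ((n : ℝ) ^ (2 * s) / (2 ^ s * s.factorial)) := by gcongr; exact ihs n
        _ = ((n : ℝ) ^ (2 * s + 1 + 1) + ((2 * s + 1 : ℕ) + 1) * (n : ℝ) ^ (2 * s + 1))
            / (2 ^ (s + 1) * (s + 1).factorial) := by
            rw [Nat.factorial_succ]
            push_cast
            field_simp
            ring
        _ ≤ ((n : ℝ) + 1) ^ (2 * s + 1 + 1) / (2 ^ (s + 1) * (s + 1).factorial) := by gcongr
        _ = _ := by push_cast; ring

lemma le_symSum (n s : ℕ) :
    ((n - s : ℕ) : ℝ) ^ (2 * s) / (2 ^ s * s.factorial) ≤ symSum n s := by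
  induction s generalizing n with
  | zero => simp [symSum_zero]
  | succ s ihs =>
    induction n with
    | zero => rw [symSum_zero_left]; simp
    | succ n ih =>
      rw [symSum_succ]
      rcases Nat.lt_or_ge s n with h | h
      · obtain ⟨a, rfl⟩ : ∃ a, n = a + (s + 1) := ⟨n - (s + 1), by omega⟩
        have hs := ihs (a + (s + 1))
        rw [show a + (s + 1) - s = a + 1 by omega] at hs
        rw [show a + (s + 1) - (s + 1) = a by omega] at ih
        rw [show a + (s + 1) + 1 - (s + 1) = a + 1 by omega]
        have hp := pow_succ_le_add (Nat.cast_nonneg (α := ℝ) a) (2 * s + 1)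
        refine le_trans ?_ (add_le_add ih (mul_le_mul_of_nonneg_left hs (Nat.cast_nonneg _)))
        calc ((a + 1 : ℕ) : ℝ) ^ (2 * (s + 1)) / (2 ^ (s + 1) * (s + 1).factorial)
            = ((a : ℝ) + 1) ^ (2 * s + 1 + 1) / (2 ^ (s + 1) * (s + 1).factorial) := by
              push_cast; ring
          _ ≤ ((a : ℝ) ^ (2 * s + 1 + 1) + ((2 * s + 1 : ℕ) + 1) * ((a : ℝ) + 1) ^ (2 * s + 1))
              / (2 ^ (s + 1) * (s + 1).factorial) := by gcongr
          _ = (a : ℝ) ^ (2 * (s + 1)) / (2 ^ (s + 1) * (s + 1).factorial)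
              + (a + 1) * ((a + 1 : ℕ) ^ (2 * s) / (2 ^ s * s.factorial)) := by
              rw [Nat.factorial_succ]
              push_cast
              field_simp
              ring
          _ ≤ _ := by
              gcongr
              exact_mod_cast (show a + 1 ≤ a + (s + 1) by omega)
      · have h0 : 0 ≤ symSum n s := le_trans (by positivity) (ihs n)
        have h1 : 0 ≤ symSum n (s + 1) := le_trans (by positivity) ih
        rcases Nat.eq_or_lt_of_le h with h | h
        · rw [show n + 1 - (s + 1) = 0 by omega]
          simp only [Nat.cast_zero]
          rw [zero_pow (by omega), zero_div]
          positivity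
        · rw [show n + 1 - (s + 1) = 0 by omega]
          simp only [Nat.cast_zero]
          rw [zero_pow (by omega), zero_div]
          positivity

lemma tendsto_symSum_div (s : ℕ) :
    Tendsto (fun n : ℕ => symSum n s / (n : ℝ) ^ (2 * s)) atTop
      (𝓝 (1 / (2 ^ s * s.factorial))) := by
  have hlow : Tendsto (fun n : ℕ => (1 - s / (n : ℝ)) ^ (2 * s) / (2 ^ s * s.factorial)) atTop
      (𝓝 ((1 - 0) ^ (2 * s) / (2 ^ s * s.factorial))) :=
    ((tendsto_const_nhds.sub (tendsto_const_div_atTop_nhds_zero_nat (s : ℝ))).pow _).div_const _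
  rw [sub_zero, one_pow] at hlow
  refine tendsto_of_tendsto_of_tendsto_of_le_of_le' hlow tendsto_const_nhds ?_ ?_
  · filter_upwards [eventually_ge_atTop s, eventually_gt_atTop 0] with n hn h0
    have h0' : (0 : ℝ) < n := by exact_mod_cast h0
    rw [le_div_iff₀ (by positivity)]
    refine le_trans (le_of_eq ?_) (le_symSum n s)
    rw [Nat.cast_sub hn, show (n : ℝ) - s = (1 - s / n) * n by field_simp, mul_pow]
    ring
  · filter_upwards [eventually_gt_atTop 0] with n h0
    have h0' : (0 : ℝ) < n := by exact_mod_cast h0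
    rw [div_le_iff₀ (by positivity)]
    refine (symSum_le n s).trans (le_of_eq ?_)
    ring

lemma card_powersetCard_range_le (n s : ℕ) :
    ((Finset.powersetCard s (Finset.range n)).card : ℝ) ≤ (n : ℝ) ^ s / s.factorial := by
  rw [Finset.card_powersetCard, Finset.card_range]
  exact Nat.choose_le_pow_div s n

lemma card_not_subset_Ico_le {n a b : ℕ} (s : ℕ) (hb : b ≤ n) :
    (n : ℝ) * ((Finset.powersetCard s (Finset.range n)).filter
      fun D => ¬ D ⊆ Finset.Ico a b).card ≤ (n - b + a) * (n : ℝ) ^ s := by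
  have hba : (0 : ℝ) ≤ n - b + a := by
    have : (b : ℝ) ≤ n := by exact_mod_cast hb
    have : (0 : ℝ) ≤ a := Nat.cast_nonneg a
    linarith
  cases s with
  | zero =>
    simp only [Finset.powersetCard_zero, Finset.filter_singleton, Finset.empty_subset,
      not_true_eq_false, if_false, Finset.card_empty, Nat.cast_zero, mul_zero, pow_zero, mul_one]
    exact hba
  | succ s =>
    have hsub : (Finset.powersetCard (s + 1) (Finset.range n)).filter
          (fun D => ¬ D ⊆ Finset.Ico a b)
        ⊆ (Finset.range a ∪ Finset.Ico b n).biUnion fun x =>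
          (Finset.powersetCard s (Finset.range n)).image (insert x) := by
      intro D hD
      obtain ⟨hD, hno⟩ := Finset.mem_filter.1 hD
      obtain ⟨hDn, hDs⟩ := Finset.mem_powersetCard.1 hD
      obtain ⟨x, hx, hxI⟩ := Finset.not_subset.1 hno
      have hxn := Finset.mem_range.1 (hDn hx)
      refine Finset.mem_biUnion.2 ⟨x, ?_, Finset.mem_image.2 ⟨D.erase x, ?_,
        Finset.insert_erase hx⟩⟩
      · simp only [Finset.mem_union, Finset.mem_range, Finset.mem_Ico] at hxI ⊢
        omega
      · exact Finset.mem_powersetCard.2 ⟨(Finset.erase_subset _ _).trans hDn, by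
          rw [Finset.card_erase_of_mem hx, hDs, Nat.add_sub_cancel]⟩
    have h1 := (Finset.card_le_card hsub).trans (Finset.card_biUnion_le_card_mul _ _ _
      fun x _ => Finset.card_image_le)
    have h2 : (Finset.range a ∪ Finset.Ico b n).card ≤ a + (n - b) :=
      (Finset.card_union_le _ _).trans (by simp)
    rw [Finset.card_powersetCard, Finset.card_range] at h1
    have h3 := h1.trans (Nat.mul_le_mul h2 (Nat.choose_le_pow n s))
    have h4 : ((((Finset.powersetCard (s + 1) (Finset.range n)).filter
        fun D => ¬ D ⊆ Finset.Ico a b).card : ℕ) : ℝ) ≤ (a + (n - b)) * (n : ℝ) ^ s := by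
      have := (Nat.cast_le (α := ℝ)).2 h3
      rw [Nat.cast_mul, Nat.cast_add, Nat.cast_sub hb, Nat.cast_pow] at this
      exact this
    calc _ ≤ (n : ℝ) * ((a + (n - b)) * (n : ℝ) ^ s) := by gcongr
      _ = _ := by ring

/-- Rescaled weight of the transition structures in which the rows in `D` are skipped. -/
noncomputable def skipRatio (n k : ℕ) (D : Finset ℕ) : ℝ :=
  (n : ℝ) ^ (k * D.card) * (skipW n k D n 0 1 / cpl n k 0 1)

lemma skipRatio_nonneg (n k : ℕ) (D : Finset ℕ) : 0 ≤ skipRatio n k D :=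
  mul_nonneg (by positivity) (div_nonneg (skipW_nonneg _ _ _ _ _ _) (cpl_nonneg _ _ _ _))

/-- Rescaled contribution to `pairW n k r n 0 1 0` of the sets of `s` skipped rows. -/
noncomputable def pairTerm (k r s n : ℕ) : ℝ :=
  (∑ D ∈ Finset.powersetCard s (Finset.range n), coef r D n 0 0 * skipRatio n k D)
    / (n : ℝ) ^ (2 * s)

lemma pairW_div_eq_sum {n k : ℕ} (hn : 0 < n) (hk : 2 ≤ k) (r : ℕ) :
    pairW n k r n 0 1 0 / cpl n k 0 1
      = ∑ s ∈ Finset.range (n + 1), pairTerm k r s n * (((n : ℝ) ^ (k - 2))⁻¹) ^ s := by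
  have hn' : (n : ℝ) ≠ 0 := by exact_mod_cast hn.ne'
  rw [pairW_eq_sum, zero_add, ← Finset.range_eq_Ico, Finset.sum_powerset, Finset.card_range,
    Finset.sum_div]
  refine Finset.sum_congr rfl fun s _ => ?_
  rw [pairTerm, Finset.sum_div, Finset.sum_div, Finset.sum_mul]
  refine Finset.sum_congr rfl fun D hD => ?_
  obtain ⟨m, rfl⟩ := Nat.exists_eq_add_of_le hk
  rw [skipRatio, (Finset.mem_powersetCard.1 hD).2, Nat.add_sub_cancel_left, inv_pow, ← pow_mul,
    add_mul, pow_add]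
  field_simp

section coefBounds

variable {n s : ℕ} {D : Finset ℕ} (hD : D ∈ Finset.powersetCard s (Finset.range n)) (r : ℕ)

include hD

lemma filter_range_eq : (Finset.Ico 0 n).filter (· ∈ D) = D :=
  filter_Ico_eq <| by
    rw [← Finset.range_eq_Ico]
    exact (Finset.mem_powersetCard.1 hD).1

lemma abs_coef_zero_le : |coef r D n 0 0| ≤ ((2 + 4 * r) * n : ℝ) ^ s := by
  have h := abs_coef_le (r := r) (D := D) 0 (zero_add n)
  rwa [filter_range_eq hD, (Finset.mem_powersetCard.1 hD).2] at h

lemma coef_zero_eq_zero {r : ℕ} (hs : s < r) : coef r D n 0 0 = 0 := by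
  refine coef_eq_zero_of_card_lt (zero_add n) ?_
  rwa [filter_range_eq hD, (Finset.mem_powersetCard.1 hD).2]

lemma abs_coef_zero_sub_le :
    n * |coef r D n 0 0 - mainCoef r s 0 * ∏ x ∈ D, (x : ℝ)|
      ≤ s * ((2 + 4 * r) * n : ℝ) ^ s := by
  have h := mul_abs_coef_sub_le (r := r) (D := D) 0 (zero_add n)
  rwa [filter_range_eq hD, (Finset.mem_powersetCard.1 hD).2] at h

lemma skipRatio_le_one (k : ℕ) : skipRatio n k D ≤ 1 :=
  pow_mul_skipW_div_le_one (Finset.mem_powersetCard.1 hD).1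

end coefBounds

lemma pairTerm_eq_zero {r s : ℕ} (hs : s < r) (k n : ℕ) : pairTerm k r s n = 0 := by
  rw [pairTerm, Finset.sum_eq_zero fun D hD => ?_, zero_div]
  rw [coef_zero_eq_zero hD hs, zero_mul]

lemma abs_pairTerm_le (k r s : ℕ) {n : ℕ} (hn : 0 < n) :
    |pairTerm k r s n| ≤ (2 + 4 * r : ℝ) ^ s / s.factorial := by
  have hn' : (0 : ℝ) < n := by exact_mod_cast hn
  rw [pairTerm, abs_div, abs_of_pos (pow_pos hn' _), div_le_iff₀ (pow_pos hn' _)]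
  calc |∑ D ∈ Finset.powersetCard s (Finset.range n), coef r D n 0 0 * skipRatio n k D|
      ≤ ∑ D ∈ Finset.powersetCard s (Finset.range n), ((2 + 4 * r) * n : ℝ) ^ s := by
        refine (Finset.abs_sum_le_sum_abs _ _).trans (Finset.sum_le_sum fun D hD => ?_)
        rw [abs_mul, abs_of_nonneg (skipRatio_nonneg _ _ _)]
        exact (mul_le_mul (abs_coef_zero_le hD r) (skipRatio_le_one hD k)
          (skipRatio_nonneg _ _ _) (by positivity)).trans_eq (mul_one _)
    _ = (Finset.powersetCard s (Finset.range n)).card * ((2 + 4 * r) * n : ℝ) ^ s := by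
        rw [Finset.sum_const, nsmul_eq_mul]
    _ ≤ ((n : ℝ) ^ s / s.factorial) * ((2 + 4 * r) * n : ℝ) ^ s :=
        mul_le_mul_of_nonneg_right (card_powersetCard_range_le n s) (by positivity)
    _ = _ := by rw [mul_pow]; ring

lemma abs_pairTerm_sub_le {k r s n a b : ℕ} {w ε : ℝ} (hn : 0 < n) (hb : b ≤ n) (hw : 0 ≤ w)
    (hw1 : w ≤ 1) (hε : 0 ≤ ε)
    (h : ∀ D ∈ Finset.powersetCard s (Finset.range n), D ⊆ Finset.Ico a b →
      |skipRatio n k D - w| ≤ ε) :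
    |pairTerm k r s n - mainCoef r s 0 * w * (symSum n s / (n : ℝ) ^ (2 * s))|
      ≤ (2 + 4 * r : ℝ) ^ s * (s * (1 / n) + (ε + (1 - b / n + a / n))) := by
  have hn' : (0 : ℝ) < n := by exact_mod_cast hn
  set S := Finset.powersetCard s (Finset.range n) with hS
  set L : ℝ := 2 + 4 * r with hL
  have hL0 : 0 ≤ L := by positivity
  have hcard : (S.card : ℝ) ≤ (n : ℝ) ^ s :=
    (card_powersetCard_range_le n s).trans
      (div_le_self (by positivity) (by exact_mod_cast Nat.one_le_iff_ne_zero.2 s.factorial_ne_zero))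
  have hX : ∑ D ∈ S, |skipRatio n k D - w|
      ≤ (n : ℝ) ^ s * (ε + (1 - b / n + a / n)) := by
    calc ∑ D ∈ S, |skipRatio n k D - w|
        ≤ ∑ D ∈ S, (ε + if ¬ D ⊆ Finset.Ico a b then 1 else 0) := by
          refine Finset.sum_le_sum fun D hD => ?_
          by_cases hDab : D ⊆ Finset.Ico a b
          · simpa [hDab] using h D hD hDab
          · have h0 := skipRatio_nonneg n k D
            have h1 := skipRatio_le_one hD k
            simp only [hDab, not_false_eq_true, if_true]
            rw [abs_le]
            constructor <;> linarith
      _ = S.card * ε + (S.filter fun D => ¬ D ⊆ Finset.Ico a b).card := by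
          rw [Finset.sum_add_distrib, Finset.sum_const, nsmul_eq_mul, Finset.sum_boole]
      _ ≤ (n : ℝ) ^ s * ε + (n - b + a) * (n : ℝ) ^ s / n :=
          add_le_add (mul_le_mul_of_nonneg_right hcard hε)
            ((le_div_iff₀' hn').2 (card_not_subset_Ico_le s hb))
      _ = _ := by field_simp
  have hC : ∑ D ∈ S, |coef r D n 0 0 - mainCoef r s 0 * ∏ x ∈ D, (x : ℝ)|
      ≤ (n : ℝ) ^ s * (s * (L * n) ^ s / n) := by
    calc _ ≤ ∑ D ∈ S, (s * (L * n) ^ s / n : ℝ) :=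
          Finset.sum_le_sum fun D hD => (le_div_iff₀' hn').2 (abs_coef_zero_sub_le hD r)
      _ = S.card * (s * (L * n) ^ s / n) := by rw [Finset.sum_const, nsmul_eq_mul]
      _ ≤ _ := mul_le_mul_of_nonneg_right hcard (by positivity)
  have heq : pairTerm k r s n - mainCoef r s 0 * w * (symSum n s / (n : ℝ) ^ (2 * s))
      = (∑ D ∈ S, (coef r D n 0 0 * (skipRatio n k D - w)
          + w * (coef r D n 0 0 - mainCoef r s 0 * ∏ x ∈ D, (x : ℝ)))) / (n : ℝ) ^ (2 * s) := by
    rw [pairTerm, symSum, mul_div_assoc', ← sub_div, Finset.mul_sum, ← Finset.sum_sub_distrib]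
    congr 1
    exact Finset.sum_congr rfl fun D _ => by ring
  rw [heq, abs_div, abs_of_pos (pow_pos hn' _), div_le_iff₀ (pow_pos hn' _)]
  calc _ ≤ ∑ D ∈ S, ((L * n) ^ s * |skipRatio n k D - w|
          + |coef r D n 0 0 - mainCoef r s 0 * ∏ x ∈ D, (x : ℝ)|) := by
        refine (Finset.abs_sum_le_sum_abs _ _).trans (Finset.sum_le_sum fun D hD => ?_)
        refine (abs_add_le _ _).trans (add_le_add ?_ ?_)
        · rw [abs_mul]
          exact mul_le_mul_of_nonneg_right (abs_coef_zero_le hD r) (abs_nonneg _)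
        · rw [abs_mul, abs_of_nonneg hw]
          exact mul_le_of_le_one_left (abs_nonneg _) hw1
    _ ≤ (L * n) ^ s * ((n : ℝ) ^ s * (ε + (1 - b / n + a / n)))
          + (n : ℝ) ^ s * (s * (L * n) ^ s / n) := by
        rw [Finset.sum_add_distrib, ← Finset.mul_sum]
        exact add_le_add (mul_le_mul_of_nonneg_left hX (by positivity)) hC
    _ = _ := by rw [mul_pow]; ring

lemma tendsto_pairTerm {k : ℕ} {ω : ℝ} (hωe : Real.exp (-(k * ω)) = 1 - ω) (hω : 0 < ω)
    (hω1 : ω < 1) (hk : 2 ≤ k) (r s : ℕ) :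
    Tendsto (pairTerm k r s) atTop
      (𝓝 (mainCoef r s 0 * ω ^ (k * s) * (1 / (2 ^ s * s.factorial)))) := by
  have hmain := (tendsto_symSum_div s).const_mul (mainCoef r s 0 * ω ^ (k * s))
  suffices hdiff : Tendsto (fun n => pairTerm k r s n
      - mainCoef r s 0 * ω ^ (k * s) * (symSum n s / (n : ℝ) ^ (2 * s))) atTop (𝓝 0) by
    simpa using hdiff.add hmain
  set L : ℝ := (2 + 4 * r) ^ s with hL
  have hL0 : 0 < L := by positivity
  rw [Metric.tendsto_nhds]
  intro δ hδ
  obtain ⟨ε, hε, hε1, hεδ⟩ : ∃ ε : ℝ, 0 < ε ∧ ε < 1 ∧ L * (2 * ε) < δ := by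
    refine ⟨min (1 / 2) (δ / (3 * L)), by positivity,
      (min_le_left _ _).trans_lt (by norm_num), ?_⟩
    calc L * (2 * min (1 / 2) (δ / (3 * L))) ≤ L * (2 * (δ / (3 * L))) := by
          gcongr; exact min_le_right _ _
      _ = 2 / 3 * δ := by field_simp
      _ < δ := by linarith
  have hfloor := tendsto_natFloor_mul_div (sub_nonneg.2 hε1.le)
  have hbound : Tendsto (fun n : ℕ => L * (s * (1 / (n : ℝ))
      + (ε + (1 - (⌊(1 - ε) * n⌋₊ : ℝ) / n + (slow n : ℝ) / n)))) atTop (𝓝 (L * (2 * ε))) := by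
    have h := ((tendsto_one_div_atTop_nhds_zero_nat (𝕜 := ℝ)).const_mul (s : ℝ)).add
      (((hfloor.const_sub 1).add tendsto_slow_div).const_add ε)
    convert h.const_mul L using 2
    ring
  have hslow : ∀ᶠ n : ℕ in atTop, slow n ≤ ⌊(1 - ε) * (n : ℝ)⌋₊ := by
    filter_upwards [tendsto_slow_div.eventually_lt hfloor (sub_pos.2 hε1),
      eventually_gt_atTop 0] with n h hn
    have hn' : (0 : ℝ) < n := by exact_mod_cast hn
    exact_mod_cast ((div_lt_div_iff_of_pos_right hn').1 h).le
  filter_upwards [hbound.eventually_lt_const hεδ, hslow, eventually_gt_atTop 0,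
    eventually_abs_skip_sub_le hωe hω hω1 hk (sub_pos.2 hε1) (sub_lt_self 1 hε) s hε]
    with n hlt hs hn hskip
  have hb : (⌊(1 - ε) * (n : ℝ)⌋₊ : ℝ) ≤ (1 - ε) * n :=
    Nat.floor_le (mul_nonneg (sub_nonneg.2 hε1.le) n.cast_nonneg)
  have hbn : ⌊(1 - ε) * (n : ℝ)⌋₊ ≤ n := by
    exact_mod_cast hb.trans (mul_le_of_le_one_left n.cast_nonneg (by linarith))
  rw [Real.dist_eq, sub_zero]
  refine (abs_pairTerm_sub_le hn hbn (by positivity) (pow_le_one₀ hω.le hω1.le) hε.le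
    fun D hD hDab => ?_).trans_lt hlt
  rw [skipRatio, (Finset.mem_powersetCard.1 hD).2]
  exact hskip _ hb hs D (Finset.mem_powersetCard.1 hD).2 hDab

lemma pairTerm_eq_zero_of_lt {n s : ℕ} (hs : n < s) (k r : ℕ) : pairTerm k r s n = 0 := by
  rw [pairTerm, Finset.powersetCard_eq_empty.2 (by rwa [Finset.card_range]), Finset.sum_empty,
    zero_div]

lemma hasSum_mainCoef (r : ℕ) (c y : ℝ) :
    HasSum (fun s : ℕ => mainCoef r s 0 * (c ^ s / s.factorial) * y ^ (s - r))
      (c ^ r / r.factorial * Real.exp (-(c * y))) := by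
  rw [← (add_left_injective r).hasSum_iff]
  · have h := (NormedSpace.expSeries_div_hasSum_exp (-(c * y))).mul_left (c ^ r / r.factorial)
    rw [← Real.exp_eq_exp_ℝ] at h
    refine h.congr_fun fun i => ?_
    have hch : (((i + r).choose r : ℕ) : ℝ) * r.factorial * i.factorial = (i + r).factorial := by
      have h := Nat.choose_mul_factorial_mul_factorial (Nat.le_add_left r i)
      rw [Nat.add_sub_cancel] at h
      exact_mod_cast h
    have hi : (i.factorial : ℝ) ≠ 0 := by exact_mod_cast i.factorial_ne_zero
    have hr : (r.factorial : ℝ) ≠ 0 := by exact_mod_cast r.factorial_ne_zero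
    have hir : (((i + r).choose r : ℕ) : ℝ) ≠ 0 := by
      exact_mod_cast (Nat.choose_pos (Nat.le_add_left r i)).ne'
    simp only [Function.comp_apply, mainCoef, Nat.zero_le, if_true, Nat.sub_zero,
      Nat.add_sub_cancel]
    rw [add_assoc, pow_add, Even.neg_one_pow ⟨r, rfl⟩, neg_pow (c * y), mul_pow, ← hch]
    field_simp
    ring
  · intro s hs
    have hsr : s < r := by
      by_contra h
      exact hs ⟨s - r, Nat.sub_add_cancel (not_lt.1 h)⟩
    simp [mainCoef, Nat.choose_eq_zero_of_lt hsr]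

lemma hasSum_pairTerm {n k : ℕ} (hn : 0 < n) (hk : 2 ≤ k) (r : ℕ) :
    HasSum (fun s : ℕ => pairTerm k r s n * (((n : ℝ) ^ (k - 2))⁻¹) ^ (s - r))
      (pairW n k r n 0 1 0 / cpl n k 0 1 / (((n : ℝ) ^ (k - 2))⁻¹) ^ r) := by
  have hn' : (0 : ℝ) < n := by exact_mod_cast hn
  have hy : (((n : ℝ) ^ (k - 2))⁻¹) ^ r ≠ 0 := by positivity
  rw [pairW_div_eq_sum hn hk, Finset.sum_div,
    Finset.sum_congr rfl (g := fun s => pairTerm k r s n * (((n : ℝ) ^ (k - 2))⁻¹) ^ (s - r))]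
  · refine hasSum_sum_of_ne_finset_zero fun s hs => ?_
    rw [pairTerm_eq_zero_of_lt (by simpa using hs), zero_mul]
  · intro s _
    rcases lt_or_ge s r with h | h
    · simp [pairTerm_eq_zero h]
    · rw [div_eq_iff hy, mul_assoc, ← pow_add, Nat.sub_add_cancel h]

lemma tendsto_pairW_sub {k : ℕ} {ω : ℝ} (hωe : Real.exp (-(k * ω)) = 1 - ω) (hω : 0 < ω)
    (hω1 : ω < 1) (hk : 2 ≤ k) (r : ℕ) :
    Tendsto (fun n : ℕ => pairW n k r n 0 1 0 / cpl n k 0 1 / (((n : ℝ) ^ (k - 2))⁻¹) ^ r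
      - (ω ^ k / 2) ^ r / r.factorial * Real.exp (-(ω ^ k / 2 * ((n : ℝ) ^ (k - 2))⁻¹)))
      atTop (𝓝 0) := by
  set c : ℝ := ω ^ k / 2 with hc
  have hc0 : 0 ≤ c := by positivity
  set β : ℕ → ℝ := fun s => mainCoef r s 0 * (c ^ s / s.factorial) with hβ
  have hlim : ∀ s, Tendsto (pairTerm k r s) atTop (𝓝 (β s)) := fun s => by
    convert tendsto_pairTerm hωe hω hω1 hk r s using 2
    simp only [hβ, hc]
    rw [div_pow, ← pow_mul]
    field_simp
  have hβle : ∀ s, |β s| ≤ (2 * c) ^ s / s.factorial := fun s => by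
    rw [hβ, abs_mul, abs_of_nonneg (by positivity : 0 ≤ c ^ s / (s.factorial : ℝ)), mul_pow,
      ← mul_div_assoc]
    gcongr
    exact abs_mainCoef_le r s 0
  have hy : ∀ n : ℕ, 0 < n → ∀ m : ℕ, |(((n : ℝ) ^ (k - 2))⁻¹) ^ m| ≤ 1 := fun n hn m => by
    rw [abs_of_nonneg (by positivity)]
    exact pow_le_one₀ (by positivity) (inv_le_one_of_one_le₀ (one_le_pow₀ (by exact_mod_cast hn)))
  have key : Tendsto (fun n : ℕ =>
      ∑' s, (pairTerm k r s n - β s) * (((n : ℝ) ^ (k - 2))⁻¹) ^ (s - r)) atTop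
      (𝓝 (∑' _ : ℕ, (0 : ℝ))) := by
    refine tendsto_tsum_of_dominated_convergence
      ((Real.summable_pow_div_factorial (2 + 4 * r)).add
        (Real.summable_pow_div_factorial (2 * c))) (fun s => ?_) ?_
    · refine squeeze_zero_norm' ?_ (by simpa using ((hlim s).sub_const (β s)).abs)
      filter_upwards [eventually_gt_atTop 0] with n hn
      rw [Real.norm_eq_abs, abs_mul]
      exact mul_le_of_le_one_right (abs_nonneg _) (hy n hn _)
    · filter_upwards [eventually_gt_atTop 0] with n hn s
      rw [Real.norm_eq_abs, abs_mul]
      exact (mul_le_of_le_one_right (abs_nonneg _) (hy n hn _)).trans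
        ((abs_sub _ _).trans (add_le_add (abs_pairTerm_le k r s hn) (hβle s)))
  rw [tsum_zero] at key
  refine key.congr' ?_
  filter_upwards [eventually_gt_atTop 0] with n hn
  rw [← ((hasSum_pairTerm hn hk r).sub (hasSum_mainCoef r c (((n : ℝ) ^ (k - 2))⁻¹))).tsum_eq]
  exact tsum_congr fun s => sub_mul _ _ _

end

/-- For `k ≥ 2` and `r ≥ 0`, the probability `P_n(r)` that a
uniformly random accessible transition structure has no three-state M-motif and
exactly `r` M-motifs satisfies `P_n(r) / (e^{-ρ_n} ρ_n^r / r!) → 1`, with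
`ρ_n = c_k n^{2-k}`. -/
theorem statement2 (k : ℕ) (hk : 2 ≤ k) (r : ℕ)
    (ω : ℝ) (hω : ω ∈ Set.Ioo (0 : ℝ) 1)
    (hωeq : -(k : ℝ) * ω = Real.log (1 - ω))
    (c : ℝ) (hc : c = ω ^ k / 2)
    (ρ : ℕ → ℝ) (hρ : ∀ n : ℕ, ρ n = c * (n : ℝ) ^ ((2 : ℤ) - (k : ℤ))) :
    Filter.Tendsto
      (fun n : ℕ =>
        ((((accSet n k).filter fun δ => ¬ HasM3 δ ∧ mCount δ = r).card : ℝ) /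
            ((accSet n k).card : ℝ)) /
          (Real.exp (-ρ n) * (ρ n) ^ r / (r.factorial : ℝ)))
      Filter.atTop (nhds 1) := by
  obtain ⟨hω0, hω1⟩ := hω
  have hωe : Real.exp (-(k * ω)) = 1 - ω := by
    rw [← neg_mul, hωeq, Real.exp_log (sub_pos.2 hω1)]
  have hc0 : 0 < c := by rw [hc]; positivity
  have h := tendsto_pairW_sub hωe hω0 hω1 hk r
  rw [← hc] at h
  set K : ℝ := c ^ r / r.factorial with hK
  have hK0 : 0 < K := by positivity
  have hratio : Filter.Tendsto (fun n : ℕ =>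
      1 + (pairW n k r n 0 1 0 / cpl n k 0 1 / (((n : ℝ) ^ (k - 2))⁻¹) ^ r
        - K * Real.exp (-(c * ((n : ℝ) ^ (k - 2))⁻¹)))
          / (K * Real.exp (-(c * ((n : ℝ) ^ (k - 2))⁻¹)))) Filter.atTop (nhds 1) := by
    suffices hdiv : Filter.Tendsto (fun n : ℕ =>
        (pairW n k r n 0 1 0 / cpl n k 0 1 / (((n : ℝ) ^ (k - 2))⁻¹) ^ r
        - K * Real.exp (-(c * ((n : ℝ) ^ (k - 2))⁻¹)))
          / (K * Real.exp (-(c * ((n : ℝ) ^ (k - 2))⁻¹)))) Filter.atTop (nhds 0) by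
      simpa using hdiv.const_add 1
    have hbound := h.abs.div_const (K * Real.exp (-c))
    rw [abs_zero, zero_div] at hbound
    refine squeeze_zero_norm' ?_ hbound
    filter_upwards [Filter.eventually_gt_atTop 0] with n hn
    rw [Real.norm_eq_abs, abs_div, abs_of_pos (mul_pos hK0 (Real.exp_pos _))]
    have hy : ((n : ℝ) ^ (k - 2))⁻¹ ≤ 1 :=
      inv_le_one_of_one_le₀ (one_le_pow₀ (by exact_mod_cast hn))
    refine div_le_div_of_nonneg_left (abs_nonneg _) (by positivity) ?_
    gcongr
    exact mul_le_of_le_one_right hc0.le hy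
  refine hratio.congr' ?_
  filter_upwards [Filter.eventually_gt_atTop 0] with n hn
  have hn' : (0 : ℝ) < n := by exact_mod_cast hn
  have hfac : ((n - 1).factorial : ℝ) ≠ 0 := by exact_mod_cast (n - 1).factorial_ne_zero
  have hzpow : (n : ℝ) ^ ((2 : ℤ) - (k : ℤ)) = ((n : ℝ) ^ (k - 2))⁻¹ := by
    rw [← zpow_natCast, ← zpow_neg, Nat.cast_sub hk, neg_sub, Nat.cast_ofNat]
  have hy0 : (0 : ℝ) < ((n : ℝ) ^ (k - 2))⁻¹ := by positivity
  rw [card_filter_accSet k r hn, card_accSet k hn, mul_div_mul_left _ _ hfac, hρ, hzpow]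
  generalize ((n : ℝ) ^ (k - 2))⁻¹ = y at hy0 ⊢
  have hE := Real.exp_pos (-(c * y))
  rw [sub_div, div_self (mul_pos hK0 hE).ne', add_sub_cancel, hK, mul_pow]
  field_simp

end ArxivAutomata
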